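/- Let t′, t″, σ′ be real numbers with σ′ ≠ 0. There exists a constant C > 0 (depending only on t′, t″, σ′) such that for all σ with 1/2 ≤ σ ≤ 3/4 and all T ≥ 3 one has ∫_{−T}^{T} |ζ(σ + i(t + t′))|⁴ / ( |ζ(1 + 2it)| · |σ′ + i(t + t″)| ) dt ≤ C · (log T)^5 (log log T). -/

import Mathlib

section

open MeasureTheory FourierTransform

/-- Plancherel's theorem for integrable square-integrable functions on the line. -/
theorem memLp_two_fourier_and_integral_norm_sq_fourier {f : ℝ → ℂ} (hf : Integrable f)
    (hf2 : MemLp f 2) :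
    MemLp (𝓕 f) 2 ∧ ∫ x, ‖𝓕 f x‖ ^ 2 = ∫ x, ‖f x‖ ^ 2 := by
  set F : Lp ℂ 2 (volume : Measure ℝ) := hf2.toLp f with hF
  have hcont : Continuous (𝓕 f) := VectorFourier.fourierIntegral_continuous Real.continuous_fourierChar (L := innerₗ ℝ) continuous_inner hf
  have key : (fun x => (𝓕 F : Lp ℂ 2 (volume : Measure ℝ)) x) =ᵐ[volume] 𝓕 f := by
    refine ae_eq_of_integral_contDiff_smul_eq ?_ hcont.locallyIntegrable ?_
    · exact (Lp.memLp (𝓕 F)).locallyIntegrable (by norm_num)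
    · intro g hg hgc
      have hgc' : HasCompactSupport (fun x => (g x : ℂ)) :=
        hgc.comp_left (g := fun x : ℝ => (x : ℂ)) (by simp)
      have hg' : ContDiff ℝ (⊤ : ℕ∞) (fun x => (g x : ℂ)) :=
        Complex.ofRealCLM.contDiff.comp hg
      set G : SchwartzMap ℝ ℂ := hgc'.toSchwartzMap hg' with hG
      have hGv : ∀ x, G x = (g x : ℂ) := fun x => rfl
      have h1 := congrArg (fun D => D G) (Lp.fourier_toTemperedDistribution_eq F)
      simp only [TemperedDistribution.fourier_apply, Lp.toTemperedDistribution_apply] at h1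
      have h2 : ∫ x, (𝓕 G) x • F x = ∫ x, (𝓕 (G : ℝ → ℂ)) x • f x := by
        refine integral_congr_ae ?_
        filter_upwards [hf2.coeFn_toLp] with x hx
        rw [hx, SchwartzMap.fourier_coe]
      have h3 : ∫ x, (𝓕 (G : ℝ → ℂ)) x • f x = ∫ x, G x • 𝓕 f x := by
        have := VectorFourier.integral_fourierIntegral_smul_eq_flip (L := innerₗ ℝ)
          (μ := volume) (ν := volume) Real.continuous_fourierChar continuous_inner G.integrable hf
        rw [flip_innerₗ] at this
        exact this
      have h4 : ∫ x, g x • (𝓕 F : Lp ℂ 2 (volume : Measure ℝ)) x = ∫ x, G x • (𝓕 F : Lp ℂ 2 (volume : Measure ℝ)) x := by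
        simp [hGv]
      have h5 : ∫ x, g x • 𝓕 f x = ∫ x, G x • 𝓕 f x := by
        simp [hGv]
      rw [h4, h5, ← h1, h2, h3]
  have hmem : MemLp (𝓕 f) 2 := (memLp_congr_ae key).1 (Lp.memLp (𝓕 F))
  refine ⟨hmem, ?_⟩
  have hn : ∀ (h : ℝ → ℂ), MemLp h 2 → ∫ x, ‖h x‖ ^ 2 = (eLpNorm h 2).toReal ^ 2 := by
    intro h hh
    rw [hh.eLpNorm_eq_integral_rpow_norm (by norm_num) (by norm_num)]
    have h0 : 0 ≤ ∫ x, ‖h x‖ ^ 2 := integral_nonneg fun x => by positivity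
    rw [ENNReal.toReal_ofReal (by positivity)]
    simp only [ENNReal.toReal_ofNat, Real.rpow_ofNat]
    rw [← Real.rpow_natCast, ← Real.rpow_mul h0]
    norm_num
  rw [hn _ hmem, hn _ hf2, ← eLpNorm_congr_ae key, ← Lp.norm_def, Lp.norm_fourier_eq, hF,
    Lp.norm_toLp]

end

section

open MeasureTheory Set Filter Topology

/-- Euler's integral with a complex rate. -/
theorem integral_cpow_mul_cexp_neg_mul_Ioi {s r : ℂ} (hs : 0 < s.re) (hr : 0 < r.re) :
    ∫ x : ℝ in Ioi 0, (x : ℂ) ^ (s - 1) * Complex.exp (-(r * x)) =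
      (1 / r) ^ s * Complex.Gamma s := by
  have hU : IsOpen {z : ℂ | 0 < z.re} := isOpen_lt continuous_const Complex.continuous_re
  have hmeas : ∀ z : ℂ, AEStronglyMeasurable
      (fun x : ℝ => (x : ℂ) ^ (s - 1) * Complex.exp (-(z * x))) (volume.restrict (Ioi 0)) := by
    intro z
    refine ContinuousOn.aestronglyMeasurable ?_ measurableSet_Ioi
    refine ContinuousOn.mul ?_ (by fun_prop)
    intro x hx
    exact (Complex.continuousAt_ofReal_cpow_const _ _ (Or.inr (ne_of_gt hx))).continuousWithinAt
  have h_int : ∀ (a b : ℝ), 0 < a → 0 < b →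
      IntegrableOn (fun x : ℝ => x ^ (a - 1) * Real.exp (-(b * x))) (Ioi 0) := by
    intro a b ha hb
    have := integrableOn_rpow_mul_exp_neg_mul_rpow (p := 1) (s := a - 1) (b := b) (by linarith)
      one_pos hb
    simpa using this
  have hnorm : ∀ (z : ℂ) (x : ℝ), x ∈ Ioi (0:ℝ) →
      ‖(x : ℂ) ^ (s - 1) * Complex.exp (-(z * x))‖ = x ^ (s.re - 1) * Real.exp (-(z.re * x)) := by
    intro z x hx
    rw [norm_mul, Complex.norm_cpow_eq_rpow_re_of_pos hx, Complex.norm_exp]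
    simp
  have hf : DifferentiableOn ℂ (fun z : ℂ =>
      ∫ x : ℝ in Ioi 0, (x : ℂ) ^ (s - 1) * Complex.exp (-(z * x))) {z : ℂ | 0 < z.re} := by
    intro z hz
    have hz' : 0 < z.re := hz
    have hnhds : {w : ℂ | z.re / 2 < w.re} ∈ 𝓝 z :=
      (isOpen_lt continuous_const Complex.continuous_re).mem_nhds (by simp; linarith)
    have := hasDerivAt_integral_of_dominated_loc_of_deriv_le (μ := volume.restrict (Ioi (0:ℝ)))
      (F := fun (z : ℂ) (x : ℝ) => (x : ℂ) ^ (s - 1) * Complex.exp (-(z * x)))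
      (F' := fun (z : ℂ) (x : ℝ) => (x : ℂ) ^ (s - 1) * (Complex.exp (-(z * x)) * (-x)))
      (bound := fun x => x ^ (s.re + 1 - 1) * Real.exp (-(z.re / 2 * x)))
      (x₀ := z) hnhds (Eventually.of_forall hmeas) ?_ ?_ ?_ ?_ ?_
    · exact this.2.differentiableAt.differentiableWithinAt
    · refine ((h_int s.re z.re hs hz').mono' (hmeas z) ?_)
      filter_upwards [ae_restrict_mem measurableSet_Ioi] with x hx
      rw [hnorm z x hx]
    · have := (hmeas z).mul (Complex.continuous_ofReal.neg.aestronglyMeasurable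
        (μ := volume.restrict (Ioi (0:ℝ))))
      refine this.congr (Eventually.of_forall fun x => ?_)
      simp [mul_assoc]
    · filter_upwards [ae_restrict_mem measurableSet_Ioi] with x hx w hw
      have hx0 : (0:ℝ) < x := hx
      rw [← mul_assoc, norm_mul, hnorm w x hx, norm_neg, Complex.norm_real, Real.norm_of_nonneg hx0.le,
        show s.re + 1 - 1 = (s.re - 1) + 1 by ring, Real.rpow_add_one hx0.ne']
      have hw' : z.re / 2 < w.re := hw
      have : Real.exp (-(w.re * x)) ≤ Real.exp (-(z.re / 2 * x)) := by
        apply Real.exp_le_exp.2; nlinarith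
      have h3 : 0 ≤ x ^ (s.re - 1) * x := by positivity
      nlinarith
    · exact h_int (s.re + 1) (z.re / 2) (by linarith) (by linarith)
    · filter_upwards with x w hw
      refine HasDerivAt.const_mul _ ?_
      have h1 : HasDerivAt (fun w : ℂ => w * (-(x:ℂ))) (-(x:ℂ)) w := hasDerivAt_mul_const _
      have h2 := h1.cexp
      simpa only [mul_neg] using h2
  have hg : DifferentiableOn ℂ (fun z : ℂ => (1 / z) ^ s * Complex.Gamma s) {z : ℂ | 0 < z.re} := by
    intro z hz
    have hz' : 0 < z.re := hz
    have hz0 : z ≠ 0 := by rintro rfl; simp at hz'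
    refine DifferentiableAt.differentiableWithinAt ?_
    refine DifferentiableAt.mul_const ?_ _
    refine DifferentiableAt.cpow_const (by fun_prop (disch := exact hz0)) (Or.inl ?_)
    simp only [one_div, Complex.inv_re]
    exact div_pos hz' (Complex.normSq_pos.2 hz0)
  have hconv : Convex ℝ {z : ℂ | 0 < z.re} := convex_halfSpace_re_gt 0
  have := (hf.analyticOnNhd hU).eqOn_of_preconnected_of_frequently_eq (hg.analyticOnNhd hU)
    hconv.isPreconnected (z₀ := 1) (by simp) ?_
  · exact this hr
  · have htend : Tendsto (fun n : ℕ => (1 : ℂ) + 1 / ((n : ℂ) + 1)) atTop (𝓝[≠] 1) := by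
      refine tendsto_nhdsWithin_iff.2 ⟨?_, Eventually.of_forall fun n => ?_⟩
      · simpa using (tendsto_const_nhds (x := (1:ℂ))).add tendsto_one_div_add_atTop_nhds_zero_nat
      · simp only [mem_compl_iff, mem_singleton_iff, add_eq_left]
        exact one_div_ne_zero (Nat.cast_add_one_ne_zero n)
    refine htend.frequently (Eventually.frequently (Eventually.of_forall fun n => ?_))
    have := Complex.integral_cpow_mul_exp_neg_mul_Ioi (a := s) (r := 1 + 1 / ((n:ℝ) + 1)) hs (by positivity)
    rw [show ((1 : ℂ) + 1 / ((n : ℂ) + 1)) = ((1 + 1 / ((n:ℝ) + 1) : ℝ) : ℂ) by push_cast; ring]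
    simpa using this

/-- The Mellin transform in logarithmic coordinates. -/
noncomputable def logMellin (σ : ℝ) (h : ℝ → ℂ) (u : ℝ) : ℂ :=
  Real.exp (-σ * u) • h (Real.exp (-u))

theorem continuous_logMellin {σ : ℝ} {h : ℝ → ℂ} (hc : ContinuousOn h (Ioi 0)) :
    Continuous (logMellin σ h) := by
  have h0 : Continuous fun u : ℝ => Real.exp (-σ * u) := by fun_prop
  refine h0.smul ?_
  exact hc.comp_continuous (by fun_prop) (fun u => Real.exp_pos _)

theorem norm_logMellin_le {σ M c : ℝ} {h : ℝ → ℂ} (hσ : 0 < σ) (hσ1 : σ ≤ 1) (hc0 : 0 < c)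
    (hb : ∀ x, 0 < x → ‖h x‖ ≤ M * Real.exp (-(c * x))) :
    ∃ K, ∀ u, ‖logMellin σ h u‖ ≤ K * (1 + u ^ 2)⁻¹ := by
  have hM : 0 ≤ M := by
    have := (norm_nonneg _).trans (hb 1 one_pos)
    exact nonneg_of_mul_nonneg_left this (Real.exp_pos _)
  have quad : ∀ (a v : ℝ), 0 < a → 0 ≤ v → Real.exp (-(a * v)) ≤ (1 + 2 / a ^ 2) * (1 + v ^ 2)⁻¹ := by
    intro a v ha hv
    have h1 : 1 + (a * v) + (a * v) ^ 2 / 2 ≤ Real.exp (a * v) :=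
      Real.quadratic_le_exp_of_nonneg (by positivity)
    rw [Real.exp_neg, ← div_eq_mul_inv, inv_eq_one_div, div_le_div_iff₀ (Real.exp_pos _) (by positivity)]
    have h2 : (1 + 2 / a ^ 2) * (1 + (a * v) ^ 2 / 2) ≥ 1 + v ^ 2 := by
      have : (1 + 2 / a ^ 2) * (1 + (a * v) ^ 2 / 2) = 1 + v ^ 2 + 2 / a ^ 2 + (a * v) ^ 2 / 2 := by
        field_simp; ring
      rw [this]; have : 0 ≤ 2 / a ^ 2 := by positivity
      nlinarith [sq_nonneg (a * v)]
    have h3 : (1 + 2 / a ^ 2) * (1 + (a * v) ^ 2 / 2) ≤ (1 + 2 / a ^ 2) * Real.exp (a * v) := by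
      gcongr; have : 0 ≤ a * v := by positivity
      linarith
    linarith
  refine ⟨M * (1 + 2 / σ ^ 2) + M * (2 / c ^ 2) * (1 + 2 / 1 ^ 2), fun u => ?_⟩
  have e1 : ‖logMellin σ h u‖ ≤ Real.exp (-σ * u) * (M * Real.exp (-(c * Real.exp (-u)))) := by
    rw [logMellin, norm_smul, Real.norm_of_nonneg (Real.exp_pos _).le]
    gcongr
    exact hb _ (Real.exp_pos _)
  refine e1.trans ?_
  have hinv : 0 ≤ (1 + u ^ 2)⁻¹ := by positivity
  rcases le_total 0 u with hu | hu
  · have h1 := quad σ u hσ hu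
    have h2 : Real.exp (-(c * Real.exp (-u))) ≤ 1 := by
      rw [Real.exp_le_one_iff]; have := Real.exp_pos (-u); nlinarith
    calc Real.exp (-σ * u) * (M * Real.exp (-(c * Real.exp (-u))))
        ≤ ((1 + 2 / σ ^ 2) * (1 + u ^ 2)⁻¹) * (M * 1) := by
          gcongr; rw [neg_mul]; exact h1
      _ ≤ _ := by
          have : 0 ≤ M * (2 / c ^ 2) * (1 + 2 / 1 ^ 2) * (1 + u ^ 2)⁻¹ := by positivity
          nlinarith
  · have h1 := quad 1 (-u) one_pos (by linarith)
    simp only [one_mul, neg_neg, even_two, Even.neg_pow] at h1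
    set y := Real.exp (-u) with hy
    have hy0 : 0 < y := Real.exp_pos _
    have h2 : Real.exp (-σ * u) ≤ y := by
      apply Real.exp_le_exp.2; nlinarith
    have h3 : Real.exp (-(c * y)) ≤ 2 / (c * y) ^ 2 := by
      have : 1 + (c * y) + (c * y) ^ 2 / 2 ≤ Real.exp (c * y) :=
        Real.quadratic_le_exp_of_nonneg (by positivity)
      rw [Real.exp_neg, inv_eq_one_div, div_le_div_iff₀ (Real.exp_pos _) (by positivity)]
      nlinarith [mul_pos hc0 hy0]
    calc Real.exp (-σ * u) * (M * Real.exp (-(c * y)))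
        ≤ y * (M * (2 / (c * y) ^ 2)) := by gcongr
      _ = M * (2 / c ^ 2) * Real.exp u := by
          have : Real.exp u = y⁻¹ := by rw [hy, Real.exp_neg, inv_inv]
          rw [this]; field_simp
      _ ≤ M * (2 / c ^ 2) * ((1 + 2 / 1 ^ 2) * (1 + u ^ 2)⁻¹) := by gcongr
      _ ≤ _ := by
          have : 0 ≤ M * (1 + 2 / σ ^ 2) * (1 + u ^ 2)⁻¹ := by positivity
          nlinarith

theorem integrable_logMellin {σ M c : ℝ} {h : ℝ → ℂ} (hσ : 0 < σ) (hσ1 : σ ≤ 1) (hc0 : 0 < c)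
    (hc : ContinuousOn h (Ioi 0)) (hb : ∀ x, 0 < x → ‖h x‖ ≤ M * Real.exp (-(c * x))) :
    Integrable (logMellin σ h) ∧ MemLp (logMellin σ h) 2 := by
  obtain ⟨K, hK⟩ := norm_logMellin_le hσ hσ1 hc0 hb
  have hm := (continuous_logMellin (σ := σ) hc).aestronglyMeasurable (μ := volume)
  have hI : Integrable (logMellin σ h) :=
    (integrable_inv_one_add_sq.const_mul K).mono' hm (Eventually.of_forall hK)
  refine ⟨hI, (memLp_two_iff_integrable_sq_norm hm).2 ?_⟩
  have hK0 : 0 ≤ K := by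
    have := (norm_nonneg _).trans (hK 0); simpa using this
  refine ((integrable_inv_one_add_sq.const_mul (K ^ 2))).mono' (hm.norm.pow 2)
    (Eventually.of_forall fun u => ?_)
  rw [Real.norm_of_nonneg (by positivity)]
  have h1 : (1 + u ^ 2)⁻¹ ≤ 1 := inv_le_one_of_one_le₀ (by nlinarith [sq_nonneg u])
  have h0 : 0 ≤ (1 + u ^ 2)⁻¹ := by positivity
  calc ‖logMellin σ h u‖ ^ 2 ≤ (K * (1 + u ^ 2)⁻¹) ^ 2 := by gcongr; exact hK u
    _ = K ^ 2 * ((1 + u ^ 2)⁻¹ * (1 + u ^ 2)⁻¹) := by ring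
    _ ≤ K ^ 2 * ((1 + u ^ 2)⁻¹ * 1) := by gcongr
    _ = _ := by ring

theorem mellin_eq_fourier_logMellin (h : ℝ → ℂ) (σ t : ℝ) : mellin h (σ + t * Complex.I) =
    FourierTransform.fourier (logMellin σ h) (t / (2 * Real.pi)) := by
  have h1 : ((σ : ℂ) + t * Complex.I).re = σ := by simp
  have h2 : ((σ : ℂ) + t * Complex.I).im = t := by simp
  rw [mellin_eq_fourier, h1, h2]
  rfl

theorem integral_norm_sq_logMellin {σ M c : ℝ} {h : ℝ → ℂ} (hσ : 0 < σ) (hσ1 : σ ≤ 1) (hc0 : 0 < c)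
    (hc : ContinuousOn h (Ioi 0)) (hb : ∀ x, 0 < x → ‖h x‖ ≤ M * Real.exp (-(c * x))) :
    Integrable (fun t : ℝ => ‖mellin h (σ + t * Complex.I)‖ ^ 2) ∧
    ∫ t : ℝ, ‖mellin h (σ + t * Complex.I)‖ ^ 2 = 2 * Real.pi * ∫ u, ‖logMellin σ h u‖ ^ 2 := by
  obtain ⟨h1, h2⟩ := integrable_logMellin hσ hσ1 hc0 hc hb
  obtain ⟨p1, p2⟩ := memLp_two_fourier_and_integral_norm_sq_fourier h1 h2
  have hpi := Real.pi_pos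
  have key : ∀ t : ℝ, mellin h (σ + t * Complex.I) =
      FourierTransform.fourier (logMellin σ h) (t / (2 * Real.pi)) := by
    intro t
    exact mellin_eq_fourier_logMellin h σ t
  have hi := (memLp_two_iff_integrable_sq_norm p1.1).1 p1
  constructor
  · simp_rw [key]
    exact hi.comp_div (by positivity)
  · simp_rw [key]
    rw [Measure.integral_comp_div (fun x => ‖FourierTransform.fourier (logMellin σ h) x‖ ^ 2) (2 * Real.pi), p2,
      abs_of_pos (by positivity), smul_eq_mul]

/-- If the Fourier transform of `φ` is almost invariant under conjugation and modulation, the mass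
of `φ` on a half line is controlled by its mass on the opposite half line. -/
theorem setIntegral_Ioi_norm_sq_le_of_fourier {φ φ₀ : ℝ → ℂ} (h1 : Integrable φ) (h2 : MemLp φ 2)
    (k1 : Integrable φ₀) (k2 : MemLp φ₀ 2) (ω : ℂ) (hω : ‖ω‖ = 1) (a : ℝ)
    (h : ∀ ξ : ℝ, ‖FourierTransform.fourier φ ξ - ω * Complex.exp (2 * Real.pi * Complex.I * (a * ξ)) *
      (starRingEnd ℂ) (FourierTransform.fourier φ ξ)‖ ≤ 2 * ‖FourierTransform.fourier φ₀ ξ‖) :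
    ∫ u in Ioi (-a / 2), ‖φ u‖ ^ 2 ≤
      2 * (∫ u in Iic (-a / 2), ‖φ u‖ ^ 2) + 8 * ∫ u, ‖φ₀ u‖ ^ 2 := by
  set ρ : ℝ → ℂ := fun u => ω * (starRingEnd ℂ) (φ (-a - u)) with hρ
  have i1 : Integrable fun u => φ (-a - u) := h1.comp_sub_left (-a)
  have hmp : MeasurePreserving (fun u : ℝ => -a - u) volume volume :=
    Measure.measurePreserving_sub_left volume (-a)
  have i2 : MemLp (fun u => φ (-a - u)) 2 := h2.comp_measurePreserving hmp
  have r1 : Integrable ρ := by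
    refine Integrable.const_mul ?_ ω
    exact (Complex.conjCLE.toContinuousLinearMap.integrable_comp i1)
  have hρn : ∀ u, ‖ρ u‖ = ‖φ (-a - u)‖ := by intro u; simp [hρ, hω]
  have r2 : MemLp ρ 2 := by
    refine MemLp.of_le i2 r1.1 (Eventually.of_forall fun u => (hρn u).le)
  have hF : ∀ ξ : ℝ, FourierTransform.fourier ρ ξ = ω * Complex.exp (2 * Real.pi * Complex.I * (a * ξ)) *
      (starRingEnd ℂ) (FourierTransform.fourier φ ξ) := by
    intro ξ
    rw [Real.fourier_real_eq_integral_exp_smul, Real.fourier_real_eq_integral_exp_smul,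
      ← integral_conj, ← integral_const_mul,
      ← integral_sub_left_eq_self (fun v => Complex.exp (↑(-2 * Real.pi * v * ξ) * Complex.I) • ρ v) volume (-a)]
    congr 1
    funext v
    simp only [hρ, smul_eq_mul, map_mul, sub_sub_cancel]
    rw [← Complex.exp_conj]
    have : Complex.exp (((-2 * Real.pi * (-a - v) * ξ : ℝ) : ℂ) * Complex.I) =
        Complex.exp (2 * Real.pi * Complex.I * (a * ξ)) *
        Complex.exp ((starRingEnd ℂ) (((-2 * Real.pi * v * ξ : ℝ) : ℂ) * Complex.I)) := by
      rw [← Complex.exp_add]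
      congr 1
      simp only [map_mul, Complex.conj_ofReal, Complex.conj_I]
      push_cast; ring
    rw [this]; ring
  set ψ : ℝ → ℂ := fun u => φ u - ρ u with hψ
  have s1 : Integrable ψ := h1.sub r1
  have s2 : MemLp ψ 2 := h2.sub r2
  have hFψ : ∀ ξ, FourierTransform.fourier ψ ξ = FourierTransform.fourier φ ξ - FourierTransform.fourier ρ ξ := by
    intro ξ
    rw [Real.fourier_real_eq, Real.fourier_real_eq, Real.fourier_real_eq, ← integral_sub]
    · congr 1; funext v; simp [hψ, smul_sub]
    · simpa [mul_comm] using (Real.fourierIntegral_convergent_iff ξ).2 h1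
    · simpa [mul_comm] using (Real.fourierIntegral_convergent_iff ξ).2 r1
  obtain ⟨p1, p2⟩ := memLp_two_fourier_and_integral_norm_sq_fourier s1 s2
  obtain ⟨q1, q2⟩ := memLp_two_fourier_and_integral_norm_sq_fourier k1 k2
  have t1 : ∫ u, ‖ψ u‖ ^ 2 ≤ 4 * ∫ u, ‖φ₀ u‖ ^ 2 := by
    rw [← p2, ← q2, ← integral_const_mul]
    refine integral_mono ((memLp_two_iff_integrable_sq_norm p1.1).1 p1)
      (((memLp_two_iff_integrable_sq_norm q1.1).1 q1).const_mul 4) fun ξ => ?_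
    have := h ξ
    rw [← hF, ← hFψ] at this
    have h0 := norm_nonneg (FourierTransform.fourier ψ ξ)
    calc ‖FourierTransform.fourier ψ ξ‖ ^ 2 ≤ (2 * ‖FourierTransform.fourier φ₀ ξ‖) ^ 2 := by gcongr
      _ = _ := by ring
  have iψ := (memLp_two_iff_integrable_sq_norm s2.1).1 s2
  have iρ := (memLp_two_iff_integrable_sq_norm r2.1).1 r2
  have iφ := (memLp_two_iff_integrable_sq_norm h2.1).1 h2
  have t2 : ∫ u in Ioi (-a / 2), ‖φ u‖ ^ 2 ≤
      ∫ u in Ioi (-a / 2), (2 * ‖ρ u‖ ^ 2 + 2 * ‖ψ u‖ ^ 2) := by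
    refine setIntegral_mono iφ.integrableOn ((iρ.const_mul 2).add (iψ.const_mul 2)).integrableOn
      fun u => ?_
    have : ‖φ u‖ ≤ ‖ρ u‖ + ‖ψ u‖ := by
      have := norm_add_le (ρ u) (ψ u)
      simpa [hψ] using this
    have h0 := norm_nonneg (φ u)
    calc ‖φ u‖ ^ 2 ≤ (‖ρ u‖ + ‖ψ u‖) ^ 2 := by gcongr
      _ ≤ _ := by nlinarith [sq_nonneg (‖ρ u‖ - ‖ψ u‖)]
  have t3 : ∫ u in Ioi (-a / 2), ‖ρ u‖ ^ 2 = ∫ u in Iic (-a / 2), ‖φ u‖ ^ 2 := by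
    simp_rw [hρn]
    rw [integral_Iic_eq_integral_Iio]
    have := hmp.setIntegral_preimage_emb (Homeomorph.subLeft (-a)).measurableEmbedding
      (fun u => ‖φ u‖ ^ 2) (Iio (-a / 2))
    rw [← this]
    congr 2
    ext u; simp only [mem_Ioi, mem_preimage, mem_Iio]
    constructor <;> intro h <;> linarith
  have t4 : ∫ u in Ioi (-a / 2), ‖ψ u‖ ^ 2 ≤ ∫ u, ‖ψ u‖ ^ 2 :=
    setIntegral_le_integral iψ (Eventually.of_forall fun u => by positivity)
  rw [integral_add (iρ.const_mul 2).integrableOn (iψ.const_mul 2).integrableOn, integral_const_mul,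
    integral_const_mul, t3] at t2
  linarith

/-- The coefficients of the Dirichlet eta function. -/
noncomputable def etaCoeff (n : ℕ) : ℂ := (-1) ^ (n + 1)

/-- The coefficients of the square of the Dirichlet eta function. -/
noncomputable def etaSqCoeff (n : ℕ) : ℂ := ∑ p ∈ n.divisorsAntidiagonal, etaCoeff p.1 * etaCoeff p.2

theorem norm_etaCoeff (n : ℕ) : ‖etaCoeff n‖ = 1 := by simp [etaCoeff]

theorem norm_etaSqCoeff_le (n : ℕ) : ‖etaSqCoeff n‖ ≤ n.divisors.card := by
  refine (norm_sum_le _ _).trans ?_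
  rw [← Nat.map_div_right_divisors]
  simp [norm_etaCoeff]

theorem etaSqCoeff_zero : etaSqCoeff 0 = 0 := by simp [etaSqCoeff]

theorem tsum_etaSqCoeff_mul_pow {q : ℂ} (hq : ‖q‖ < 1) :
    ∑' n : ℕ, etaSqCoeff n * q ^ n = ∑' k : ℕ, (-1) ^ k * (q ^ (k + 1) / (1 + q ^ (k + 1))) := by
  have hs0 : Summable fun c : ℕ+ × ℕ+ => etaCoeff c.1 * etaCoeff c.2 * q ^ (c.1 * c.2 : ℕ) := by
    have := summable_prod_mul_pow (𝕜 := ℂ) 0 hq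
    refine Summable.of_norm ?_
    have h2 := this.norm
    refine h2.congr fun c => ?_
    simp [norm_etaCoeff]
  have e1 : ∑' n : ℕ, etaSqCoeff n * q ^ n = ∑' n : ℕ+, etaSqCoeff n * q ^ (n : ℕ) := by
    refine (PNat.coe_injective.tsum_eq (f := fun n : ℕ => etaSqCoeff n * q ^ n) ?_).symm
    intro n hn
    rcases Nat.eq_zero_or_pos n with rfl | h
    · simp [etaSqCoeff_zero] at hn
    · exact ⟨⟨n, h⟩, rfl⟩
  rw [e1]
  have e2 : ∑' c : ℕ+ × ℕ+, etaCoeff c.1 * etaCoeff c.2 * q ^ (c.1 * c.2 : ℕ) =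
      ∑' n : ℕ+, etaSqCoeff n * q ^ (n : ℕ) := by
    rw [← sigmaAntidiagonalEquivProd.tsum_eq]
    have hs1 := (sigmaAntidiagonalEquivProd.summable_iff).2 hs0
    refine (Summable.tsum_sigma hs1).trans (tsum_congr fun n => ?_)
    rw [tsum_fintype, Finset.univ_eq_attach, etaSqCoeff, Finset.sum_mul]
    rw [← Finset.sum_attach (n : ℕ).divisorsAntidiagonal]
    refine Finset.sum_congr rfl fun p hp => ?_
    have := (Nat.mem_divisorsAntidiagonal.1 p.2).1
    simp only [sigmaAntidiagonalEquivProd, divisorsAntidiagonalFactors, Equiv.coe_fn_mk, PNat.mk_coe, Function.comp]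
    rw [this]
  rw [← e2, hs0.tsum_prod]
  rw [tsum_pnat_eq_tsum_succ (f := fun k : ℕ => ∑' c : ℕ+, etaCoeff k * etaCoeff c * q ^ (k * c : ℕ))]
  refine tsum_congr fun k => ?_
  have hk : ‖-q ^ (k + 1)‖ < 1 := by
    rw [norm_neg, norm_pow]; exact pow_lt_one₀ (norm_nonneg _) hq (by simp)
  rw [tsum_pnat_eq_tsum_succ (f := fun c : ℕ => etaCoeff (k+1) * etaCoeff c * q ^ ((k+1) * c : ℕ))]
  have := tsum_geometric_of_norm_lt_one hk
  rw [sub_neg_eq_add] at this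
  rw [div_eq_mul_inv, ← this, ← tsum_mul_left, ← tsum_mul_left]
  refine tsum_congr fun j => ?_
  rw [neg_pow (q ^ (k+1)), etaCoeff, etaCoeff]
  ring

theorem one_sub_exp_le_norm_one_add_cexp {w : ℂ} (hw : ‖w‖ = 1) (hc : 0 < w.re) {r : ℝ} (hr : 0 ≤ r) :
    1 - Real.exp (-w.re) ≤ ‖1 + Complex.exp (-(r * w))‖ := by
  have hn : ‖Complex.exp (-(r * w))‖ = Real.exp (-(r * w.re)) := by simp [Complex.norm_exp]
  rcases le_total r 1 with h1 | h1
  · have him : |r * w.im| ≤ 1 := by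
      rw [abs_mul, abs_of_nonneg hr]
      have := Complex.abs_im_le_norm w
      rw [hw] at this
      nlinarith [abs_nonneg w.im]
    have hre : 0 ≤ (Complex.exp (-(r * w))).re := by
      rw [Complex.exp_re]
      refine mul_nonneg (Real.exp_pos _).le ?_
      have : (-(r * w)).im = -(r * w.im) := by simp
      rw [this, Real.cos_neg]
      have hpi := Real.pi_gt_three
      rw [abs_le] at him
      exact Real.cos_nonneg_of_neg_pi_div_two_le_of_le (by linarith) (by linarith)
    have := Complex.re_le_norm (1 + Complex.exp (-(r * w)))
    rw [Complex.add_re, Complex.one_re] at this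
    have := Real.exp_pos (-w.re)
    linarith
  · have := norm_sub_norm_le (1 : ℂ) (-Complex.exp (-(r * w)))
    rw [norm_neg, hn, norm_one, sub_neg_eq_add] at this
    have h2 : Real.exp (-(r * w.re)) ≤ Real.exp (-w.re) := by
      apply Real.exp_le_exp.2; nlinarith
    linarith

/-- The Lambert series attached to the square of the Dirichlet eta function, along a ray. -/
noncomputable def etaLambert (w : ℂ) (x : ℝ) : ℂ := ∑' n : ℕ, etaSqCoeff n * Complex.exp (-(n * x * w))

theorem norm_cexp_neg_mul_lt_one {w : ℂ} (hc : 0 < w.re) {x : ℝ} (hx : 0 < x) :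
    ‖Complex.exp (-(x * w))‖ < 1 := by
  rw [Complex.norm_exp, Real.exp_lt_one_iff]
  simp; positivity

theorem etaLambert_eq_pow (w : ℂ) (x : ℝ) :
    etaLambert w x = ∑' n : ℕ, etaSqCoeff n * Complex.exp (-(x * w)) ^ n := by
  unfold etaLambert
  refine tsum_congr fun n => ?_
  rw [← Complex.exp_nat_mul]; congr 2; ring

theorem norm_logistic_sub_le {w : ℂ} (hw : ‖w‖ = 1) (hc : 0 < w.re) {a b : ℝ} (ha : 0 ≤ a) (hab : a ≤ b) :
    ‖Complex.exp (-(a * w)) / (1 + Complex.exp (-(a * w))) -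
      Complex.exp (-(b * w)) / (1 + Complex.exp (-(b * w)))‖ ≤
      Real.exp (-(a * w.re)) / (1 - Real.exp (-w.re)) ^ 2 * (b - a) := by
  have hb0 : 0 < 1 - Real.exp (-w.re) := by
    rw [sub_pos, Real.exp_lt_one_iff]; linarith
  have hne : ∀ r : ℝ, 0 ≤ r → 1 + Complex.exp (-(r * w)) ≠ 0 := fun r hr h => by
    have := one_sub_exp_le_norm_one_add_cexp hw hc hr
    rw [h, norm_zero] at this; linarith
  have hd : ∀ r ∈ Icc a b, HasDerivWithinAt
      (fun r : ℝ => Complex.exp (-(r * w)) / (1 + Complex.exp (-(r * w))))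
      ((Complex.exp (-(r * w)) * (-w) * (1 + Complex.exp (-(r * w))) -
        Complex.exp (-(r * w)) * (Complex.exp (-(r * w)) * (-w))) /
        (1 + Complex.exp (-(r * w))) ^ 2) (Icc a b) r := by
    intro r hr
    have h1 : HasDerivAt (fun r : ℝ => (r : ℂ) * (-w)) (-w) r := by
      simpa using (HasDerivAt.ofReal_comp (hasDerivAt_id r)).mul_const (-w)
    have h2 : HasDerivAt (fun r : ℝ => Complex.exp (-(r * w))) (Complex.exp (-(r * w)) * (-w)) r := by
      simpa only [mul_neg] using h1.cexp
    exact (h2.div (h2.const_add 1) (hne r (ha.trans hr.1))).hasDerivWithinAt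
  have := Convex.norm_image_sub_le_of_norm_hasDerivWithin_le hd
    (C := Real.exp (-(a * w.re)) / (1 - Real.exp (-w.re)) ^ 2) ?_ (convex_Icc a b)
    (right_mem_Icc.2 hab) (left_mem_Icc.2 hab)
  · refine this.trans (le_of_eq ?_)
    rw [Real.norm_eq_abs, abs_of_nonpos (by linarith)]; ring
  · intro r hr
    rw [show (Complex.exp (-(r * w)) * (-w) * (1 + Complex.exp (-(r * w))) -
        Complex.exp (-(r * w)) * (Complex.exp (-(r * w)) * (-w))) = -(Complex.exp (-(r * w)) * w) by ring]
    rw [norm_div, norm_neg, norm_mul, hw, mul_one, norm_pow]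
    have h1 := one_sub_exp_le_norm_one_add_cexp hw hc (ha.trans hr.1)
    have h2 : ‖Complex.exp (-(r * w))‖ ≤ Real.exp (-(a * w.re)) := by
      rw [Complex.norm_exp]; apply Real.exp_le_exp.2
      simp; nlinarith [hr.1]
    gcongr

theorem mul_exp_mul_inv_one_sub_le {c b x : ℝ} (hc : 0 < c) (hb : 0 < b) (hx : 0 < x) :
    Real.exp (-(x * c)) / b ^ 2 * x * (1 - Real.exp (-(x * c)) ^ 2)⁻¹ ≤
      2 / (c * b ^ 2) * Real.exp (-(c / 2 * x)) := by
  have hy : 0 < c * x := by positivity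
  have h4 : 2 * (c * x) / (1 + 2 * (c * x)) ≤ 1 - Real.exp (-(x * c)) ^ 2 := by
    have h5 := Real.add_one_le_exp (2 * (c * x))
    have : Real.exp (-(x * c)) ^ 2 ≤ 1 / (1 + 2 * (c * x)) := by
      rw [← Real.exp_nat_mul, show ((2 : ℕ) : ℝ) * -(x * c) = -(2 * (c * x)) by push_cast; ring,
        Real.exp_neg, one_div]
      exact inv_anti₀ (by positivity) (by linarith)
    have h6 : 2 * (c * x) / (1 + 2 * (c * x)) = 1 - 1 / (1 + 2 * (c * x)) := by field_simp; ring
    linarith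
  have h7 : (1 - Real.exp (-(x * c)) ^ 2)⁻¹ ≤ (1 + 2 * (c * x)) / (2 * (c * x)) := by
    rw [← inv_div]; exact inv_anti₀ (by positivity) h4
  have h8 : 1 + 2 * (c * x) ≤ 4 * Real.exp (c / 2 * x) := by
    have := Real.add_one_le_exp (c / 2 * x); linarith
  have h9 : (1 - Real.exp (-(x * c)) ^ 2)⁻¹ ≤ (4 * Real.exp (c / 2 * x)) / (2 * (c * x)) :=
    h7.trans (by gcongr)
  calc Real.exp (-(x * c)) / b ^ 2 * x * (1 - Real.exp (-(x * c)) ^ 2)⁻¹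
      ≤ Real.exp (-(x * c)) / b ^ 2 * x * ((4 * Real.exp (c / 2 * x)) / (2 * (c * x))) := by
        gcongr
    _ = 2 / (c * b ^ 2) * (Real.exp (-(x * c)) * Real.exp (c / 2 * x)) := by
        field_simp; norm_num
    _ = _ := by rw [← Real.exp_add]; congr 2; ring

theorem tsum_eq_tsum_even_add_odd (f : ℕ → ℂ) (hf : Summable f) :
    ∑' k, f k = ∑' k, (f (2 * k) + f (2 * k + 1)) := by
  have hE : Summable fun k => f (2 * k) := hf.comp_injective fun a b h => by simpa using h
  have hO : Summable fun k => f (2 * k + 1) := hf.comp_injective fun a b h => by simpa using h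
  rw [← tsum_even_add_odd hE hO, hE.tsum_add hO]

theorem exists_norm_etaLambert_le {w : ℂ} (hw : ‖w‖ = 1) (hc : 0 < w.re) :
    ∃ M, ∀ x : ℝ, 0 < x → ‖etaLambert w x‖ ≤ M * Real.exp (-(w.re / 2 * x)) := by
  obtain ⟨b, hb⟩ : ∃ b, b = 1 - Real.exp (-w.re) := ⟨_, rfl⟩
  have hb0 : 0 < b := by
    rw [hb, sub_pos, Real.exp_lt_one_iff]; linarith
  refine ⟨2 / (w.re * b ^ 2), fun x hx => ?_⟩
  refine le_trans ?_ (mul_exp_mul_inv_one_sub_le hc hb0 hx)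
  obtain ⟨g, hg⟩ : ∃ g : ℝ → ℂ, ∀ r : ℝ, g r = Complex.exp (-(r * w)) / (1 + Complex.exp (-(r * w))) :=
    ⟨_, fun _ => rfl⟩
  obtain ⟨ρ, hρ⟩ : ∃ ρ, ρ = Real.exp (-(x * w.re)) := ⟨_, rfl⟩
  have hpow : ∀ k : ℕ, Complex.exp (-(x * w)) ^ (k + 1) /
      (1 + Complex.exp (-(x * w)) ^ (k + 1)) = g ((k + 1) * x) := by
    intro k
    rw [hg, ← Complex.exp_nat_mul]
    have : (((k + 1 : ℕ) : ℂ) * -(x * w)) = (-(((k + 1) * x : ℝ) * w)) := by push_cast; ring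
    rw [this]
  rw [etaLambert_eq_pow, tsum_etaSqCoeff_mul_pow (norm_cexp_neg_mul_lt_one hc hx)]
  simp_rw [hpow]
  rw [← hρ]
  have hρ1 : ρ < 1 := by rw [hρ, Real.exp_lt_one_iff]; nlinarith
  have hρ0 : 0 < ρ := hρ ▸ Real.exp_pos _
  have hexp : ∀ k : ℕ, Real.exp (-(((k + 1) * x : ℝ) * w.re)) = ρ ^ (k + 1) := by
    intro k; rw [hρ, ← Real.exp_nat_mul]; congr 1; push_cast; ring
  have hgn : ∀ r : ℝ, 0 ≤ r → ‖g r‖ ≤ Real.exp (-(r * w.re)) / b := by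
    intro r hr
    rw [hg, norm_div]
    have h1 := one_sub_exp_le_norm_one_add_cexp hw hc hr
    rw [← hb] at h1
    have h2 : ‖Complex.exp (-(r * w))‖ = Real.exp (-(r * w.re)) := by simp [Complex.norm_exp]
    rw [h2]; gcongr
  have hsum : Summable fun k : ℕ => (-1 : ℂ) ^ k * g ((k + 1) * x) := by
    refine Summable.of_norm_bounded (g := fun k : ℕ => ρ ^ (k + 1) / b) ?_ fun k => ?_
    · exact (((summable_geometric_of_lt_one hρ0.le hρ1).mul_left ρ).congr fun k => by ring).div_const b
    · rw [norm_mul, norm_pow, norm_neg, norm_one, one_pow, one_mul, ← hexp k]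
      exact hgn _ (by positivity)
  rw [tsum_eq_tsum_even_add_odd _ hsum]
  have hgeo : HasSum (fun j : ℕ => ρ / b ^ 2 * x * (ρ ^ 2) ^ j) (ρ / b ^ 2 * x * (1 - ρ ^ 2)⁻¹) :=
    (hasSum_geometric_of_lt_one (by positivity) (by nlinarith)).mul_left _
  refine tsum_of_norm_bounded hgeo fun j => ?_
  have key := norm_logistic_sub_le hw hc (a := (2 * j + 1) * x) (b := (2 * j + 1 + 1) * x)
    (by positivity) (by nlinarith)
  have e : Real.exp (-((2 * j + 1) * x * w.re)) = ρ * (ρ ^ 2) ^ j := by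
    have := hexp (2 * j); push_cast at this; rw [this]; ring
  rw [e, ← hg, ← hg, ← hb] at key
  have e1 : (-1 : ℂ) ^ (2 * j) = 1 := by rw [pow_mul]; simp
  have e2 : (-1 : ℂ) ^ (2 * j + 1) = -1 := by rw [pow_succ, e1]; simp
  rw [e1, e2]
  push_cast
  rw [one_mul, neg_one_mul, ← sub_eq_add_neg]
  refine key.trans (le_of_eq ?_)
  ring

theorem summable_card_divisors_mul_pow {q : ℝ} (hq0 : 0 ≤ q) (hq : q < 1) :
    Summable fun n : ℕ => (n.divisors.card : ℝ) * q ^ n := by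
  have h := summable_pow_mul_geometric_of_norm_lt_one (R := ℝ) 1 (r := q) (by rwa [Real.norm_of_nonneg hq0])
  refine Summable.of_nonneg_of_le (fun n => by positivity) (fun n => ?_) h
  have : (n.divisors.card : ℝ) ≤ n := by exact_mod_cast Nat.card_divisors_le_self n
  simp only [pow_one]; gcongr

theorem continuousOn_etaLambert {w : ℂ} (hc : 0 < w.re) : ContinuousOn (etaLambert w) (Ioi 0) := by
  have key : ∀ a : ℝ, 0 < a → ContinuousOn (etaLambert w) (Ioi a) := by
    intro a ha
    have hq1 : Real.exp (-(a * w.re)) < 1 := by rw [Real.exp_lt_one_iff]; nlinarith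
    refine continuousOn_tsum (u := fun n : ℕ => (n.divisors.card : ℝ) * Real.exp (-(a * w.re)) ^ n)
      (fun n => by fun_prop) (summable_card_divisors_mul_pow (Real.exp_pos _).le hq1) ?_
    intro n x hx
    rw [norm_mul]
    gcongr
    · exact norm_etaSqCoeff_le n
    · rw [Complex.norm_exp, ← Real.exp_nat_mul]
      apply Real.exp_le_exp.2
      simp
      have hx' : a < x := hx
      have : (n : ℝ) * (a * w.re) ≤ n * (x * w.re) := by gcongr
      nlinarith
  intro x hx
  have hx' : (0:ℝ) < x := hx
  exact ((key (x / 2) (by linarith)).continuousAt (Ioi_mem_nhds (by linarith))).continuousWithinAt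

theorem LSeriesHasSum_etaCoeff {s : ℂ} (hs : 1 < s.re) :
    LSeriesHasSum etaCoeff s ((1 - 2 ^ (1 - s)) * riemannZeta s) := by
  have hs0 : s ≠ 0 := by rintro rfl; simp at hs; linarith
  have hz : Summable fun n : ℕ => 1 / (n : ℂ) ^ s := Complex.summable_one_div_nat_cpow.2 hs
  have hzs := zeta_eq_tsum_one_div_nat_cpow hs
  have hE : Summable fun k : ℕ => 1 / ((2 * k : ℕ) : ℂ) ^ s :=
    hz.comp_injective (i := fun k : ℕ => 2 * k) fun a b h => by simpa using h
  have hO : Summable fun k : ℕ => 1 / ((2 * k + 1 : ℕ) : ℂ) ^ s :=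
    hz.comp_injective (i := fun k : ℕ => 2 * k + 1) fun a b h => by simpa using h
  have hEv : ∑' k : ℕ, 1 / ((2 * k : ℕ) : ℂ) ^ s = 2 ^ (-s) * riemannZeta s := by
    rw [hzs, ← tsum_mul_left]
    refine tsum_congr fun k => ?_
    have := Complex.natCast_mul_natCast_cpow 2 k s
    push_cast at this ⊢
    rw [this, Complex.cpow_neg]
    ring
  have hsum := tsum_eq_tsum_even_add_odd _ hz
  rw [hE.tsum_add hO, ← hzs, hEv] at hsum
  have h1 : HasSum (fun k : ℕ => LSeries.term etaCoeff s (2 * k)) (-(2 ^ (-s) * riemannZeta s)) := by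
    have := hE.hasSum.neg
    rw [hEv] at this
    refine this.congr_fun fun k => ?_
    rcases Nat.eq_zero_or_pos k with rfl | hk
    · simp [hs0]
    · rw [LSeries.term_of_ne_zero (by omega), etaCoeff, pow_succ, pow_mul]
      simp [neg_div]
  have h2 : HasSum (fun k : ℕ => LSeries.term etaCoeff s (2 * k + 1))
      (riemannZeta s - 2 ^ (-s) * riemannZeta s) := by
    have := hO.hasSum
    rw [show (∑' k : ℕ, 1 / ((2 * k + 1 : ℕ) : ℂ) ^ s) = riemannZeta s - 2 ^ (-s) * riemannZeta s by
      linear_combination -hsum] at this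
    refine this.congr_fun fun k => ?_
    rw [LSeries.term_of_ne_zero (by omega), etaCoeff, show 2 * k + 1 + 1 = 2 * (k + 1) by ring, pow_mul]
    simp
  have := h1.even_add_odd h2
  unfold LSeriesHasSum
  convert this using 1
  rw [Complex.cpow_sub _ _ two_ne_zero, Complex.cpow_neg, Complex.cpow_one]
  ring

theorem LSeriesHasSum_etaSqCoeff {s : ℂ} (hs : 1 < s.re) :
    LSeriesHasSum etaSqCoeff s (((1 - 2 ^ (1 - s)) * riemannZeta s) ^ 2) := by
  have h := (LSeriesHasSum_etaCoeff hs).convolution (LSeriesHasSum_etaCoeff hs)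
  rw [← sq] at h
  have e : LSeries.convolution etaCoeff etaCoeff = etaSqCoeff := by
    rw [LSeries.convolution_def]; rfl
  rwa [e] at h

theorem mellin_etaLambert_of_one_lt {w : ℂ} (hc : 0 < w.re) {s : ℂ} (hs : 1 < s.re) :
    mellin (etaLambert w) s =
      Complex.Gamma s * (1 / w) ^ s * ((1 - 2 ^ (1 - s)) * riemannZeta s) ^ 2 := by
  have hs0 : s ≠ 0 := by rintro rfl; simp at hs; linarith
  have hL := LSeriesHasSum_etaSqCoeff hs
  set F : ℕ → ℝ → ℂ := fun n x => (x : ℂ) ^ (s - 1) • (etaSqCoeff n * Complex.exp (-(n * x * w))) with hF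
  have hG : ∀ n : ℕ, 0 < n → ∫ x in Ioi (0:ℝ), (x : ℂ) ^ (s - 1) • Complex.exp (-(n * x * w)) =
      (n : ℂ) ^ (-s) * ((1 / w) ^ s * Complex.Gamma s) := by
    intro n hn
    have h1 := mellin_comp_mul_left (fun x : ℝ => Complex.exp (-(w * x))) s (a := n) (by exact_mod_cast hn)
    simp only [mellin] at h1
    rw [show (fun x : ℝ => (x : ℂ) ^ (s - 1) • Complex.exp (-(n * x * w))) =
      fun t : ℝ => (t : ℂ) ^ (s - 1) • Complex.exp (-(w * ((n * t : ℝ) : ℂ))) by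
        funext t; congr 3; push_cast; ring, h1]
    have h2 := integral_cpow_mul_cexp_neg_mul_Ioi (s := s) (r := w) (by linarith) hc
    simp only [smul_eq_mul] at h2 ⊢
    rw [h2]; simp
  have hGn : ∀ n : ℕ, 0 < n → ∀ x ∈ Ioi (0:ℝ), ‖(x : ℂ) ^ (s - 1) • Complex.exp (-(n * x * w))‖ =
      x ^ (s.re - 1) * Real.exp (-(n * w.re * x)) := by
    intro n hn x hx
    rw [norm_smul, Complex.norm_cpow_eq_rpow_re_of_pos hx, Complex.norm_exp]
    congr 2; simp; ring
  have hmeas : ∀ n : ℕ, AEStronglyMeasurable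
      (fun x : ℝ => (x : ℂ) ^ (s - 1) • Complex.exp (-(n * x * w))) (volume.restrict (Ioi 0)) := by
    intro n
    refine ContinuousOn.aestronglyMeasurable ?_ measurableSet_Ioi
    have h0 : Continuous fun x : ℝ => Complex.exp (-(n * x * w)) := by fun_prop
    have h1 : ContinuousOn (fun x : ℝ => (x : ℂ) ^ (s - 1)) (Ioi 0) := ?_
    · exact h1.smul h0.continuousOn
    intro x hx
    exact (Complex.continuousAt_ofReal_cpow_const _ _ (Or.inr (ne_of_gt hx))).continuousWithinAt
  have hri : ∀ n : ℕ, 0 < n → IntegrableOn (fun x : ℝ => x ^ (s.re - 1) * Real.exp (-(n * w.re * x))) (Ioi 0) := by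
    intro n hn
    have := integrableOn_rpow_mul_exp_neg_mul_rpow (p := 1) (s := s.re - 1) (b := n * w.re) (by linarith)
      one_pos (by positivity)
    simpa using this
  have h_int : ∀ n : ℕ, Integrable (F n) (volume.restrict (Ioi 0)) := by
    intro n
    rcases Nat.eq_zero_or_pos n with rfl | hn
    · simp [hF, etaSqCoeff_zero]
    · have h1 : Integrable (fun x : ℝ => (x : ℂ) ^ (s - 1) • Complex.exp (-(n * x * w)))
          (volume.restrict (Ioi 0)) := by
        refine Integrable.mono' (hri n hn) (hmeas n) ?_
        filter_upwards [ae_restrict_mem measurableSet_Ioi] with x hx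
        rw [hGn n hn x hx]
      refine (h1.const_mul (etaSqCoeff n)).congr (Eventually.of_forall fun x => ?_)
      simp [hF]; ring
  have hFi : ∀ n : ℕ, ∫ x in Ioi (0:ℝ), F n x =
      LSeries.term etaSqCoeff s n * ((1 / w) ^ s * Complex.Gamma s) := by
    intro n
    rcases Nat.eq_zero_or_pos n with rfl | hn
    · simp [hF, etaSqCoeff_zero]
    · rw [LSeries.term_of_ne_zero hn.ne', div_eq_mul_inv, ← Complex.cpow_neg, mul_assoc, ← hG n hn,
        ← integral_const_mul]
      congr 1; funext x; simp only [hF, smul_eq_mul]; ring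
  have hFn : ∀ n : ℕ, ∫ x in Ioi (0:ℝ), ‖F n x‖ =
      ‖LSeries.term etaSqCoeff s n‖ * ((1 / w.re) ^ s.re * Real.Gamma s.re) := by
    intro n
    rcases Nat.eq_zero_or_pos n with rfl | hn
    · simp [hF, etaSqCoeff_zero]
    · have h1 := Real.integral_rpow_mul_exp_neg_mul_Ioi (a := s.re) (r := n * w.re) (by linarith) (by positivity)
      have hn0 : (0:ℝ) < n := by exact_mod_cast hn
      rw [show 1 / (n * w.re) = (1 / n) * (1 / w.re) by field_simp,
        Real.mul_rpow (by positivity) (by positivity)] at h1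
      rw [LSeries.norm_term_eq, if_neg hn.ne', div_eq_mul_inv, ← Real.inv_rpow hn0.le, mul_assoc,
        ← one_div (n : ℝ), ← mul_assoc _ _ (Real.Gamma s.re), ← h1, ← integral_const_mul]
      refine setIntegral_congr_fun measurableSet_Ioi fun x hx => ?_
      have := hGn n hn x hx
      simp only [hF, norm_smul, norm_mul] at this ⊢
      rw [← this]; ring
  have hsum := hasSum_integral_of_summable_integral_norm h_int (by
    simp_rw [hFn]
    exact hL.summable.norm.mul_right _)
  simp_rw [hFi] at hsum
  have h3 := hsum.unique (hL.mul_right ((1 / w) ^ s * Complex.Gamma s))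
  rw [mellin]
  have h4 : ∀ x : ℝ, (x : ℂ) ^ (s - 1) • etaLambert w x = ∑' n, F n x := by
    intro x
    simp only [hF, smul_eq_mul, etaLambert]
    rw [tsum_mul_left]
  simp_rw [h4]
  rw [h3]; ring

theorem mellinHypotheses_of_norm_le {h : ℝ → ℂ} {M c : ℝ} (hc : 0 < c) (hcont : ContinuousOn h (Ioi 0))
    (hb : ∀ x, 0 < x → ‖h x‖ ≤ M * Real.exp (-(c * x))) :
    LocallyIntegrableOn h (Ioi 0) ∧ h =O[atTop] (fun t => Real.exp (-c * t)) ∧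
      h =O[𝓝[>] 0] (fun x : ℝ => x ^ (-(0:ℝ))) := by
  refine ⟨hcont.locallyIntegrableOn measurableSet_Ioi, ?_, ?_⟩
  · refine Asymptotics.IsBigO.of_bound M ?_
    filter_upwards [eventually_gt_atTop 0] with x hx
    rw [Real.norm_of_nonneg (Real.exp_pos _).le, neg_mul]
    exact hb x hx
  · refine Asymptotics.IsBigO.of_bound M ?_
    filter_upwards [self_mem_nhdsWithin] with x hx
    have hx' : 0 < x := hx
    refine (hb x hx).trans ?_
    have hM : 0 ≤ M := by
      have := (norm_nonneg _).trans (hb 1 one_pos)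
      exact nonneg_of_mul_nonneg_left this (Real.exp_pos _)
    have : Real.exp (-(c * x)) ≤ 1 := by rw [Real.exp_le_one_iff]; nlinarith
    simp; nlinarith

theorem mellin_etaLambert {w : ℂ} (hw : ‖w‖ = 1) (hc : 0 < w.re) {s : ℂ} (hs : 0 < s.re) (hs1 : s ≠ 1) :
    mellin (etaLambert w) s =
      Complex.Gamma s * (1 / w) ^ s * ((1 - 2 ^ (1 - s)) * riemannZeta s) ^ 2 := by
  obtain ⟨M, hM⟩ := exists_norm_etaLambert_le hw hc
  obtain ⟨k1, k2, k3⟩ := mellinHypotheses_of_norm_le (by positivity) (continuousOn_etaLambert hc) hM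
  have hw0 : w ≠ 0 := by rintro rfl; simp at hc
  have hU : IsOpen {z : ℂ | 0 < z.re} := isOpen_lt continuous_const Complex.continuous_re
  have d1 : DifferentiableOn ℂ (fun s => (s - 1) ^ 2 * mellin (etaLambert w) s) {z : ℂ | 0 < z.re} := by
    intro z hz
    exact (DifferentiableAt.mul (by fun_prop)
      (mellin_differentiableAt_of_isBigO_rpow_exp (by positivity) k1 k2 k3 hz)).differentiableWithinAt
  have d2 : DifferentiableOn ℂ (fun s => Complex.Gamma s * (1 / w) ^ s *
      ((1 - 2 ^ (1 - s)) * riemannZeta₁ s) ^ 2) {z : ℂ | 0 < z.re} := by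
    intro z hz
    have hz' : 0 < z.re := hz
    have g1 : DifferentiableAt ℂ Complex.Gamma z := by
      refine Complex.differentiableAt_Gamma z fun m hm => ?_
      rw [hm] at hz'; simp at hz'; linarith
    have g2 : DifferentiableAt ℂ (fun s : ℂ => (1 / w) ^ s) z :=
      differentiableAt_id.const_cpow (Or.inl (by simpa using hw0))
    have g3 : DifferentiableAt ℂ (fun s : ℂ => (2 : ℂ) ^ (1 - s)) z :=
      DifferentiableAt.const_cpow (by fun_prop) (Or.inl two_ne_zero)
    have g4 := differentiable_riemannZeta₁ z
    exact ((g1.mul g2).mul (((g3.const_sub 1).mul g4).pow 2)).differentiableWithinAt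
  have heq := (d1.analyticOnNhd hU).eqOn_of_preconnected_of_frequently_eq (d2.analyticOnNhd hU)
    (convex_halfSpace_re_gt 0).isPreconnected (z₀ := 2) (by simp) ?_
  · have h1 := heq hs
    simp only at h1
    have hs2 : s - 1 ≠ 0 := sub_ne_zero.2 hs1
    rw [riemannZeta_eq_inv_sub_mul hs1]
    have : (s - 1) ^ 2 ≠ 0 := pow_ne_zero 2 hs2
    apply mul_left_cancel₀ this
    rw [h1]; field_simp
  · refine Filter.Eventually.frequently ?_
    have : {z : ℂ | 1 < z.re} ∈ 𝓝[≠] (2 : ℂ) := mem_nhdsWithin_of_mem_nhds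
      ((isOpen_lt continuous_const Complex.continuous_re).mem_nhds (by simp))
    filter_upwards [this] with z hz
    have hz1 : z ≠ 1 := by rintro rfl; simp at hz
    have hz2 : z - 1 ≠ 0 := sub_ne_zero.2 hz1
    rw [mellin_etaLambert_of_one_lt hc hz, riemannZeta_eq_inv_sub_mul hz1]
    field_simp

/-- A symmetrised Lambert series whose Mellin transform has a functional equation. -/
noncomputable def etaLambertSym (w : ℂ) (x : ℝ) : ℂ :=
  etaLambert w x - 2 * etaLambert w (1 / 2 * x) + etaLambert w (1 / 4 * x)

/-- The Mellin transform of `etaLambertSym 1`. -/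
noncomputable def zetaSqKernel (s : ℂ) : ℂ :=
  Complex.Gamma s * ((1 - 2 ^ (1 - s)) * (1 - 2 ^ s) * riemannZeta s) ^ 2

theorem continuousOn_etaLambertSym {w : ℂ} (hc : 0 < w.re) : ContinuousOn (etaLambertSym w) (Ioi 0) := by
  have h := continuousOn_etaLambert hc
  have hk : ∀ a : ℝ, 0 < a → ContinuousOn (fun x => etaLambert w (a * x)) (Ioi 0) := by
    intro a ha
    refine h.comp (by fun_prop) fun x hx => ?_
    have hx' : (0:ℝ) < x := hx
    exact mul_pos ha hx'
  exact (h.sub (continuousOn_const.mul (hk _ (by norm_num)))).add (hk _ (by norm_num))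

theorem exists_norm_etaLambertSym_le {w : ℂ} (hw : ‖w‖ = 1) (hc : 0 < w.re) :
    ∃ M, ∀ x : ℝ, 0 < x → ‖etaLambertSym w x‖ ≤ M * Real.exp (-(w.re / 8 * x)) := by
  obtain ⟨M, hM⟩ := exists_norm_etaLambert_le hw hc
  have hM0 : 0 ≤ M := by
    have := (norm_nonneg _).trans (hM 1 one_pos)
    exact nonneg_of_mul_nonneg_left this (Real.exp_pos _)
  refine ⟨4 * M, fun x hx => ?_⟩
  have hmono : ∀ a : ℝ, 1 / 4 ≤ a → ‖etaLambert w (a * x)‖ ≤ M * Real.exp (-(w.re / 8 * x)) := by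
    intro a ha
    refine (hM (a * x) (by positivity)).trans ?_
    have : Real.exp (-(w.re / 2 * (a * x))) ≤ Real.exp (-(w.re / 8 * x)) := by
      apply Real.exp_le_exp.2
      have : 1 / 4 * (w.re / 2 * x) ≤ a * (w.re / 2 * x) := by gcongr
      nlinarith
    gcongr
  have h1 := hmono 1 (by norm_num)
  rw [one_mul] at h1
  have h2 := hmono (1 / 2) (by norm_num)
  have h3 := hmono (1 / 4) (by norm_num)
  have h4 : ‖etaLambertSym w x‖ ≤ ‖etaLambert w x‖ + 2 * ‖etaLambert w (1 / 2 * x)‖ +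
      ‖etaLambert w (1 / 4 * x)‖ := by
    refine (norm_add_le _ _).trans ?_
    gcongr
    refine (norm_sub_le _ _).trans ?_
    rw [norm_mul]; simp
  linarith

theorem mellin_etaLambertSym {w : ℂ} (hw : ‖w‖ = 1) (hc : 0 < w.re) {s : ℂ} (hs : 0 < s.re) (hs1 : s ≠ 1) :
    mellin (etaLambertSym w) s = (1 / w) ^ s * zetaSqKernel s := by
  obtain ⟨M, hM⟩ := exists_norm_etaLambert_le hw hc
  obtain ⟨k1, k2, k3⟩ := mellinHypotheses_of_norm_le (by positivity) (continuousOn_etaLambert hc) hM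
  have hconv : MellinConvergent (etaLambert w) s :=
    mellinConvergent_of_isBigO_rpow_exp (by positivity) k1 k2 k3 hs
  have c2 : MellinConvergent (fun x => etaLambert w (1 / 2 * x)) s :=
    (MellinConvergent.comp_mul_left (by norm_num)).2 hconv
  have c4 : MellinConvergent (fun x => etaLambert w (1 / 4 * x)) s :=
    (MellinConvergent.comp_mul_left (by norm_num)).2 hconv
  have m2 := mellin_comp_mul_left (etaLambert w) s (a := 1 / 2) (by norm_num)
  have m4 := mellin_comp_mul_left (etaLambert w) s (a := 1 / 4) (by norm_num)
  have e2 : (((1 / 2 : ℝ)) : ℂ) ^ (-s) = 2 ^ s := by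
    rw [Complex.cpow_neg, show (((1 / 2 : ℝ)) : ℂ) = (2:ℂ)⁻¹ by push_cast; norm_num, Complex.inv_cpow, inv_inv]
    rw [show (2:ℂ) = ((2:ℝ):ℂ) by norm_num, Complex.arg_ofReal_of_nonneg (by norm_num)]
    exact Real.pi_pos.ne
  have e4 : (((1 / 4 : ℝ)) : ℂ) ^ (-s) = 2 ^ s * 2 ^ s := by
    rw [← e2, ← Complex.mul_cpow_ofReal_nonneg (by norm_num) (by norm_num)]
    congr 1; push_cast; norm_num
  rw [e2] at m2
  rw [e4] at m4
  have hm : mellin (etaLambertSym w) s = mellin (etaLambert w) s -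
      2 * mellin (fun x => etaLambert w (1 / 2 * x)) s + mellin (fun x => etaLambert w (1 / 4 * x)) s := by
    have a1 : HasMellin (fun x => (2 : ℂ) • etaLambert w (1 / 2 * x)) s
        ((2:ℂ) • mellin (fun x => etaLambert w (1 / 2 * x)) s) :=
      hasMellin_const_smul c2 2
    have a2 := hasMellin_sub hconv a1.1
    have a3 := hasMellin_add a2.1 c4
    have := a3.2
    rw [a2.2, a1.2] at this
    have hfun : etaLambertSym w = fun x => etaLambert w x - 2 * etaLambert w (1 / 2 * x) +
        etaLambert w (1 / 4 * x) := rfl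
    rw [hfun]
    simpa using this
  rw [hm, m2, m4, mellin_etaLambert hw hc hs hs1, zetaSqKernel]
  simp only [smul_eq_mul]
  ring

theorem zetaSqKernel_conj (s : ℂ) :
    zetaSqKernel ((starRingEnd ℂ) s) = (starRingEnd ℂ) (zetaSqKernel s) := by
  have h2 : ∀ z : ℂ, (2 : ℂ) ^ ((starRingEnd ℂ) z) = (starRingEnd ℂ) ((2 : ℂ) ^ z) := by
    intro z
    have h0 : Complex.arg 2 ≠ Real.pi := by
      rw [show (2:ℂ) = ((2:ℝ):ℂ) by norm_num, Complex.arg_ofReal_of_nonneg (by norm_num)]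
      exact Real.pi_pos.ne
    have := Complex.cpow_conj 2 z h0
    rw [this, Complex.conj_ofNat]
  have h3 : (2 : ℂ) ^ (1 - (starRingEnd ℂ) s) = (starRingEnd ℂ) ((2 : ℂ) ^ (1 - s)) := by
    rw [← h2]; simp
  rw [zetaSqKernel, zetaSqKernel, Complex.Gamma_conj, riemannZeta_conj, h2, h3]
  simp

theorem zetaSqKernel_one_sub {s : ℂ} (hs0 : 0 < s.re) (hs1 : s.re < 1) :
    zetaSqKernel (1 - s) * Complex.sin (Real.pi * s / 2) =
      (2 * Real.pi) ^ (1 - 2 * s) * Complex.cos (Real.pi * s / 2) * zetaSqKernel s := by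
  have hne : ∀ n : ℕ, s ≠ -n := by
    rintro n rfl; simp at hs0; have : (0:ℝ) ≤ n := Nat.cast_nonneg n; linarith
  have hne1 : s ≠ 1 := by rintro rfl; simp at hs1
  have hz := riemannZeta_one_sub hne hne1
  have hg := Complex.Gamma_mul_Gamma_one_sub s
  have hsin : Complex.sin (Real.pi * s) = 2 * Complex.sin (Real.pi * s / 2) * Complex.cos (Real.pi * s / 2) := by
    rw [← Complex.sin_two_mul]; congr 1; ring
  have hpi : (Real.pi : ℂ) ≠ 0 := by exact_mod_cast Real.pi_ne_zero
  have hGs : Complex.Gamma s ≠ 0 := Complex.Gamma_ne_zero hne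
  have hG1 : Complex.Gamma (1 - s) ≠ 0 := by
    refine Complex.Gamma_ne_zero fun n hn => ?_
    have : (1 - s).re = -(n:ℝ) := by rw [hn]; simp
    simp at this; have : (0:ℝ) ≤ n := Nat.cast_nonneg n; linarith
  have hs : Complex.sin (Real.pi * s) ≠ 0 := by
    intro h; rw [h, div_zero] at hg; exact mul_ne_zero hGs hG1 hg
  have hsn : Complex.sin (Real.pi * s / 2) ≠ 0 := by
    intro h; rw [hsin, h] at hs; simp at hs
  have hcs : Complex.cos (Real.pi * s / 2) ≠ 0 := by
    intro h; rw [hsin, h] at hs; simp at hs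
  have hg' : Complex.Gamma (1 - s) * Complex.sin (Real.pi * s / 2) * (2 * Complex.Gamma s * Complex.cos (Real.pi * s / 2)) =
      Real.pi := by
    rw [hsin, eq_div_iff (by rw [← hsin]; exact hs)] at hg
    linear_combination hg
  have hp : ((2:ℂ) * Real.pi) ^ (1 - 2 * s) = (2 * Real.pi) * ((2 * Real.pi) ^ (-s)) ^ 2 := by
    have h2pi : (2 * (Real.pi:ℂ)) ≠ 0 := mul_ne_zero two_ne_zero hpi
    rw [Complex.cpow_sub _ _ h2pi, Complex.cpow_one, ← Complex.cpow_nat_mul, div_eq_mul_inv, ← Complex.cpow_neg]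
    congr 2; push_cast; ring
  rw [zetaSqKernel, zetaSqKernel, hz, hp, sub_sub_cancel]
  have key : Complex.Gamma (1 - s) * Complex.sin (Real.pi * s / 2) * (2 * Complex.Gamma s * Complex.cos (Real.pi * s / 2)) ^ 2
    = Real.pi * (2 * Complex.Gamma s * Complex.cos (Real.pi * s / 2)) := by
    rw [sq, ← mul_assoc, hg']
  linear_combination ((1 - 2 ^ s) * (1 - 2 ^ (1 - s))  * ((2 * Real.pi) ^ (-s)) * riemannZeta s) ^ 2 * key

theorem norm_cos_sq_quarter (t : ℝ) :
    ‖Complex.cos (Real.pi * (1 / 2 + t * Complex.I) / 2)‖ ^ 2 = Real.cosh (Real.pi * t) / 2 := by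
  have e : (Real.pi * (1 / 2 + t * Complex.I) / 2 : ℂ) = ((Real.pi / 4 : ℝ) : ℂ) + ((Real.pi * t / 2 : ℝ) : ℂ) * Complex.I := by
    push_cast; ring
  rw [e, Complex.cos_add_mul_I, ← Complex.ofReal_cos, ← Complex.ofReal_sin, ← Complex.ofReal_cosh,
    ← Complex.ofReal_sinh, ← Complex.ofReal_mul, ← Complex.ofReal_mul, ← Complex.normSq_eq_norm_sq,
    Complex.normSq_apply]
  simp only [Complex.sub_re, Complex.sub_im, Complex.mul_re, Complex.mul_im, Complex.ofReal_re, Complex.ofReal_im, Complex.I_re, Complex.I_im]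
  rw [Real.cos_pi_div_four, Real.sin_pi_div_four, show Real.pi * t = 2 * (Real.pi * t / 2) by ring, Real.cosh_two_mul]
  have h2 : Real.sqrt 2 ^ 2 = 2 := Real.sq_sqrt (by norm_num)
  rw [show 2 * (Real.pi * t / 2) / 2 = Real.pi * t / 2 by ring]
  linear_combination ((Real.cosh (Real.pi * t / 2) ^ 2 + Real.sinh (Real.pi * t / 2) ^ 2) / 4) * h2

theorem norm_zetaSqKernel_sub_le {θ : ℝ} (h0 : 0 ≤ θ) (h1 : θ ≤ Real.pi) (t : ℝ) :
    Real.exp (θ * t) * ‖zetaSqKernel (1 / 2 + t * Complex.I) -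
      Complex.I * (2 * Real.pi) ^ (2 * (t * Complex.I)) *
        (starRingEnd ℂ) (zetaSqKernel (1 / 2 + t * Complex.I))‖ ≤
    2 * ‖zetaSqKernel (1 / 2 + t * Complex.I)‖ := by
  set s : ℂ := 1 / 2 + t * Complex.I with hs
  set K := zetaSqKernel s with hK
  have hre : s.re = 1 / 2 := by simp [hs]
  have hfe := zetaSqKernel_one_sub (s := s) (by rw [hre]; norm_num) (by rw [hre]; norm_num)
  have hcj : (1 - s) = (starRingEnd ℂ) s := by
    apply Complex.ext <;> simp [hs]; norm_num
  rw [hcj, zetaSqKernel_conj, ← hK] at hfe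
  set P : ℂ := (2 * Real.pi) ^ (2 * (t * Complex.I)) with hP
  have hP0 : ((2:ℂ) * Real.pi) ^ (1 - 2 * s) = P⁻¹ := by
    rw [hP, ← Complex.cpow_neg]; congr 1; rw [hs]; ring
  have hPn : ‖P‖ = 1 := by
    have := Complex.norm_cpow_eq_rpow_re_of_pos (x := 2 * Real.pi) (by positivity) (2 * (t * Complex.I))
    push_cast at this
    rw [hP, this]; simp
  have hPne : P ≠ 0 := by intro h; rw [h] at hPn; simp at hPn
  rw [hP0] at hfe
  set z : ℂ := Real.pi * s / 2 with hz
  have hcos : ‖Complex.cos z‖ ^ 2 = Real.cosh (Real.pi * t) / 2 := norm_cos_sq_quarter t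
  have e1 : Complex.cos z * (K - Complex.I * P * (starRingEnd ℂ) K) =
      P * (starRingEnd ℂ) K * (-Complex.I * Complex.exp (z * Complex.I)) := by
    rw [← Complex.cos_add_sin_I]
    have : Complex.cos z * K = P * ((starRingEnd ℂ) K * Complex.sin z) := by
      rw [hfe]; field_simp
    linear_combination this + P * (starRingEnd ℂ) K * Complex.sin z * Complex.I_sq
  have e2 : ‖Complex.cos z‖ * ‖K - Complex.I * P * (starRingEnd ℂ) K‖ = ‖K‖ * Real.exp (-(Real.pi * t / 2)) := by
    rw [← norm_mul, e1]
    simp only [norm_mul, hPn, norm_neg, Complex.norm_I, Complex.norm_conj, one_mul, Complex.norm_exp]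
    congr 2
    rw [hz, hs]; simp
  set D := ‖K - Complex.I * P * (starRingEnd ℂ) K‖ with hD
  have hD0 : 0 ≤ D := norm_nonneg _
  have e3 : Real.cosh (Real.pi * t) / 2 * D ^ 2 = ‖K‖ ^ 2 * Real.exp (-(Real.pi * t)) := by
    rw [← hcos, ← mul_pow, e2, mul_pow, ← Real.exp_nat_mul]; congr 2; push_cast; ring
  have e4 : Real.exp (θ * t) ^ 2 ≤ Real.exp (Real.pi * t) ^ 2 + 1 := by
    rcases le_total 0 t with ht | ht
    · have : Real.exp (θ * t) ≤ Real.exp (Real.pi * t) := by apply Real.exp_le_exp.2; gcongr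
      have := Real.exp_pos (θ * t)
      nlinarith
    · have h5 : Real.exp (θ * t) ≤ 1 := by rw [Real.exp_le_one_iff]; nlinarith
      have := Real.exp_pos (θ * t)
      nlinarith [sq_nonneg (Real.exp (Real.pi * t))]
  have e5 : (Real.exp (Real.pi * t) ^ 2 + 1) * D ^ 2 = 4 * ‖K‖ ^ 2 := by
    rw [Real.cosh_eq, Real.exp_neg] at e3
    have hE := Real.exp_pos (Real.pi * t)
    field_simp at e3
    linarith
  refine le_of_sq_le_sq ?_ (by positivity)
  rw [mul_pow, mul_pow]
  calc Real.exp (θ * t) ^ 2 * D ^ 2 ≤ (Real.exp (Real.pi * t) ^ 2 + 1) * D ^ 2 := by gcongr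
    _ = _ := by rw [e5]; norm_num

theorem norm_sq_logMellin (σ : ℝ) (h : ℝ → ℂ) (u : ℝ) :
    ‖logMellin σ h u‖ ^ 2 = Real.exp (-(2 * σ * u)) * ‖h (Real.exp (-u))‖ ^ 2 := by
  rw [logMellin, norm_smul, mul_pow, Real.norm_of_nonneg (Real.exp_pos _).le, ← Real.exp_nat_mul]
  congr 2; push_cast; ring

theorem setIntegral_Iic_norm_sq_logMellin (σ : ℝ) (h : ℝ → ℂ) (a : ℝ) :
    ∫ u in Iic (-a), ‖logMellin σ h u‖ ^ 2 =
      ∫ x in Ioi (Real.exp a), x ^ (2 * σ - 1) * ‖h x‖ ^ 2 := by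
  rw [← integral_comp_exp_Ioi, ← integral_comp_neg_Ioi]
  refine setIntegral_congr_fun measurableSet_Ioi fun u _ => ?_
  simp only [norm_sq_logMellin, smul_eq_mul, neg_neg]
  rw [← Real.exp_mul, ← mul_assoc, ← Real.exp_add]
  congr 2; ring

theorem mellin_etaLambertSym_exp {θ : ℝ} (h0 : 0 ≤ θ) (h1 : θ < Real.pi / 2) {σ : ℝ} (hσ : 0 < σ)
    (hσ1 : σ < 1) (t : ℝ) :
    mellin (etaLambertSym (Complex.exp (θ * Complex.I))) (σ + t * Complex.I) =
      Complex.exp (-(θ * Complex.I) * (σ + t * Complex.I)) * zetaSqKernel (σ + t * Complex.I) := by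
  have hw : ‖Complex.exp (θ * Complex.I)‖ = 1 := Complex.norm_exp_ofReal_mul_I θ
  have hc : 0 < (Complex.exp (θ * Complex.I)).re := by
    rw [Complex.exp_ofReal_mul_I_re]
    exact Real.cos_pos_of_mem_Ioo ⟨by linarith [Real.pi_pos], h1⟩
  have hne : (σ + t * Complex.I : ℂ) ≠ 1 := by
    intro h
    have := congrArg Complex.re h
    simp at this; linarith
  rw [mellin_etaLambertSym hw hc (by simpa using hσ) hne, one_div, ← Complex.exp_neg, Complex.cpow_def_of_ne_zero (Complex.exp_ne_zero _),
    Complex.log_exp]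
  · simp; linarith [Real.pi_pos]
  · simp; linarith [Real.pi_pos]

/-- The second moment of `zetaSqKernel` against `exp (2 * θ * t)` is controlled by the tail of the
square of the corresponding Lambert series. -/
theorem exists_integral_zetaSqKernel_le :
    ∃ C > 0, ∀ θ : ℝ, 0 ≤ θ → θ < Real.pi / 2 → ∀ σ : ℝ, 1 / 2 ≤ σ → σ ≤ 3 / 4 →
      Integrable (fun t : ℝ => (Real.exp (θ * t) * ‖zetaSqKernel (σ + t * Complex.I)‖) ^ 2) ∧
      ∫ t : ℝ, (Real.exp (θ * t) * ‖zetaSqKernel (σ + t * Complex.I)‖) ^ 2 ≤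
        C * (1 + ∫ x in Ioi (2 * Real.pi), x ^ (2 * σ - 1) *
          ‖etaLambertSym (Complex.exp (θ * Complex.I)) x‖ ^ 2) := by
  obtain ⟨φ₀, hφ₀⟩ : ∃ φ₀, φ₀ = logMellin (1 / 2) (etaLambertSym 1) := ⟨_, rfl⟩
  obtain ⟨K0, hK0⟩ : ∃ K0, K0 = ∫ u, ‖φ₀ u‖ ^ 2 := ⟨_, rfl⟩
  have hK00 : 0 ≤ K0 := by rw [hK0]; positivity
  obtain ⟨M1, hM1⟩ := exists_norm_etaLambertSym_le (w := 1) (by simp) (by simp)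
  have hpi := Real.pi_pos
  have hpi3 := Real.pi_gt_three
  have k := integrable_logMellin (σ := 1 / 2) (by norm_num) (by norm_num) (by simp)
    (continuousOn_etaLambertSym (w := 1) (by simp)) hM1
  rw [← hφ₀] at k
  refine ⟨2 * Real.pi * (1 + 4 * Real.pi + 16 * Real.pi * K0), by positivity, ?_⟩
  intro θ h0 h1 σ hσ hσ1
  obtain ⟨w, hwdef⟩ : ∃ w, w = Complex.exp (θ * Complex.I) := ⟨_, rfl⟩
  have hw : ‖w‖ = 1 := by rw [hwdef]; exact Complex.norm_exp_ofReal_mul_I θ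
  have hc : 0 < w.re := by
    rw [hwdef, Complex.exp_ofReal_mul_I_re]
    exact Real.cos_pos_of_mem_Ioo ⟨by linarith, h1⟩
  obtain ⟨M, hM⟩ := exists_norm_etaLambertSym_le hw hc
  have hcont := continuousOn_etaLambertSym hc
  have i1 := integral_norm_sq_logMellin (σ := σ) (by linarith) (by linarith) (by linarith) hcont hM
  have i2 := integrable_logMellin (σ := σ) (by linarith) (by linarith) (by linarith) hcont hM
  have i3 := integrable_logMellin (σ := 1 / 2) (by norm_num) (by norm_num) (by linarith) hcont hM
  obtain ⟨Φ, hΦ⟩ : ∃ Φ, Φ = logMellin σ (etaLambertSym w) := ⟨_, rfl⟩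
  obtain ⟨φ, hφ⟩ : ∃ φ, φ = logMellin (1 / 2) (etaLambertSym w) := ⟨_, rfl⟩
  rw [← hΦ] at i1 i2
  rw [← hφ] at i3
  have hnorm : ∀ (s : ℝ), 0 < s → s < 1 → ∀ t : ℝ, ‖mellin (etaLambertSym w) (s + t * Complex.I)‖ =
      Real.exp (θ * t) * ‖zetaSqKernel (s + t * Complex.I)‖ := by
    intro s hs hs1 t
    rw [hwdef, mellin_etaLambertSym_exp h0 h1 hs hs1, norm_mul, Complex.norm_exp]
    congr 2; simp
  have href := setIntegral_Ioi_norm_sq_le_of_fourier (φ := φ) (φ₀ := φ₀) i3.1 i3.2 k.1 k.2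
    (Complex.I * Complex.exp (-(θ * Complex.I))) (by
      rw [norm_mul, ← neg_mul, Complex.norm_I, ← Complex.ofReal_neg, Complex.norm_exp_ofReal_mul_I, one_mul]) (2 * Real.log (2 * Real.pi)) (by
    intro ξ
    obtain ⟨t, ht⟩ : ∃ t : ℝ, ξ = t / (2 * Real.pi) := ⟨2 * Real.pi * ξ, by field_simp⟩
    have e1 := mellin_eq_fourier_logMellin (etaLambertSym w) (1 / 2) t
    have e2 := mellin_eq_fourier_logMellin (etaLambertSym 1) (1 / 2) t
    rw [← hφ, ← ht] at e1
    rw [← hφ₀, ← ht] at e2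
    rw [← e1, ← e2]
    have e3 := mellin_etaLambertSym_exp h0 h1 (σ := 1 / 2) (by norm_num) (by norm_num) t
    have e4 := mellin_etaLambertSym_exp (θ := 0) (le_refl _) (by linarith) (σ := 1 / 2) (by norm_num) (by norm_num) t
    rw [← hwdef] at e3
    simp only [Complex.ofReal_zero, zero_mul, Complex.exp_zero, neg_zero, one_mul] at e4
    rw [e3, e4]
    have key := norm_zetaSqKernel_sub_le h0 (by linarith) t
    have e5 : (((1 / 2 : ℝ)) : ℂ) = 1 / 2 := by push_cast; rfl
    rw [e5]
    refine le_trans (le_of_eq ?_) key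
    have e6 : Complex.exp (2 * Real.pi * Complex.I * ((2 * Real.log (2 * Real.pi) : ℝ) * ξ)) =
        (2 * Real.pi) ^ (2 * (t * Complex.I)) := by
      rw [Complex.cpow_def_of_ne_zero (by exact_mod_cast (by positivity : (2 * Real.pi) ≠ 0)), ht]
      rw [show (2 * Real.pi : ℂ) = ((2 * Real.pi : ℝ) : ℂ) by push_cast; rfl, ← Complex.ofReal_log (by positivity)]
      congr 1
      push_cast
      have : (Real.pi : ℂ) ≠ 0 := by exact_mod_cast hpi.ne'
      field_simp
    have e7 : (starRingEnd ℂ) (Complex.exp (-(θ * Complex.I) * (1 / 2 + t * Complex.I))) =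
        Complex.exp (θ * Complex.I / 2 + θ * t) := by
      rw [← Complex.exp_conj]; congr 1
      simp [Complex.conj_ofNat]
      linear_combination (- θ * t : ℂ) * Complex.I_sq
    have e8 : Complex.exp (-(θ * Complex.I) * (1 / 2 + t * Complex.I)) =
        Complex.exp (-(θ * Complex.I / 2)) * Complex.exp (θ * t) := by
      rw [← Complex.exp_add]; congr 1
      linear_combination (- θ * t : ℂ) * Complex.I_sq
    have e9 : Complex.exp (-(θ * Complex.I)) * Complex.exp (θ * Complex.I / 2 + θ * t) =
        Complex.exp (-(θ * Complex.I / 2)) * Complex.exp (θ * t) := by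
      rw [← Complex.exp_add, ← Complex.exp_add]; congr 1; ring
    rw [map_mul, e7, e6, e8]
    have e10 : ∀ K P K' : ℂ, Complex.exp (-(θ * Complex.I / 2)) * Complex.exp (θ * t) * K -
        Complex.I * Complex.exp (-(θ * Complex.I)) * P * (Complex.exp (θ * Complex.I / 2 + θ * t) * K') =
        (Complex.exp (-(θ * Complex.I / 2)) * Complex.exp (θ * t)) * (K - Complex.I * P * K') := by
      intro K P K'
      linear_combination (-Complex.I * P * K') * e9
    rw [e10, norm_mul, norm_mul, Complex.norm_exp, Complex.norm_exp]
    simp)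
  have hA : -(2 * Real.log (2 * Real.pi)) / 2 = -Real.log (2 * Real.pi) := by ring
  rw [hA] at href
  have hlog : 0 ≤ Real.log (2 * Real.pi) := Real.log_nonneg (by linarith)
  have hsq : Integrable (fun u => ‖Φ u‖ ^ 2) := i2.2.integrable_norm_pow (by norm_num)
  have hsq' : Integrable (fun u => ‖φ u‖ ^ 2) := i3.2.integrable_norm_pow (by norm_num)
  have hJ : ∫ u in Iic (-Real.log (2 * Real.pi)), ‖Φ u‖ ^ 2 = ∫ x in Ioi (2 * Real.pi), x ^ (2 * σ - 1) *
          ‖etaLambertSym w x‖ ^ 2 := by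
    rw [hΦ, setIntegral_Iic_norm_sq_logMellin, Real.exp_log (by positivity)]
  have hJ0 : 0 ≤ ∫ u in Iic (-Real.log (2 * Real.pi)), ‖Φ u‖ ^ 2 := by positivity
  have c1 : ∫ u in Iic (-Real.log (2 * Real.pi)), ‖φ u‖ ^ 2 ≤ ∫ u in Iic (-Real.log (2 * Real.pi)), ‖Φ u‖ ^ 2 := by
    refine setIntegral_mono_on hsq'.integrableOn hsq.integrableOn measurableSet_Iic fun u hu => ?_
    rw [hΦ, hφ, norm_sq_logMellin, norm_sq_logMellin]
    gcongr ?_ * _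
    apply Real.exp_le_exp.2
    have : u ≤ 0 := le_trans hu (by linarith)
    nlinarith
  have c2 : ∫ u in Ioi (-Real.log (2 * Real.pi)), ‖Φ u‖ ^ 2 ≤
      ∫ u in Ioi (-Real.log (2 * Real.pi)), (2 * Real.pi) * ‖φ u‖ ^ 2 := by
    refine setIntegral_mono_on hsq.integrableOn (hsq'.const_mul _).integrableOn measurableSet_Ioi fun u hu => ?_
    rw [hΦ, hφ, norm_sq_logMellin, norm_sq_logMellin, ← mul_assoc]
    gcongr ?_ * _
    rw [show 2 * Real.pi * Real.exp (-(2 * (1 / 2) * u)) = Real.exp (Real.log (2 * Real.pi) + -(2 * (1 / 2) * u)) by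
      rw [Real.exp_add, Real.exp_log (by positivity)]]
    apply Real.exp_le_exp.2
    have hu' : -Real.log (2 * Real.pi) < u := hu
    nlinarith
  rw [integral_const_mul] at c2
  have hsplit : ∫ u, ‖Φ u‖ ^ 2 = (∫ u in Iic (-Real.log (2 * Real.pi)), ‖Φ u‖ ^ 2) +
      ∫ u in Ioi (-Real.log (2 * Real.pi)), ‖Φ u‖ ^ 2 := by
    rw [← setIntegral_union (Iic_disjoint_Ioi le_rfl) measurableSet_Ioi hsq.integrableOn hsq.integrableOn,
      Iic_union_Ioi, setIntegral_univ]
  have hfun : (fun t : ℝ => ‖mellin (etaLambertSym w) (σ + t * Complex.I)‖ ^ 2) =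
      fun t : ℝ => (Real.exp (θ * t) * ‖zetaSqKernel (σ + t * Complex.I)‖) ^ 2 := by
    funext t
    rw [hnorm σ (by linarith) (by linarith)]
  rw [hfun] at i1
  refine ⟨i1.1, ?_⟩
  rw [i1.2, ← hwdef, ← hJ, mul_assoc (2 * Real.pi)]
  gcongr
  rw [hsplit]
  rw [← hK0] at href
  obtain ⟨J, hJd⟩ : ∃ J, J = ∫ u in Iic (-Real.log (2 * Real.pi)), ‖Φ u‖ ^ 2 := ⟨_, rfl⟩
  obtain ⟨A, hAd⟩ : ∃ A, A = ∫ u in Ioi (-Real.log (2 * Real.pi)), ‖φ u‖ ^ 2 := ⟨_, rfl⟩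
  rw [← hJd] at c1 hJ0 ⊢
  rw [← hAd] at c2 href
  have : 2 * Real.pi * A ≤ 2 * Real.pi * (2 * J + 8 * K0) := by gcongr; linarith
  nlinarith [mul_nonneg hK00 hJ0, mul_nonneg hpi.le (mul_nonneg hK00 hJ0)]

theorem tsum_card_divisors_mul (G : ℕ → ENNReal) :
    ∑' n : ℕ+, ((n : ℕ).divisors.card : ENNReal) * G n = ∑' a : ℕ+, ∑' b : ℕ+, G (a * b) := by
  rw [← ENNReal.tsum_prod (f := fun a b : ℕ+ => G (a * b)), ← sigmaAntidiagonalEquivProd.tsum_eq]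
  rw [ENNReal.tsum_sigma' ]
  refine tsum_congr fun n => ?_
  rw [tsum_fintype]
  have h : ∀ x : ((n : ℕ).divisorsAntidiagonal),
      G (((sigmaAntidiagonalEquivProd ⟨n, x⟩).1 : ℕ) * ((sigmaAntidiagonalEquivProd ⟨n, x⟩).2 : ℕ)) = G n := by
    rintro ⟨⟨a, b⟩, hab⟩
    simp [sigmaAntidiagonalEquivProd, divisorsAntidiagonalFactors]
    rw [(Nat.mem_divisorsAntidiagonal.1 hab).1]
  rw [Finset.sum_congr rfl fun x _ => h x]
  simp [← Nat.map_div_right_divisors]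

theorem card_divisors_mul_le (a b : ℕ) : (a * b).divisors.card ≤ a.divisors.card * b.divisors.card := by
  rw [Nat.divisors_mul]; exact Finset.card_mul_le

theorem tsum_card_divisors_sq_mul_le (G : ℕ → ENNReal) :
    ∑' n : ℕ+, ((n : ℕ).divisors.card : ENNReal) ^ 2 * G n ≤
      ∑' a : ℕ+, ((a : ℕ).divisors.card : ENNReal) *
        ∑' b : ℕ+, ((b : ℕ).divisors.card : ENNReal) * G (a * b) := by
  have h := tsum_card_divisors_mul (fun n => (n.divisors.card : ENNReal) * G n)
  simp only [sq, mul_assoc]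
  rw [h]
  refine ENNReal.tsum_le_tsum fun a => ?_
  rw [← ENNReal.tsum_mul_left]
  refine ENNReal.tsum_le_tsum fun b => ?_
  rw [← mul_assoc]
  gcongr
  exact_mod_cast card_divisors_mul_le a b

/-- `1 + 1/κ` bounds the zeta function at `1 + κ`. -/
theorem sum_range_rpow_le {κ : ℝ} (hκ : 0 < κ) (N : ℕ) :
    ∑ n ∈ Finset.range N, ((n : ℝ) + 1) ^ (-1 - κ) ≤ 1 + 1 / κ := by
  have key : ∀ n : ℕ, ∑ n ∈ Finset.range (n + 1), ((n : ℝ) + 1) ^ (-1 - κ) ≤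
      1 + 1 / κ - 1 / κ * ((n : ℝ) + 1) ^ (-κ) := by
    intro n
    induction n with
    | zero => simp
    | succ n ih =>
      rw [Finset.sum_range_succ]
      have hn : (0 : ℝ) < (n : ℝ) + 1 := by positivity
      have hn2 : (0 : ℝ) < (n : ℝ) + 1 + 1 := by positivity
      have e1 : ((n : ℝ) + 1) ^ (-κ) = ((n : ℝ) + 1 + 1) ^ (-κ) * (((n : ℝ) + 1 + 1) / ((n : ℝ) + 1)) ^ κ := by
        rw [Real.div_rpow hn2.le hn.le, Real.rpow_neg hn.le, Real.rpow_neg hn2.le]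
        field_simp
      have e2 : κ / ((n : ℝ) + 1 + 1) ≤ (((n : ℝ) + 1 + 1) / ((n : ℝ) + 1)) ^ κ - 1 := by
        rw [Real.rpow_def_of_pos (by positivity)]
        have h1 := Real.add_one_le_exp (Real.log (((n : ℝ) + 1 + 1) / ((n : ℝ) + 1)) * κ)
        have h2 := Real.one_sub_inv_le_log_of_pos (x := ((n : ℝ) + 1 + 1) / ((n : ℝ) + 1)) (by positivity)
        have h3 : 1 - (((n : ℝ) + 1 + 1) / ((n : ℝ) + 1))⁻¹ = 1 / ((n : ℝ) + 1 + 1) := by field_simp; ring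
        rw [h3] at h2
        have h4 : κ / ((n : ℝ) + 1 + 1) = 1 / ((n : ℝ) + 1 + 1) * κ := by ring
        rw [h4]
        nlinarith
      have e3 : ((n : ℝ) + 1 + 1) ^ (-1 - κ) = ((n : ℝ) + 1 + 1) ^ (-κ) / ((n : ℝ) + 1 + 1) := by
        rw [show -1 - κ = -κ - 1 by ring, Real.rpow_sub_one hn2.ne']
      have hA : 0 < ((n : ℝ) + 1 + 1) ^ (-κ) := by positivity
      have e4 : ((n : ℝ) + 1 + 1) ^ (-1 - κ) ≤ 1 / κ * (((n : ℝ) + 1) ^ (-κ) - ((n : ℝ) + 1 + 1) ^ (-κ)) := by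
        rw [e1, e3]
        have := mul_le_mul_of_nonneg_left e2 (mul_nonneg (one_div_pos.2 hκ).le hA.le)
        calc _ = 1 / κ * ((n : ℝ) + 1 + 1) ^ (-κ) * (κ / ((n : ℝ) + 1 + 1)) := by field_simp
          _ ≤ _ := this
          _ = _ := by ring
      push_cast
      linarith
  rcases N with _ | N
  · simp; positivity
  · refine (key N).trans ?_
    have : 0 ≤ 1 / κ * ((N : ℝ) + 1) ^ (-κ) := by positivity
    linarith

theorem tsum_pnat_rpow_le {κ : ℝ} (hκ : 0 < κ) :
    ∑' n : ℕ+, ENNReal.ofReal ((n : ℕ) ^ (-1 - κ)) ≤ ENNReal.ofReal (1 + 1 / κ) := by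
  rw [tsum_pnat_eq_tsum_succ (f := fun n => ENNReal.ofReal ((n : ℝ) ^ (-1 - κ)))]
  refine ENNReal.tsum_le_of_sum_range_le fun N => ?_
  rw [← ENNReal.ofReal_sum_of_nonneg (fun _ _ => by positivity)]
  refine ENNReal.ofReal_le_ofReal ?_
  have := sum_range_rpow_le hκ N
  push_cast
  exact this

theorem exp_neg_le_rpow_neg {y κ : ℝ} (hy : 0 < y) (hκ : 0 < κ) (hκ1 : κ ≤ 1) : Real.exp (-y) ≤ y ^ (-κ) := by
  rw [Real.rpow_def_of_pos hy]
  apply Real.exp_le_exp.2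
  have := Real.log_le_sub_one_of_pos hy
  rcases le_total 0 (Real.log y) with h | h <;> nlinarith

theorem tsum_card_divisors_mul_rpow_le {κ : ℝ} (hκ : 0 < κ) :
    ∑' n : ℕ+, ((n : ℕ).divisors.card : ENNReal) * ENNReal.ofReal ((n : ℕ) ^ (-1 - κ)) ≤
      ENNReal.ofReal (1 + 1 / κ) ^ 2 := by
  rw [tsum_card_divisors_mul (fun n => ENNReal.ofReal ((n : ℝ) ^ (-1 - κ)))]
  have h : ∀ a b : ℕ+, ENNReal.ofReal ((((a : ℕ) * (b : ℕ) : ℕ) : ℝ) ^ (-1 - κ)) =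
      ENNReal.ofReal (((a : ℕ) : ℝ) ^ (-1 - κ)) * ENNReal.ofReal (((b : ℕ) : ℝ) ^ (-1 - κ)) := by
    intro a b
    rw [← ENNReal.ofReal_mul (by positivity), Nat.cast_mul, Real.mul_rpow (by positivity) (by positivity)]
  simp only [h, ENNReal.tsum_mul_left, ENNReal.tsum_mul_right]
  rw [sq]
  gcongr <;> exact tsum_pnat_rpow_le hκ

theorem tsum_card_divisors_sq_mul_exp_div_le {κ τ : ℝ} (hκ : 0 < κ) (hκ1 : κ ≤ 1) (hτ : 0 < τ) :
    ∑' n : ℕ+, ((n : ℕ).divisors.card : ENNReal) ^ 2 * ENNReal.ofReal (Real.exp (-(n * τ)) / (n : ℕ)) ≤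
      ENNReal.ofReal (τ ^ (-κ)) * ENNReal.ofReal (1 + 1 / κ) ^ 4 := by
  have h1 : ∀ n : ℕ+, ENNReal.ofReal (Real.exp (-(n * τ)) / (n : ℕ)) ≤
      ENNReal.ofReal (τ ^ (-κ)) * ENNReal.ofReal ((n : ℕ) ^ (-1 - κ)) := by
    intro n
    have hn : (0 : ℝ) < (n : ℕ) := by exact_mod_cast n.pos
    rw [← ENNReal.ofReal_mul (by positivity)]
    apply ENNReal.ofReal_le_ofReal
    rw [show -1 - κ = -κ - 1 by ring, Real.rpow_sub_one hn.ne', ← mul_div_assoc, mul_comm (τ ^ (-κ)),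
      ← Real.mul_rpow hn.le hτ.le]
    gcongr
    exact exp_neg_le_rpow_neg (by positivity) hκ hκ1
  calc _ ≤ ∑' n : ℕ+, ((n : ℕ).divisors.card : ENNReal) ^ 2 *
        (ENNReal.ofReal (τ ^ (-κ)) * ENNReal.ofReal ((n : ℕ) ^ (-1 - κ))) :=
        ENNReal.tsum_le_tsum fun n => by gcongr; exact h1 n
    _ ≤ _ := tsum_card_divisors_sq_mul_le (fun n => ENNReal.ofReal (τ ^ (-κ)) * ENNReal.ofReal ((n : ℝ) ^ (-1 - κ)))
    _ = ENNReal.ofReal (τ ^ (-κ)) * ((∑' n : ℕ+, ((n : ℕ).divisors.card : ENNReal) * ENNReal.ofReal ((n : ℕ) ^ (-1 - κ))) *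
          (∑' n : ℕ+, ((n : ℕ).divisors.card : ENNReal) * ENNReal.ofReal ((n : ℕ) ^ (-1 - κ)))) := by
        rw [← ENNReal.tsum_mul_right, ← ENNReal.tsum_mul_left]
        refine tsum_congr fun a => ?_
        rw [← ENNReal.tsum_mul_left, ← ENNReal.tsum_mul_left, ← ENNReal.tsum_mul_left]
        refine tsum_congr fun b => ?_
        have : ENNReal.ofReal (((a : ℕ) * (b : ℕ) : ℝ) ^ (-1 - κ)) =
            ENNReal.ofReal (((a : ℕ) : ℝ) ^ (-1 - κ)) * ENNReal.ofReal (((b : ℕ) : ℝ) ^ (-1 - κ)) := by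
          rw [← ENNReal.ofReal_mul (by positivity), Real.mul_rpow (by positivity) (by positivity)]
        push_cast
        rw [this]; ring
    _ ≤ _ := by
        rw [show 4 = 2 + 2 by rfl, pow_add]
        gcongr <;> exact tsum_card_divisors_mul_rpow_le hκ

theorem tsum_exp_neg_mul_le {u : ℝ} (hu : 0 < u) :
    ∑' n : ℕ+, ENNReal.ofReal (Real.exp (-(n * u))) ≤ ENNReal.ofReal (Real.exp (-(u / 2)) / u) := by
  have hr : Real.exp (-u) < 1 := by rw [Real.exp_lt_one_iff]; linarith
  have hs := (hasSum_geometric_of_lt_one (Real.exp_pos (-u)).le hr).mul_left (Real.exp (-u))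
  rw [tsum_pnat_eq_tsum_succ (f := fun n => ENNReal.ofReal (Real.exp (-(n * u))))]
  have h1 : ∀ n : ℕ, Real.exp (-(((n + 1 : ℕ) : ℝ) * u)) = Real.exp (-u) * Real.exp (-u) ^ n := by
    intro n
    rw [← Real.exp_nat_mul, ← Real.exp_add]; congr 1; push_cast; ring
  simp only [h1]
  rw [← ENNReal.ofReal_tsum_of_nonneg (fun _ => by positivity) hs.summable, hs.tsum_eq]
  apply ENNReal.ofReal_le_ofReal
  have h2 : 0 < 1 - Real.exp (-u) := by linarith
  rw [← div_eq_mul_inv, div_le_div_iff₀ h2 hu]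
  have h3 : Real.exp (-u) = Real.exp (-(u / 2)) * Real.exp (-(u / 2)) := by rw [← Real.exp_add]; ring_nf
  have h4 := Real.self_le_sinh_iff.2 (show 0 ≤ u / 2 by linarith)
  rw [Real.sinh_eq] at h4
  have h5 : Real.exp (u / 2) * Real.exp (-(u / 2)) = 1 := by rw [← Real.exp_add]; simp
  have h6 := Real.exp_pos (-(u / 2))
  rw [h3]
  nlinarith

theorem tsum_card_divisors_sq_mul_exp_le {κ τ : ℝ} (hκ : 0 < κ) (hκ1 : κ ≤ 1) (hτ : 0 < τ) :
    ∑' n : ℕ+, ((n : ℕ).divisors.card : ENNReal) ^ 2 * ENNReal.ofReal (Real.exp (-(n * τ))) ≤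
      ENNReal.ofReal (τ⁻¹ * (τ / 2) ^ (-κ)) * ENNReal.ofReal (1 + 1 / κ) ^ 3 := by
  have hcast : ∀ n : ℕ+, (0 : ℝ) < (n : ℕ) := fun n => by exact_mod_cast n.pos
  have h1 : ∀ a b : ℕ+, ∑' d : ℕ+, ENNReal.ofReal (Real.exp (-(((a : ℕ) * ((b : ℕ) * (d : ℕ)) : ℕ) * τ))) ≤
      ENNReal.ofReal (τ⁻¹ * (τ / 2) ^ (-κ)) * (ENNReal.ofReal ((a : ℕ) ^ (-1 - κ)) *
        ENNReal.ofReal ((b : ℕ) ^ (-1 - κ))) := by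
    intro a b
    have ha := hcast a
    have hb := hcast b
    have hu : 0 < (a : ℕ) * (b : ℕ) * τ := by positivity
    have := tsum_exp_neg_mul_le hu
    refine (le_of_eq ?_).trans (this.trans ?_)
    · refine tsum_congr fun d => ?_
      congr 3; push_cast; ring
    rw [← ENNReal.ofReal_mul (by positivity), ← ENNReal.ofReal_mul (by positivity)]
    apply ENNReal.ofReal_le_ofReal
    have h2 := exp_neg_le_rpow_neg (y := (a : ℕ) * (b : ℕ) * τ / 2) (by positivity) hκ hκ1
    have h3 : ((a : ℕ) * (b : ℕ) * τ / 2 : ℝ) ^ (-κ) = (a : ℕ) ^ (-κ) * (b : ℕ) ^ (-κ) * (τ / 2) ^ (-κ) := by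
      rw [mul_div_assoc, Real.mul_rpow (by positivity) (by positivity), Real.mul_rpow (by positivity) (by positivity)]
    rw [h3] at h2
    rw [show -1 - κ = -κ - 1 by ring, Real.rpow_sub_one ha.ne', Real.rpow_sub_one hb.ne', div_le_iff₀ hu]
    refine h2.trans (le_of_eq ?_)
    field_simp
  calc _ ≤ _ := tsum_card_divisors_sq_mul_le (fun n => ENNReal.ofReal (Real.exp (-(n * τ))))
    _ = ∑' a : ℕ+, ((a : ℕ).divisors.card : ENNReal) * ∑' b : ℕ+, ∑' d : ℕ+,
          ENNReal.ofReal (Real.exp (-(((a : ℕ) * ((b : ℕ) * (d : ℕ)) : ℕ) * τ))) := by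
        refine tsum_congr fun a => ?_
        rw [← tsum_card_divisors_mul (fun n => ENNReal.ofReal (Real.exp (-(((a : ℕ) * n : ℕ) * τ))))]
    _ ≤ ∑' a : ℕ+, ((a : ℕ).divisors.card : ENNReal) * ∑' b : ℕ+,
          ENNReal.ofReal (τ⁻¹ * (τ / 2) ^ (-κ)) * (ENNReal.ofReal ((a : ℕ) ^ (-1 - κ)) *
        ENNReal.ofReal ((b : ℕ) ^ (-1 - κ))) := by
        refine ENNReal.tsum_le_tsum fun a => ?_
        gcongr with b
        exact h1 a b
    _ = ENNReal.ofReal (τ⁻¹ * (τ / 2) ^ (-κ)) * ((∑' a : ℕ+, ((a : ℕ).divisors.card : ENNReal) * ENNReal.ofReal ((a : ℕ) ^ (-1 - κ))) *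
          ∑' b : ℕ+, ENNReal.ofReal ((b : ℕ) ^ (-1 - κ))) := by
        simp only [ENNReal.tsum_mul_left]
        rw [← ENNReal.tsum_mul_right, ← ENNReal.tsum_mul_left]
        refine tsum_congr fun a => ?_
        ring
    _ ≤ _ := by
        rw [show 3 = 2 + 1 by rfl, pow_add, pow_one]
        gcongr
        · exact tsum_card_divisors_mul_rpow_le hκ
        · exact tsum_pnat_rpow_le hκ

/-- Majorant of the off-diagonal weights in the mean square of a Lambert series. -/
noncomputable def hilbertKernel (c : ℝ) (m n : ℕ) : ℝ :=
  Real.exp (-((m + n) * c / 2)) * (if m = n then 1 / (n * c) else 2 / |(m : ℝ) - n|)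

theorem hilbertKernel_symm (c : ℝ) (m n : ℕ) : hilbertKernel c m n = hilbertKernel c n m := by
  rw [hilbertKernel, hilbertKernel, add_comm (m : ℝ), abs_sub_comm]
  by_cases h : m = n
  · simp [h]
  · simp [h, Ne.symm h]

theorem tsum_exp_div_le {c : ℝ} (hc : 0 < c) (hc1 : c ≤ 1) :
    ∑' k : ℕ, ENNReal.ofReal (Real.exp (-((k + 1 : ℕ) * (c / 4))) / ((k + 1 : ℕ) : ℝ)) ≤
      ENNReal.ofReal (Real.log (8 / c)) := by
  have hr : Real.exp (-(c / 4)) < 1 := by rw [Real.exp_lt_one_iff]; linarith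
  have hs := Real.hasSum_pow_div_log_of_abs_lt_one (x := Real.exp (-(c / 4)))
    (by rw [abs_of_pos (Real.exp_pos _)]; exact hr)
  have h1 : ∀ k : ℕ, Real.exp (-((k + 1 : ℕ) * (c / 4))) / ((k + 1 : ℕ) : ℝ) =
      Real.exp (-(c / 4)) ^ (k + 1) / ((k : ℝ) + 1) := by
    intro k
    rw [← Real.exp_nat_mul]; push_cast; ring_nf
  simp only [h1]
  rw [← ENNReal.ofReal_tsum_of_nonneg (fun _ => by positivity) hs.summable, hs.tsum_eq]
  apply ENNReal.ofReal_le_ofReal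
  rw [← Real.log_inv]
  have h2 : c / 8 ≤ 1 - Real.exp (-(c / 4)) := by
    have := Real.exp_bound_div_one_sub_of_interval' (x := c / 4) (by linarith) (by linarith)
    have h3 : Real.exp (c / 4) ≥ 1 + c / 4 := by linarith [Real.add_one_le_exp (c / 4)]
    rw [Real.exp_neg]
    have h4 : (Real.exp (c / 4))⁻¹ ≤ (1 + c / 4)⁻¹ := inv_anti₀ (by linarith) h3
    have h5 : (1 + c / 4)⁻¹ ≤ 1 - c / 8 := by
      rw [inv_le_comm₀ (by linarith) (by linarith), ← one_div, div_le_iff₀ (by linarith)]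
      nlinarith
    linarith
  apply Real.log_le_log (inv_pos.2 (by linarith))
  rw [inv_le_comm₀ (by linarith) (by positivity)]
  rw [inv_div]; exact h2

theorem tsum_hilbertKernel_le {c : ℝ} (hc : 0 < c) (hc1 : c ≤ 1) (n : ℕ) :
    ∑' m : ℕ, ENNReal.ofReal (hilbertKernel c m n) ≤
      ENNReal.ofReal (Real.exp (-(n * c)) / n) * ENNReal.ofReal (1 / c) +
        ENNReal.ofReal (Real.exp (-(n * (c / 4)))) * ENNReal.ofReal (4 * Real.log (8 / c)) := by
  obtain ⟨g, hg⟩ : ∃ g : ℤ → ENNReal, g = fun j => if j = 0 then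
    ENNReal.ofReal (Real.exp (-(n * c)) / n) * ENNReal.ofReal (1 / c) else
    ENNReal.ofReal (2 * Real.exp (-(n * (c / 4)))) * ENNReal.ofReal (Real.exp (-(j.natAbs * (c / 4))) / j.natAbs) := ⟨_, rfl⟩
  have h1 : ∀ m : ℕ, ENNReal.ofReal (hilbertKernel c m n) ≤ g ((m : ℤ) - n) := by
    intro m
    by_cases h : m = n
    · rw [hg, hilbertKernel]
      simp only [h, sub_self, if_true]
      rw [← ENNReal.ofReal_mul (by positivity)]
      apply ENNReal.ofReal_le_ofReal
      apply le_of_eq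
      rw [show ((n : ℝ) + n) * c / 2 = n * c by ring]
      ring
    · have h' : (m : ℤ) - n ≠ 0 := by omega
      rw [hg, hilbertKernel]
      simp only [h, if_false, h']
      rw [← ENNReal.ofReal_mul (by positivity)]
      apply ENNReal.ofReal_le_ofReal
      have e1 : (((m : ℤ) - n).natAbs : ℝ) = |(m : ℝ) - n| := by
        rw [Nat.cast_natAbs]; push_cast; rfl
      rw [e1]
      have hpos : 0 < |(m : ℝ) - n| := by
        rw [abs_pos, sub_ne_zero]; exact_mod_cast h
      have e2 : Real.exp (-((m + n) * c / 2)) ≤ Real.exp (-(n * (c / 4))) * Real.exp (-(|(m : ℝ) - n| * (c / 4))) := by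
        rw [← Real.exp_add]
        apply Real.exp_le_exp.2
        have hm0 : (0 : ℝ) ≤ m := Nat.cast_nonneg m
        have hn0 : (0 : ℝ) ≤ n := Nat.cast_nonneg n
        have : |(m : ℝ) - n| ≤ m + n := by rw [abs_le]; constructor <;> linarith
        nlinarith [mul_nonneg hm0 hc.le, mul_nonneg hn0 hc.le, mul_le_mul_of_nonneg_right this hc.le]
      calc _ ≤ (Real.exp (-(n * (c / 4))) * Real.exp (-(|(m : ℝ) - n| * (c / 4)))) * (2 / |(m : ℝ) - n|) := by gcongr
        _ = _ := by ring
  have h2 : Function.Injective (fun m : ℕ => (m : ℤ) - n) := by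
    intro a b h; simpa using h
  calc _ ≤ ∑' m : ℕ, g ((m : ℤ) - n) := ENNReal.tsum_le_tsum h1
    _ ≤ ∑' j : ℤ, g j := ENNReal.tsum_comp_le_tsum_of_injective h2 g
    _ = ∑' k : ℕ, g k + ∑' k : ℕ, g (-(k + 1)) :=
        tsum_of_nat_of_neg_add_one ENNReal.summable ENNReal.summable
    _ = g 0 + ∑' k : ℕ, g ((k + 1 : ℕ) : ℤ) + ∑' k : ℕ, g (-(k + 1)) := by
        rw [tsum_eq_zero_add' ENNReal.summable]; simp
    _ ≤ _ := by
        have e1 : ∀ k : ℕ, g ((k + 1 : ℕ) : ℤ) = ENNReal.ofReal (2 * Real.exp (-(n * (c / 4)))) *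
            ENNReal.ofReal (Real.exp (-((k + 1 : ℕ) * (c / 4))) / ((k + 1 : ℕ) : ℝ)) := by
          intro k
          have : ((k + 1 : ℕ) : ℤ) ≠ 0 := by omega
          rw [hg]; simp only [this, if_false, Int.natAbs_natCast]
        have e2 : ∀ k : ℕ, g (-((k : ℤ) + 1)) = ENNReal.ofReal (2 * Real.exp (-(n * (c / 4)))) *
            ENNReal.ofReal (Real.exp (-((k + 1 : ℕ) * (c / 4))) / ((k + 1 : ℕ) : ℝ)) := by
          intro k
          have : -((k : ℤ) + 1) ≠ 0 := by omega
          have h3 : (-((k : ℤ) + 1)).natAbs = k + 1 := by omega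
          rw [hg]; simp only [this, if_false, h3]
        simp only [e1, e2, ENNReal.tsum_mul_left]
        have e3 : g 0 = ENNReal.ofReal (Real.exp (-(n * c)) / n) * ENNReal.ofReal (1 / c) := by
          rw [hg]; simp
        rw [e3, add_assoc, ← two_mul]
        refine add_le_add le_rfl ?_
        calc _ ≤ 2 * (ENNReal.ofReal (2 * Real.exp (-(n * (c / 4)))) * ENNReal.ofReal (Real.log (8 / c))) := by
              gcongr; exact tsum_exp_div_le hc hc1
          _ = _ := by
              have : (2 : ENNReal) = ENNReal.ofReal 2 := by simp
              rw [this, ENNReal.ofReal_mul (by norm_num), ENNReal.ofReal_mul (p := 4) (by norm_num), show (4 : ℝ) = 2 * 2 by norm_num, ENNReal.ofReal_mul (by norm_num)]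
              ring

theorem tsum_card_divisors_mul_hilbertKernel_le {c : ℝ} (hc : 0 < c) (hc1 : c ≤ Real.exp (-1)) :
    ∑' p : ℕ × ℕ, (p.1.divisors.card : ENNReal) * p.2.divisors.card * ENNReal.ofReal (hilbertKernel c p.1 p.2) ≤
      ENNReal.ofReal (100000 * c⁻¹ * Real.log c⁻¹ ^ 4) := by
  have hc1' : c ≤ 1 := hc1.trans (by rw [Real.exp_le_one_iff]; norm_num)
  obtain ⟨l, hl⟩ : ∃ l, l = Real.log c⁻¹ := ⟨_, rfl⟩
  have hl1 : 1 ≤ l := by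
    rw [hl, Real.log_inv]
    have := Real.log_le_log hc hc1
    rw [Real.log_exp] at this; linarith
  rw [← hl]
  obtain ⟨D, hD⟩ : ∃ D : ℕ → ENNReal, D = fun n => (n.divisors.card : ENNReal) := ⟨_, rfl⟩
  have hD0 : D 0 = 0 := by simp [hD]
  have h1 : ∑' p : ℕ × ℕ, (p.1.divisors.card : ENNReal) * p.2.divisors.card * ENNReal.ofReal (hilbertKernel c p.1 p.2) ≤
      2 * ∑' n : ℕ, D n ^ 2 * ∑' m : ℕ, ENNReal.ofReal (hilbertKernel c m n) := by
    have e : ∀ a b : ℕ, (a.divisors.card : ENNReal) * b.divisors.card ≤ D a ^ 2 + D b ^ 2 := by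
      intro a b
      simp only [hD]
      have : a.divisors.card * b.divisors.card ≤ a.divisors.card ^ 2 + b.divisors.card ^ 2 := by nlinarith [sq_nonneg ((a.divisors.card : ℤ) - b.divisors.card), Nat.zero_le (a.divisors.card * b.divisors.card), two_mul_le_add_sq a.divisors.card b.divisors.card]
      exact_mod_cast this
    calc _ ≤ ∑' p : ℕ × ℕ, (D p.1 ^ 2 + D p.2 ^ 2) * ENNReal.ofReal (hilbertKernel c p.1 p.2) := by
          refine ENNReal.tsum_le_tsum fun p => ?_
          gcongr; exact e _ _
      _ = ∑' (m : ℕ) (n : ℕ), D m ^ 2 * ENNReal.ofReal (hilbertKernel c m n) +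
          ∑' (m : ℕ) (n : ℕ), D n ^ 2 * ENNReal.ofReal (hilbertKernel c m n) := by
          rw [ENNReal.tsum_prod (f := fun m n => (D m ^ 2 + D n ^ 2) * ENNReal.ofReal (hilbertKernel c m n)),
            ← ENNReal.tsum_add]
          refine tsum_congr fun m => ?_
          rw [← ENNReal.tsum_add]
          refine tsum_congr fun n => ?_
          rw [add_mul]
      _ = ∑' (n : ℕ) (m : ℕ), D n ^ 2 * ENNReal.ofReal (hilbertKernel c m n) +
          ∑' (n : ℕ) (m : ℕ), D n ^ 2 * ENNReal.ofReal (hilbertKernel c m n) := by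
          congr 1
          · refine tsum_congr fun m => tsum_congr fun n => ?_
            rw [hilbertKernel_symm]
          · exact ENNReal.tsum_comm
      _ = _ := by rw [← two_mul]; simp only [ENNReal.tsum_mul_left]
  refine h1.trans ?_
  have h2 : ∑' n : ℕ, D n ^ 2 * ∑' m : ℕ, ENNReal.ofReal (hilbertKernel c m n) =
      ∑' n : ℕ+, D n ^ 2 * ∑' m : ℕ, ENNReal.ofReal (hilbertKernel c m n) := by
    rw [tsum_pnat_eq_tsum_succ (f := fun n => D n ^ 2 * ∑' m : ℕ, ENNReal.ofReal (hilbertKernel c m n)),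
      tsum_eq_zero_add' ENNReal.summable, hD0]
    simp
  rw [h2]
  have hκ : 0 < 1 / l := by positivity
  have hκ1 : 1 / l ≤ 1 := by rw [div_le_one (by positivity)]; exact hl1
  have hS1 := tsum_card_divisors_sq_mul_exp_div_le hκ hκ1 hc
  have hS0 := tsum_card_divisors_sq_mul_exp_le (τ := c / 4) hκ hκ1 (by positivity)
  rw [one_div_one_div] at hS1 hS0
  have hck : c ^ (-(1 / l)) = Real.exp 1 := by
    rw [Real.rpow_def_of_pos hc, hl, Real.log_inv]
    congr 1
    have : Real.log c ≠ 0 := by rw [Real.log_inv] at hl; intro h; rw [h] at hl; linarith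
    field_simp
  have hck8 : (c / 4 / 2) ^ (-(1 / l)) ≤ 8 * Real.exp 1 := by
    rw [show c / 4 / 2 = c * (1 / 8) by ring, Real.mul_rpow hc.le (by norm_num), hck, mul_comm]
    gcongr
    rw [Real.rpow_neg (by norm_num), ← Real.inv_rpow (by norm_num), show ((1:ℝ)/8)⁻¹ = 8 by norm_num]
    calc (8:ℝ) ^ (1 / l) ≤ 8 ^ (1:ℝ) := Real.rpow_le_rpow_of_exponent_le (by norm_num) hκ1
      _ = 8 := by norm_num
  have he3 : Real.exp 1 ≤ 3 := by linarith [Real.exp_one_lt_d9]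
  have hL : Real.log (8 / c) ≤ 4 * l := by
    rw [div_eq_mul_inv, Real.log_mul (by norm_num) (by positivity), ← hl]
    have : Real.log 8 = 3 * Real.log 2 := by
      rw [show (8:ℝ) = 2 ^ 3 by norm_num, Real.log_pow]; norm_num
    linarith [Real.log_two_lt_d9]
  calc 2 * ∑' n : ℕ+, D n ^ 2 * ∑' m : ℕ, ENNReal.ofReal (hilbertKernel c m n)
      ≤ 2 * ∑' n : ℕ+, (D n ^ 2 * ENNReal.ofReal (Real.exp (-(n * c)) / (n : ℕ)) * ENNReal.ofReal (1 / c) +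
        D n ^ 2 * ENNReal.ofReal (Real.exp (-(n * (c / 4)))) * ENNReal.ofReal (4 * Real.log (8 / c))) := by
        gcongr with n
        rw [mul_assoc, mul_assoc, ← mul_add]
        gcongr
        exact tsum_hilbertKernel_le hc hc1' n
    _ = 2 * ((∑' n : ℕ+, D n ^ 2 * ENNReal.ofReal (Real.exp (-(n * c)) / (n : ℕ))) * ENNReal.ofReal (1 / c) +
        (∑' n : ℕ+, D n ^ 2 * ENNReal.ofReal (Real.exp (-(n * (c / 4))))) * ENNReal.ofReal (4 * Real.log (8 / c))) := by
        rw [ENNReal.tsum_add, ENNReal.tsum_mul_right, ENNReal.tsum_mul_right]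
    _ ≤ 2 * ((ENNReal.ofReal 3 * ENNReal.ofReal (2 * l) ^ 4) * ENNReal.ofReal (1 / c) +
        (ENNReal.ofReal ((c / 4)⁻¹ * 24) * ENNReal.ofReal (2 * l) ^ 3) * ENNReal.ofReal (4 * (4 * l))) := by
        rw [hD]
        gcongr
        · refine hS1.trans ?_
          rw [hck]
          gcongr
          linarith
        · refine hS0.trans ?_
          gcongr
          · linarith
          · linarith
    _ = ENNReal.ofReal (2 * ((3 * (2 * l) ^ 4) * (1 / c) + ((c / 4)⁻¹ * 24 * (2 * l) ^ 3) * (4 * (4 * l)))) := by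
        rw [← ENNReal.ofReal_pow (by positivity), ← ENNReal.ofReal_pow (by positivity), ← ENNReal.ofReal_mul (by positivity),
          ← ENNReal.ofReal_mul (by positivity), ← ENNReal.ofReal_mul (by positivity), ← ENNReal.ofReal_mul (by positivity),
          ← ENNReal.ofReal_add (by positivity) (by positivity), ENNReal.ofReal_mul (p := 2) (by norm_num)]
        simp
    _ ≤ _ := by
        apply ENNReal.ofReal_le_ofReal
        have : 0 ≤ c⁻¹ * l ^ 4 := by positivity
        have e : 2 * ((3 * (2 * l) ^ 4) * (1 / c) + ((c / 4)⁻¹ * 24 * (2 * l) ^ 3) * (4 * (4 * l))) =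
            24672 * (c⁻¹ * l ^ 4) := by
          rw [inv_div, one_div]; ring
        rw [e, mul_assoc]; nlinarith

theorem exists_integral_norm_sq_etaLambert_le {w : ℂ} (hw : ‖w‖ = 1) (hc : 0 < w.re)
    (hc1 : w.re ≤ Real.exp (-1)) :
    IntegrableOn (fun x : ℝ => Real.exp (w.re / 2 * x) * ‖etaLambert w x‖ ^ 2) (Ioi 1) ∧
    ∫ x in Ioi (1 : ℝ), Real.exp (w.re / 2 * x) * ‖etaLambert w x‖ ^ 2 ≤
      100000 * w.re⁻¹ * Real.log w.re⁻¹ ^ 4 := by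
  obtain ⟨c, hcd⟩ : ∃ c, c = w.re := ⟨_, rfl⟩
  rw [← hcd] at hc hc1 ⊢
  have hc3 : c ≤ 1 / 2 := by
    refine hc1.trans ?_
    rw [Real.exp_neg, inv_le_comm₀ (Real.exp_pos _) (by norm_num)]
    linarith [Real.add_one_le_exp 1]
  have him : 1 / 2 ≤ |w.im| := by
    have h := Complex.sq_norm_sub_sq_re w
    rw [hw, ← hcd] at h
    by_contra hlt
    push Not at hlt
    have : w.im ^ 2 < (1 / 2) ^ 2 := by rw [← sq_abs w.im]; gcongr
    nlinarith
  have hl : 0 ≤ Real.log c⁻¹ := Real.log_nonneg (by rw [le_inv_comm₀ (by norm_num) hc]; linarith)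
  constructor
  · obtain ⟨M, hM⟩ := exists_norm_etaLambert_le hw (hcd ▸ hc)
    have h1 : IntegrableOn (fun x : ℝ => M ^ 2 * Real.exp (-(c / 2) * x)) (Ioi 1) :=
      (integrableOn_exp_mul_Ioi (by linarith) 1).const_mul _
    refine Integrable.mono' h1 ?_ ?_
    · apply ContinuousOn.aestronglyMeasurable _ measurableSet_Ioi
      have := (continuousOn_etaLambert (hcd ▸ hc)).mono (Ioi_subset_Ioi (zero_le_one' ℝ))
      exact (by fun_prop : Continuous fun x : ℝ => Real.exp (c / 2 * x)).continuousOn.mul (this.norm.pow 2)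
    · refine (ae_restrict_iff' measurableSet_Ioi).2 (ae_of_all _ fun x hx => ?_)
      have hx0 : (0:ℝ) < x := lt_trans one_pos hx
      rw [Real.norm_of_nonneg (by positivity)]
      have := hM x hx0
      rw [← hcd] at this
      calc _ ≤ Real.exp (c / 2 * x) * (M * Real.exp (-(c / 2 * x))) ^ 2 := by gcongr
        _ = _ := by
          rw [mul_pow, ← Real.exp_nat_mul, mul_left_comm, ← Real.exp_add]; congr 2; push_cast; ring
  obtain ⟨μ, hμ⟩ : ∃ μ : ℕ × ℕ → ℂ, μ = fun p => p.1 * w + p.2 * (starRingEnd ℂ) w - c / 2 := ⟨_, rfl⟩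
  obtain ⟨A, hA⟩ : ∃ A : ℕ × ℕ → ℂ, A = fun p => etaSqCoeff p.1 * (starRingEnd ℂ) (etaSqCoeff p.2) := ⟨_, rfl⟩
  have hμre : ∀ p, (μ p).re = (p.1 + p.2) * c - c / 2 := by
    intro p; rw [hμ, hcd]; simp; ring
  have hμim : ∀ p, (μ p).im = (p.1 - p.2) * w.im := by
    intro p; rw [hμ, hcd]; simp; ring
  have hA0 : ∀ p : ℕ × ℕ, p.1 = 0 ∨ p.2 = 0 → A p = 0 := by
    rintro ⟨m, n⟩ (h | h) <;> simp only at h <;> simp [hA, h, etaSqCoeff_zero]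
  have hAn : ∀ p : ℕ × ℕ, ‖A p‖ ≤ p.1.divisors.card * p.2.divisors.card := by
    intro p
    rw [hA]; simp only [norm_mul, Complex.norm_conj]
    gcongr <;> exact norm_etaSqCoeff_le _
  obtain ⟨F, hF⟩ : ∃ F : ℕ × ℕ → ℝ → ℂ, F = fun p (x : ℝ) => A p * Complex.exp (-(μ p) * (x : ℂ)) := ⟨_, rfl⟩
  have hre : ∀ p : ℕ × ℕ, p.1 ≠ 0 → p.2 ≠ 0 → (p.1 + p.2) * c / 2 ≤ (μ p).re := by
    intro p h1 h2
    rw [hμre]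
    have : (1:ℝ) ≤ p.1 := by exact_mod_cast Nat.one_le_iff_ne_zero.2 h1
    have : (1:ℝ) ≤ p.2 := by exact_mod_cast Nat.one_le_iff_ne_zero.2 h2
    nlinarith
  have hrepos : ∀ p : ℕ × ℕ, p.1 ≠ 0 → p.2 ≠ 0 → c / 2 ≤ (μ p).re := by
    intro p h1 h2
    refine le_trans ?_ (hre p h1 h2)
    have : (1:ℝ) ≤ p.1 := by exact_mod_cast Nat.one_le_iff_ne_zero.2 h1
    have : (0:ℝ) ≤ p.2 := Nat.cast_nonneg _
    nlinarith
  have hFint : ∀ p, Integrable (F p) (volume.restrict (Ioi (1:ℝ))) := by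
    intro p
    by_cases h : p.1 = 0 ∨ p.2 = 0
    · have : F p = fun _ => 0 := by rw [hF]; funext x; simp [hA0 p h]
      rw [this]; simp
    · push Not at h
      rw [hF]
      apply Integrable.const_mul
      exact integrableOn_exp_mul_complex_Ioi (by simp only [Complex.neg_re]; linarith [hrepos p h.1 h.2]) 1
  have hFnorm : ∀ p (x : ℝ), ‖F p x‖ = ‖A p‖ * Real.exp (-(μ p).re * x) := by
    intro p x
    rw [hF]; simp only [norm_mul, Complex.norm_exp]
    congr 2; simp
  have hq := summable_card_divisors_mul_pow (Real.exp_pos (-(c / 2))).le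
    (by rw [Real.exp_lt_one_iff]; linarith)
  have hFsum : Summable fun p => ∫ x in Ioi (1:ℝ), ‖F p x‖ := by
    have hprod := (hq.mul_of_nonneg hq (fun _ => by positivity) (fun _ => by positivity)).mul_right (2 / c)
    refine Summable.of_nonneg_of_le (fun p => by positivity) (fun p => ?_) hprod
    by_cases h : p.1 = 0 ∨ p.2 = 0
    · simp only [hFnorm, hA0 p h, norm_zero, zero_mul, integral_zero]
      positivity
    · push Not at h
      have hr := hrepos p h.1 h.2
      have hr' := hre p h.1 h.2
      simp only [hFnorm]
      rw [integral_const_mul, integral_exp_mul_Ioi (by linarith)]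
      have e1 : -Real.exp (-(μ p).re * 1) / -(μ p).re = Real.exp (-(μ p).re) * (1 / (μ p).re) := by
        rw [mul_one, neg_div_neg_eq]; ring
      rw [e1]
      calc ‖A p‖ * (Real.exp (-(μ p).re) * (1 / (μ p).re))
          ≤ (p.1.divisors.card * p.2.divisors.card) * (Real.exp (-((p.1 + p.2) * c / 2)) * (1 / (c / 2))) := by
            gcongr
            · have : 0 < (μ p).re := by linarith
              positivity
            · exact hAn p
            · exact (one_div_pos.2 (show 0 < (μ p).re by linarith)).le
        _ = _ := by
            rw [← Real.exp_nat_mul, ← Real.exp_nat_mul,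
              show -(((p.1 : ℝ) + p.2) * c / 2) = (p.1 : ℝ) * -(c / 2) + p.2 * -(c / 2) by ring, Real.exp_add]
            field_simp
  have hsum := hasSum_integral_of_summable_integral_norm hFint hFsum
  have hpt : ∀ x ∈ Ioi (1:ℝ), ∑' p, F p x = ((Real.exp (c / 2 * x) * ‖etaLambert w x‖ ^ 2 : ℝ) : ℂ) := by
    intro x hx
    have hx0 : (0:ℝ) < x := lt_trans one_pos hx
    have hs : Summable fun n : ℕ => ‖etaSqCoeff n * Complex.exp (-(n * x * w))‖ := by
      have := summable_card_divisors_mul_pow (Real.exp_pos (-(c * x))).le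
        (by rw [Real.exp_lt_one_iff]; nlinarith)
      refine Summable.of_nonneg_of_le (fun _ => norm_nonneg _) (fun n => ?_) this
      rw [norm_mul, Complex.norm_exp, ← Real.exp_nat_mul]
      have : (-((n:ℂ) * x * w)).re = n * -(c * x) := by simp [hcd]; ring
      rw [this]
      gcongr
      exact norm_etaSqCoeff_le _
    have hs' : Summable fun n : ℕ => ‖(starRingEnd ℂ) (etaSqCoeff n * Complex.exp (-(n * x * w)))‖ := by
      simpa only [Complex.norm_conj] using hs
    have hm := tsum_mul_tsum_of_summable_norm hs hs'
    have e1 : ∑' n : ℕ, (starRingEnd ℂ) (etaSqCoeff n * Complex.exp (-(n * x * w))) =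
        (starRingEnd ℂ) (etaLambert w x) := (Complex.conj_tsum _).symm
    rw [e1, show ∑' n : ℕ, etaSqCoeff n * Complex.exp (-(n * x * w)) = etaLambert w x from rfl, Complex.mul_conj] at hm
    rw [Complex.ofReal_mul, ← Complex.normSq_eq_norm_sq, hm, ← tsum_mul_left]
    refine tsum_congr fun p => ?_
    rw [hF, hA, hμ]
    simp only [map_mul, ← Complex.exp_conj, Complex.ofReal_exp]
    rw [show Complex.exp ((c / 2 * x : ℝ) : ℂ) * (etaSqCoeff p.1 * Complex.exp (-(p.1 * x * w)) *
      ((starRingEnd ℂ) (etaSqCoeff p.2) * Complex.exp ((starRingEnd ℂ) (-(p.2 * x * w))))) =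
      etaSqCoeff p.1 * (starRingEnd ℂ) (etaSqCoeff p.2) * (Complex.exp ((c / 2 * x : ℝ) : ℂ) *
        Complex.exp (-(p.1 * x * w)) * Complex.exp ((starRingEnd ℂ) (-(p.2 * x * w)))) by ring,
      ← Complex.exp_add, ← Complex.exp_add]
    congr 2
    simp only [map_neg, map_mul, Complex.conj_natCast, Complex.conj_ofReal]
    push_cast
    ring
  have hI : ∫ x in Ioi (1:ℝ), ∑' p, F p x =
      ((∫ x in Ioi (1 : ℝ), Real.exp (c / 2 * x) * ‖etaLambert w x‖ ^ 2 : ℝ) : ℂ) := by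
    rw [setIntegral_congr_fun measurableSet_Ioi hpt]
    exact integral_ofReal
  rw [hI] at hsum
  have hJ0 : 0 ≤ ∫ x in Ioi (1 : ℝ), Real.exp (c / 2 * x) * ‖etaLambert w x‖ ^ 2 := by positivity
  have hterm : ∀ p : ℕ × ℕ, ‖∫ x in Ioi (1:ℝ), F p x‖ₑ ≤
      (p.1.divisors.card : ENNReal) * p.2.divisors.card * ENNReal.ofReal (hilbertKernel c p.1 p.2) := by
    intro p
    by_cases h : p.1 = 0 ∨ p.2 = 0
    · rw [hF]; simp only [hA0 p h, zero_mul, integral_zero, enorm_zero]; positivity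
    · push Not at h
      have hr := hrepos p h.1 h.2
      have hr' := hre p h.1 h.2
      have e : (p.1.divisors.card : ENNReal) * p.2.divisors.card =
          ENNReal.ofReal (p.1.divisors.card * p.2.divisors.card) := by
        rw [ENNReal.ofReal_mul (by positivity), ENNReal.ofReal_natCast, ENNReal.ofReal_natCast]
      rw [e, ← ENNReal.ofReal_mul (by positivity), ← ofReal_norm]
      apply ENNReal.ofReal_le_ofReal
      rw [hF]
      simp only
      rw [integral_const_mul, integral_exp_mul_complex_Ioi (by simp only [Complex.neg_re]; linarith), neg_div_neg_eq,
        norm_mul, norm_div, Complex.norm_exp]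
      have e2 : (-(μ p) * ((1:ℝ):ℂ)).re = -(μ p).re := by simp
      rw [e2, hilbertKernel]
      have hp1 : (1:ℝ) ≤ p.1 := by exact_mod_cast Nat.one_le_iff_ne_zero.2 h.1
      have hp2 : (1:ℝ) ≤ p.2 := by exact_mod_cast Nat.one_le_iff_ne_zero.2 h.2
      have e3 : 1 / ‖μ p‖ ≤ if p.1 = p.2 then 1 / (p.2 * c) else 2 / |(p.1 : ℝ) - p.2| := by
        split_ifs with heq
        · apply one_div_le_one_div_of_le (by positivity)
          refine le_trans ?_ ((Complex.abs_re_le_norm _).trans' (le_abs_self _))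
          rw [heq] at hr'; linarith
        · have hpos : 0 < |(p.1 : ℝ) - p.2| := by rw [abs_pos, sub_ne_zero]; exact_mod_cast heq
          rw [show 2 / |(p.1 : ℝ) - p.2| = 1 / (|(p.1 : ℝ) - p.2| * (1 / 2)) by field_simp]
          apply one_div_le_one_div_of_le (by positivity)
          refine le_trans ?_ (Complex.abs_im_le_norm _)
          rw [hμim, abs_mul]; gcongr
      rw [div_eq_mul_one_div]
      gcongr
      · exact hAn p
  have hfin : ‖((∫ x in Ioi (1 : ℝ), Real.exp (c / 2 * x) * ‖etaLambert w x‖ ^ 2 : ℝ) : ℂ)‖ₑ ≤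
      ENNReal.ofReal (100000 * c⁻¹ * Real.log c⁻¹ ^ 4) := by
    rw [← hsum.tsum_eq]
    exact enorm_tsum_le_tsum_enorm.trans ((ENNReal.tsum_le_tsum hterm).trans
      (tsum_card_divisors_mul_hilbertKernel_le hc hc1))
  rw [← ofReal_norm, Complex.norm_real, Real.norm_of_nonneg hJ0] at hfin
  exact (ENNReal.ofReal_le_ofReal_iff (by positivity)).1 hfin

theorem setIntegral_norm_sq_etaLambertSym_le {w : ℂ} (hw : ‖w‖ = 1) (hc : 0 < w.re)
    (hc1 : w.re ≤ Real.exp (-1)) {a : ℝ} (ha : 0 ≤ a) (ha1 : a ≤ 1) :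
    ∫ x in Ioi (2 * Real.pi), x ^ a * ‖etaLambertSym w x‖ ^ 2 ≤
      (120000000 * w.re⁻¹ * Real.log w.re⁻¹ ^ 4) * w.re ^ (-a) := by
  obtain ⟨c, hcd⟩ : ∃ c, c = w.re := ⟨_, rfl⟩
  obtain ⟨hG, hGle⟩ := exists_integral_norm_sq_etaLambert_le hw hc hc1
  rw [← hcd] at hc hc1 hG hGle ⊢
  obtain ⟨G, hGd⟩ : ∃ G : ℝ → ℝ, G = fun x => Real.exp (c / 2 * x) * ‖etaLambert w x‖ ^ 2 := ⟨_, rfl⟩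
  rw [← hGd] at hG hGle
  have hG0 : ∀ x, 0 ≤ G x := fun x => by rw [hGd]; positivity
  have hpi := Real.pi_gt_three
  obtain ⟨B, hB⟩ : ∃ B, B = 100000 * c⁻¹ * Real.log c⁻¹ ^ 4 := ⟨_, rfl⟩
  rw [← hB] at hGle
  have hsc : ∀ s : ℝ, 1 / 4 ≤ s → IntegrableOn (fun x => G (s * x)) (Ioi (2 * Real.pi)) ∧
      ∫ x in Ioi (2 * Real.pi), G (s * x) ≤ 4 * B := by
    intro s hs
    have hs0 : 0 < s := by linarith
    have hsub : Ioi (s * (2 * Real.pi)) ⊆ Ioi 1 := Ioi_subset_Ioi (by nlinarith)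
    have hi := hG.mono_set hsub
    refine ⟨(integrableOn_Ioi_comp_mul_left_iff G (2 * Real.pi) hs0).2 hi, ?_⟩
    rw [integral_comp_mul_left_Ioi G _ hs0, smul_eq_mul]
    have h1 : ∫ x in Ioi (s * (2 * Real.pi)), G x ≤ ∫ x in Ioi 1, G x :=
      setIntegral_mono_set hG (ae_of_all _ hG0) hsub.eventuallyLE
    have h2 : 0 ≤ ∫ x in Ioi (s * (2 * Real.pi)), G x := integral_nonneg hG0
    have h3 : s⁻¹ ≤ 4 := by rw [inv_le_comm₀ hs0 (by norm_num)]; linarith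
    calc _ ≤ 4 * ∫ x in Ioi (s * (2 * Real.pi)), G x := by gcongr
      _ ≤ _ := by linarith
  obtain ⟨i1, j1⟩ := hsc 1 (by norm_num)
  obtain ⟨i2, j2⟩ := hsc (1 / 2) (by norm_num)
  obtain ⟨i4, j4⟩ := hsc (1 / 4) (by norm_num)
  have hmaj : IntegrableOn (fun x => (96 * c ^ (-a)) * (G (1 * x) + G (1 / 2 * x) + G (1 / 4 * x))) (Ioi (2 * Real.pi)) :=
    ((i1.add i2).add i4).const_mul _
  have hbd : ∀ x ∈ Ioi (2 * Real.pi), x ^ a * ‖etaLambertSym w x‖ ^ 2 ≤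
      (96 * c ^ (-a)) * (G (1 * x) + G (1 / 2 * x) + G (1 / 4 * x)) := by
    intro x hx
    have hx0 : 0 < x := lt_trans (by positivity) hx
    have h1 : x ^ a ≤ 8 * c ^ (-a) * Real.exp (c / 8 * x) := by
      have e1 : x = (8 / c) * (c / 8 * x) := by field_simp
      have e2 : x ^ a = (8 / c) ^ a * (c / 8 * x) ^ a := by
        rw [← Real.mul_rpow (by positivity) (by positivity), ← e1]
      rw [e2, Real.div_rpow (by norm_num) hc.le, div_eq_mul_inv, ← Real.rpow_neg hc.le]
      have e3 : (8:ℝ) ^ a ≤ 8 := by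
        calc (8:ℝ) ^ a ≤ 8 ^ (1:ℝ) := Real.rpow_le_rpow_of_exponent_le (by norm_num) ha1
          _ = 8 := by norm_num
      have e4 : (c / 8 * x) ^ a ≤ Real.exp (c / 8 * x) := by
        have h0 : 0 < c / 8 * x := by positivity
        calc (c / 8 * x) ^ a ≤ (1 + c / 8 * x) ^ a := by gcongr; linarith
          _ ≤ (1 + c / 8 * x) ^ (1:ℝ) := Real.rpow_le_rpow_of_exponent_le (by linarith) ha1
          _ ≤ _ := by rw [Real.rpow_one]; linarith [Real.add_one_le_exp (c / 8 * x)]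
      gcongr
    have h2 : ‖etaLambertSym w x‖ ^ 2 ≤ 12 * (‖etaLambert w (1 * x)‖ ^ 2 + ‖etaLambert w (1 / 2 * x)‖ ^ 2 + ‖etaLambert w (1 / 4 * x)‖ ^ 2) := by
      have e : ‖etaLambertSym w x‖ ≤ ‖etaLambert w (1 * x)‖ + 2 * ‖etaLambert w (1 / 2 * x)‖ + ‖etaLambert w (1 / 4 * x)‖ := by
        rw [etaLambertSym, one_mul]
        refine (norm_add_le _ _).trans ?_
        gcongr
        refine (norm_sub_le _ _).trans ?_
        rw [norm_mul]; simp
      obtain ⟨p, hp⟩ : ∃ p, p = ‖etaLambert w (1 * x)‖ := ⟨_, rfl⟩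
      obtain ⟨q, hq⟩ : ∃ q, q = ‖etaLambert w (1 / 2 * x)‖ := ⟨_, rfl⟩
      obtain ⟨r, hr⟩ : ∃ r, r = ‖etaLambert w (1 / 4 * x)‖ := ⟨_, rfl⟩
      rw [← hp, ← hq, ← hr] at e ⊢
      calc _ ≤ (p + 2 * q + r) ^ 2 := by gcongr
        _ ≤ _ := by nlinarith [sq_nonneg (p - 2 * q), sq_nonneg (p - r), sq_nonneg (2 * q - r), sq_nonneg p, sq_nonneg r]
    have h3 : ∀ s : ℝ, 1 / 4 ≤ s → Real.exp (c / 8 * x) * ‖etaLambert w (s * x)‖ ^ 2 ≤ G (s * x) := by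
      intro s hs
      rw [hGd]
      simp only
      gcongr ?_ * _
      apply Real.exp_le_exp.2
      have : c * x * (1 / 4) ≤ c * x * s := by gcongr
      linarith
    have k1 := h3 1 (by norm_num)
    have k2 := h3 (1 / 2) (by norm_num)
    have k4 := h3 (1 / 4) (by norm_num)
    calc _ ≤ (8 * c ^ (-a) * Real.exp (c / 8 * x)) * (12 * (‖etaLambert w (1 * x)‖ ^ 2 + ‖etaLambert w (1 / 2 * x)‖ ^ 2 + ‖etaLambert w (1 / 4 * x)‖ ^ 2)) := by gcongr
      _ = (96 * c ^ (-a)) * (Real.exp (c / 8 * x) * ‖etaLambert w (1 * x)‖ ^ 2 + Real.exp (c / 8 * x) * ‖etaLambert w (1 / 2 * x)‖ ^ 2 + Real.exp (c / 8 * x) * ‖etaLambert w (1 / 4 * x)‖ ^ 2) := by ring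
      _ ≤ _ := by gcongr
  have hle : ∫ x in Ioi (2 * Real.pi), x ^ a * ‖etaLambertSym w x‖ ^ 2 ≤
      ∫ x in Ioi (2 * Real.pi), (96 * c ^ (-a)) * (G (1 * x) + G (1 / 2 * x) + G (1 / 4 * x)) := by
    refine integral_mono_of_nonneg ?_ hmaj ?_
    · refine (ae_restrict_iff' measurableSet_Ioi).2 (ae_of_all _ fun x hx => ?_)
      have hx0 : 0 < x := lt_trans (by positivity) hx
      simp only [Pi.zero_apply]; positivity
    · exact (ae_restrict_iff' measurableSet_Ioi).2 (ae_of_all _ hbd)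
  refine hle.trans ?_
  have i12 : IntegrableOn (fun x => G (1 * x) + G (1 / 2 * x)) (Ioi (2 * Real.pi)) := i1.add i2
  rw [integral_const_mul, integral_add i12 i4, integral_add i1 i2]
  have hB0 : 0 ≤ c ^ (-a) := by positivity
  calc _ ≤ 96 * c ^ (-a) * (4 * B + 4 * B + 4 * B) := by gcongr
    _ = 115200000 * (c⁻¹ * Real.log c⁻¹ ^ 4) * c ^ (-a) := by rw [hB]; ring
    _ ≤ _ := by
      rw [mul_assoc 120000000]
      have : 0 ≤ c⁻¹ * Real.log c⁻¹ ^ 4 := by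
        have : 0 ≤ Real.log c⁻¹ ^ 4 := by positivity
        positivity
      gcongr; norm_num

theorem exists_integral_zetaSqKernel_le_rpow :
    ∃ C > 0, ∀ θ : ℝ, 0 ≤ θ → θ < Real.pi / 2 → Real.cos θ ≤ Real.exp (-1) →
      ∀ σ : ℝ, 1 / 2 ≤ σ → σ ≤ 3 / 4 →
      Integrable (fun t : ℝ => (Real.exp (θ * t) * ‖zetaSqKernel (σ + t * Complex.I)‖) ^ 2) ∧
      ∫ t : ℝ, (Real.exp (θ * t) * ‖zetaSqKernel (σ + t * Complex.I)‖) ^ 2 ≤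
        C * (Real.cos θ)⁻¹ ^ (2 * σ) * Real.log (Real.cos θ)⁻¹ ^ 4 := by
  obtain ⟨C, hC, h⟩ := exists_integral_zetaSqKernel_le
  refine ⟨C * 120000001, by positivity, fun θ h0 h1 h2 σ hσ hσ1 => ⟨(h θ h0 h1 σ hσ hσ1).1, (h θ h0 h1 σ hσ hσ1).2.trans ?_⟩⟩
  have hcpos : 0 < Real.cos θ := Real.cos_pos_of_mem_Ioo ⟨by linarith [Real.pi_pos], h1⟩
  have hre : (Complex.exp (θ * Complex.I)).re = Real.cos θ := Complex.exp_ofReal_mul_I_re θ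
  have key := setIntegral_norm_sq_etaLambertSym_le (w := Complex.exp (θ * Complex.I))
    (Complex.norm_exp_ofReal_mul_I θ) (by rw [hre]; exact hcpos) (by rw [hre]; exact h2)
    (a := 2 * σ - 1) (by linarith) (by linarith)
  rw [hre] at key
  obtain ⟨c, hc⟩ : ∃ c, c = Real.cos θ := ⟨_, rfl⟩
  rw [← hc] at hcpos h2 key ⊢
  have hl : 1 ≤ Real.log c⁻¹ := by
    rw [Real.log_inv]
    have := Real.log_le_log hcpos h2
    rw [Real.log_exp] at this; linarith
  have hc1 : c ≤ 1 := h2.trans (by rw [Real.exp_le_one_iff]; norm_num)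
  have e1 : c⁻¹ * c ^ (-(2 * σ - 1)) = c⁻¹ ^ (2 * σ) := by
    rw [Real.inv_rpow hcpos.le, ← Real.rpow_neg hcpos.le, ← Real.rpow_neg_one, ← Real.rpow_add hcpos]
    congr 1; ring
  have e2 : 1 ≤ c⁻¹ ^ (2 * σ) * Real.log c⁻¹ ^ 4 := by
    have : 1 ≤ c⁻¹ ^ (2 * σ) := Real.one_le_rpow ((one_le_inv₀ hcpos).2 hc1) (by linarith)
    have := one_le_pow₀ hl (n := 4)
    nlinarith
  rw [mul_assoc, mul_assoc]
  gcongr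
  have e3 : 120000000 * c⁻¹ * Real.log c⁻¹ ^ 4 * c ^ (-(2 * σ - 1)) = 120000000 * (c⁻¹ ^ (2 * σ) * Real.log c⁻¹ ^ 4) := by
    rw [← e1]; ring
  rw [e3] at key
  linarith

theorem sum_range_inv_sq_add_one_le (N : ℕ) :
    ∑ j ∈ Finset.range N, (1:ℝ) / ((j:ℝ) ^ 2 + 1) ≤ 4 - 4 / ((N:ℝ) + 1) := by
  induction N with
  | zero => simp
  | succ N ih =>
    rw [Finset.sum_range_succ]
    have : (1:ℝ) / ((N:ℝ) ^ 2 + 1) ≤ 4 / (N + 1) - 4 / (N + 1 + 1) := by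
      rw [div_sub_div _ _ (by positivity) (by positivity), div_le_div_iff₀ (by positivity) (by positivity)]
      nlinarith [sq_nonneg ((N:ℝ) - 1), (Nat.cast_nonneg N : (0:ℝ) ≤ N)]
    push_cast
    linarith

theorem abs_div_sub_div_le {x y j t : ℝ} (hj : 0 ≤ j) (ht : 1 ≤ t) (hx : x ∈ Icc j (j + 1))
    (hy : y ∈ Icc j (j + 1)) :
    x / (x ^ 2 + t ^ 2) - y / (y ^ 2 + t ^ 2) ≤ 1 / (j ^ 2 + 1) := by
  obtain ⟨hx0, hx1⟩ := hx
  obtain ⟨hy0, hy1⟩ := hy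
  have h1 : x / (x ^ 2 + t ^ 2) - y / (y ^ 2 + t ^ 2) =
      (x - y) * (t ^ 2 - x * y) / ((x ^ 2 + t ^ 2) * (y ^ 2 + t ^ 2)) := by
    have := sq_nonneg x
    have := sq_nonneg y
    field_simp
    ring
  have h2 : (x - y) * (t ^ 2 - x * y) ≤ t ^ 2 + x * y := by
    have : 0 ≤ x * y := mul_nonneg (hj.trans hx0) (hj.trans hy0)
    have : |(x - y) * (t ^ 2 - x * y)| ≤ 1 * (t ^ 2 + x * y) := by
      rw [abs_mul]
      gcongr
      · rw [abs_le]; constructor <;> linarith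
      · rw [abs_le]; constructor <;> nlinarith
    linarith [le_abs_self ((x - y) * (t ^ 2 - x * y))]
  rw [h1, div_le_div_iff₀ (by positivity) (by positivity), one_mul]
  have h3 : (t ^ 2 + x * y) ^ 2 ≤ (x ^ 2 + t ^ 2) * (y ^ 2 + t ^ 2) := by nlinarith [sq_nonneg (t * (x - y))]
  have h4 : j ^ 2 + 1 ≤ t ^ 2 + x * y := by nlinarith
  have h5 : 0 ≤ t ^ 2 + x * y := by nlinarith
  nlinarith

theorem log_sq_add_sub_le {a j t : ℝ} (hj : 0 ≤ j) (ht : 1 ≤ t) (ha : 0 ≤ a) (ha1 : a ≤ 1 / 2) :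
    Real.log ((1 / 2 + a + j) ^ 2 + t ^ 2) / 2 - Real.log ((1 / 2 + j) ^ 2 + t ^ 2) / 2 ≤
      a * (Real.log ((j + 1) ^ 2 + t ^ 2) / 2 - Real.log (j ^ 2 + t ^ 2) / 2) + 1 / (j ^ 2 + 1) := by
  have hd : ∀ x : ℝ, HasDerivAt (fun x => Real.log (x ^ 2 + t ^ 2) / 2) (x / (x ^ 2 + t ^ 2)) x := by
    intro x
    have h := (((hasDerivAt_pow 2 x).add_const (t ^ 2)).log (by positivity)).div_const 2
    refine h.congr_deriv ?_
    push_cast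
    ring
  have hc : Continuous fun x : ℝ => Real.log (x ^ 2 + t ^ 2) / 2 :=
    continuous_iff_continuousAt.2 fun x => (hd x).continuousAt
  obtain ⟨y, hy, hy2⟩ := exists_hasDerivAt_eq_slope _ _ (show j < j + 1 by linarith) hc.continuousOn
    (fun x _ => hd x)
  rcases ha.eq_or_lt with rfl | ha
  · simp; positivity
  obtain ⟨x, hx, hx2⟩ := exists_hasDerivAt_eq_slope _ _ (show 1 / 2 + j < 1 / 2 + a + j by linarith) hc.continuousOn
    (fun x _ => hd x)
  have key := abs_div_sub_div_le (x := x) (y := y) hj ht ⟨by linarith [hx.1], by linarith [hx.2]⟩ ⟨hy.1.le, hy.2.le⟩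
  have e1 : 1 / 2 + a + j - (1 / 2 + j) = a := by ring
  have e2 : j + 1 - j = 1 := by ring
  rw [e1, eq_div_iff ha.ne'] at hx2
  rw [e2, div_one] at hy2
  rw [← hx2, ← hy2]
  have : 0 ≤ 1 / (j ^ 2 + 1) := by positivity
  nlinarith

theorem prod_norm_add_le {a t : ℝ} (ht : 1 ≤ t) (ha : 0 ≤ a) (ha1 : a ≤ 1 / 2) (N : ℕ) :
    ∏ j ∈ Finset.range N, ‖((1 / 2 + a : ℝ) : ℂ) + t * Complex.I + j‖ ≤
      (∏ j ∈ Finset.range N, ‖((1 / 2 : ℝ) : ℂ) + t * Complex.I + j‖) *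
        Real.exp (a * (Real.log ((N:ℝ) ^ 2 + t ^ 2) / 2 - Real.log t) +
          ∑ j ∈ Finset.range N, (1:ℝ) / ((j:ℝ) ^ 2 + 1)) := by
  have hn : ∀ (b : ℝ) (j : ℕ), 0 < b → ‖(b : ℂ) + t * Complex.I + j‖ = Real.exp (Real.log ((b + j) ^ 2 + t ^ 2) / 2) := by
    intro b j hb
    rw [show (b : ℂ) + t * Complex.I + j = ((b + j : ℝ) : ℂ) + t * Complex.I by push_cast; ring,
      Complex.norm_add_mul_I, Real.sqrt_eq_rpow, Real.rpow_def_of_pos (by positivity)]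
    congr 1; ring
  induction N with
  | zero => simp [Real.log_pow]
  | succ N ih =>
    rw [Finset.prod_range_succ, Finset.prod_range_succ, Finset.sum_range_succ]
    have h := log_sq_add_sub_le (Nat.cast_nonneg N) ht ha ha1
    rw [hn _ N (by positivity), hn (1 / 2) N (by positivity)]
    refine (mul_le_mul_of_nonneg_right ih (Real.exp_pos _).le).trans ?_
    rw [mul_assoc, mul_assoc, ← Real.exp_add, ← Real.exp_add]
    refine mul_le_mul_of_nonneg_left (Real.exp_le_exp.2 ?_) (Finset.prod_nonneg fun _ _ => norm_nonneg _)
    push_cast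
    linarith

theorem norm_Gamma_half_le_norm_Gamma {a t : ℝ} (ht : 1 ≤ t) (ha : 0 ≤ a) (ha1 : a ≤ 1 / 2) :
    Real.exp (-5) * t ^ a * ‖Complex.Gamma (((1 / 2 : ℝ) : ℂ) + t * Complex.I)‖ ≤
      ‖Complex.Gamma (((1 / 2 + a : ℝ) : ℂ) + t * Complex.I)‖ := by
  refine le_of_tendsto_of_tendsto
    ((Complex.GammaSeq_tendsto_Gamma (((1 / 2 : ℝ) : ℂ) + t * Complex.I)).norm.const_mul _)
    (Complex.GammaSeq_tendsto_Gamma (((1 / 2 + a : ℝ) : ℂ) + t * Complex.I)).norm ?_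
  filter_upwards [eventually_ge_atTop (⌈t⌉₊ + 1)] with n hn
  have hn' : t + 1 ≤ n := by
    have := Nat.le_ceil t
    have h2 : ((⌈t⌉₊ + 1 : ℕ) : ℝ) ≤ n := by exact_mod_cast hn
    push_cast at h2; linarith
  have hn0 : (0:ℝ) < n := by linarith
  have hnn : 0 < n := by exact_mod_cast hn0
  have hcp : ∀ b : ℝ, ‖(n : ℂ) ^ ((b : ℂ) + t * Complex.I)‖ = (n:ℝ) ^ b := by
    intro b
    rw [Complex.norm_natCast_cpow_of_pos hnn]; simp
  have hpos : ∀ b : ℝ, 0 < b → 0 < ∏ j ∈ Finset.range (n + 1), ‖(b : ℂ) + t * Complex.I + j‖ := by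
    intro b hb
    refine Finset.prod_pos fun j _ => norm_pos_iff.2 fun h => ?_
    have := congrArg Complex.im h
    simp at this; linarith
  have hp := prod_norm_add_le ht ha ha1 (n + 1)
  have hs := sum_range_inv_sq_add_one_le (n + 1)
  have hlog : Real.log (((n + 1 : ℕ):ℝ) ^ 2 + t ^ 2) / 2 ≤ Real.log n + 2 := by
    have : Real.log (((n + 1 : ℕ):ℝ) ^ 2 + t ^ 2) ≤ Real.log (Real.exp 4 * (n:ℝ) ^ 2) := by
      apply Real.log_le_log (by positivity)
      have : (5:ℝ) ≤ Real.exp 4 := by linarith [Real.add_one_le_exp (4:ℝ)]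
      push_cast
      nlinarith
    rw [Real.log_mul (by positivity) (by positivity), Real.log_exp, Real.log_pow] at this
    push_cast at this ⊢
    linarith
  have hexp : Real.exp (a * (Real.log (((n + 1 : ℕ):ℝ) ^ 2 + t ^ 2) / 2 - Real.log t) +
          ∑ j ∈ Finset.range (n + 1), (1:ℝ) / ((j:ℝ) ^ 2 + 1)) ≤ Real.exp 5 * (n:ℝ) ^ a * (t ^ a)⁻¹ := by
    rw [Real.rpow_def_of_pos hn0, Real.rpow_def_of_pos (by linarith), ← Real.exp_neg, ← Real.exp_add, ← Real.exp_add]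
    apply Real.exp_le_exp.2
    have : 0 ≤ (4:ℝ) / (((n + 1 : ℕ):ℝ) + 1) := by positivity
    nlinarith
  have hp' := hp.trans (mul_le_mul_of_nonneg_left hexp (hpos (1 / 2) (by norm_num)).le)
  rw [Complex.GammaSeq, Complex.GammaSeq, norm_div, norm_div, norm_mul, norm_mul, norm_prod, norm_prod, hcp, hcp]
  obtain ⟨P, hP⟩ : ∃ P, P = ∏ j ∈ Finset.range (n + 1), ‖((1 / 2 : ℝ) : ℂ) + t * Complex.I + j‖ := ⟨_, rfl⟩
  obtain ⟨Q, hQ⟩ : ∃ Q, Q = ∏ j ∈ Finset.range (n + 1), ‖((1 / 2 + a : ℝ) : ℂ) + t * Complex.I + j‖ := ⟨_, rfl⟩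
  have hP0 : 0 < P := hP ▸ hpos _ (by norm_num)
  have hQ0 : 0 < Q := hQ ▸ hpos _ (by positivity)
  rw [← hP, ← hQ] at hp' ⊢
  rw [mul_div_assoc', div_le_div_iff₀ hP0 hQ0, Real.rpow_add hn0, Real.exp_neg]
  obtain ⟨A, hA⟩ : ∃ A, A = (n:ℝ) ^ ((1:ℝ) / 2) * ‖((n.factorial : ℕ) : ℂ)‖ := ⟨_, rfl⟩
  have hA0 : 0 ≤ A := by rw [hA]; positivity
  have ht0 : (0:ℝ) < t ^ a := by positivity
  calc _ = (Real.exp 5)⁻¹ * t ^ a * A * Q := by rw [hA]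
    _ ≤ (Real.exp 5)⁻¹ * t ^ a * A * (P * (Real.exp 5 * (n:ℝ) ^ a * (t ^ a)⁻¹)) := by gcongr
    _ = A * (n:ℝ) ^ a * P := by field_simp
    _ = _ := by rw [hA]; ring

theorem norm_sq_Gamma_half (t : ℝ) :
    ‖Complex.Gamma (((1 / 2 : ℝ) : ℂ) + t * Complex.I)‖ ^ 2 = Real.pi / Real.cosh (Real.pi * t) := by
  have h := Complex.Gamma_mul_Gamma_one_sub (((1 / 2 : ℝ) : ℂ) + t * Complex.I)
  have e : 1 - (((1 / 2 : ℝ) : ℂ) + t * Complex.I) = (starRingEnd ℂ) (((1 / 2 : ℝ) : ℂ) + t * Complex.I) := by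
    apply Complex.ext <;> simp; norm_num
  rw [e, Complex.Gamma_conj, Complex.mul_conj, Complex.normSq_eq_norm_sq] at h
  have e2 : Complex.sin (Real.pi * (((1 / 2 : ℝ) : ℂ) + t * Complex.I)) = (Real.cosh (Real.pi * t) : ℝ) := by
    rw [show (Real.pi : ℂ) * (((1 / 2 : ℝ) : ℂ) + t * Complex.I) = (Real.pi * t : ℝ) * Complex.I + Real.pi / 2 by push_cast; ring,
      Complex.sin_add_pi_div_two, Complex.cos_mul_I, Complex.ofReal_cosh]
  rw [e2] at h
  exact_mod_cast h

theorem le_norm_sq_Gamma {σ t : ℝ} (ht : 1 ≤ t) (hσ : 1 / 2 ≤ σ) (hσ1 : σ ≤ 1) :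
    Real.exp (-10) * (t ^ (2 * σ - 1) * Real.exp (-(Real.pi * t))) ≤
      ‖Complex.Gamma ((σ : ℂ) + t * Complex.I)‖ ^ 2 := by
  have h := norm_Gamma_half_le_norm_Gamma (a := σ - 1 / 2) ht (by linarith) (by linarith)
  rw [show 1 / 2 + (σ - 1 / 2) = σ by ring] at h
  have h2 := pow_le_pow_left₀ (by positivity) h 2
  rw [mul_pow, mul_pow, norm_sq_Gamma_half, ← Real.exp_nat_mul, ← Real.rpow_natCast (t ^ _), ← Real.rpow_mul (by linarith)] at h2
  refine le_trans ?_ h2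
  have e1 : (σ - 1 / 2) * ((2:ℕ):ℝ) = 2 * σ - 1 := by push_cast; ring
  have e2 : ((2:ℕ):ℝ) * (-5) = -10 := by norm_num
  rw [e1, e2, mul_assoc]
  gcongr
  rw [Real.exp_neg, le_div_iff₀ (Real.cosh_pos _)]
  have h3 : Real.cosh (Real.pi * t) ≤ Real.exp (Real.pi * t) := by
    rw [Real.cosh_eq]
    have : Real.exp (-(Real.pi * t)) ≤ Real.exp (Real.pi * t) := Real.exp_le_exp.2 (by nlinarith [Real.pi_pos])
    linarith
  calc _ ≤ (Real.exp (Real.pi * t))⁻¹ * Real.exp (Real.pi * t) := by gcongr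
    _ = 1 := inv_mul_cancel₀ (Real.exp_pos _).ne'
    _ ≤ _ := by linarith [Real.pi_gt_three]

theorem le_norm_one_sub_two_cpow {s : ℂ} (h : 1 / 4 ≤ s.re) : 1 / 10 ≤ ‖1 - (2:ℂ) ^ s‖ := by
  have h1 : ‖(2:ℂ) ^ s‖ = (2:ℝ) ^ s.re := by
    have := Complex.norm_cpow_eq_rpow_re_of_pos (show (0:ℝ) < 2 by norm_num) s
    simpa using this
  have h2 : (11:ℝ) / 10 ≤ (2:ℝ) ^ s.re := by
    rw [Real.rpow_def_of_pos (by norm_num)]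
    have := Real.add_one_le_exp (Real.log 2 * s.re)
    have := Real.log_two_gt_d9
    nlinarith
  have h3 := norm_sub_norm_le ((2:ℂ) ^ s) 1
  rw [norm_sub_rev, h1, norm_one] at h3
  linarith

theorem norm_zeta_pow_four_le {σ t : ℝ} (ht : 1 ≤ t) (hσ : 1 / 2 ≤ σ) (hσ1 : σ ≤ 3 / 4) :
    t ^ (2 * σ - 1) * Real.exp (-(Real.pi * t)) * ‖riemannZeta (σ + t * Complex.I)‖ ^ 4 ≤
      10 ^ 8 * Real.exp 10 * ‖zetaSqKernel (σ + t * Complex.I)‖ ^ 2 := by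
  have hG := le_norm_sq_Gamma ht hσ (by linarith)
  have h1 := le_norm_one_sub_two_cpow (s := (σ:ℂ) + t * Complex.I) (by simp; linarith)
  have h2 := le_norm_one_sub_two_cpow (s := 1 - ((σ:ℂ) + t * Complex.I)) (by simp; linarith)
  have h3 : (1:ℝ) / 10 ^ 8 ≤ (‖1 - (2:ℂ) ^ (1 - ((σ:ℂ) + t * Complex.I))‖ * ‖1 - (2:ℂ) ^ ((σ:ℂ) + t * Complex.I)‖) ^ 4 := by
    calc (1:ℝ) / 10 ^ 8 = (1 / 10 * (1 / 10)) ^ 4 := by norm_num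
      _ ≤ _ := by gcongr
  rw [zetaSqKernel, norm_mul, mul_pow, norm_pow, norm_mul, norm_mul, ← pow_mul, mul_pow]
  rw [Real.exp_neg] at hG
  obtain ⟨Z, hZ⟩ : ∃ Z, Z = ‖riemannZeta (σ + t * Complex.I)‖ ^ 4 := ⟨_, rfl⟩
  have hZ0 : 0 ≤ Z := by rw [hZ]; positivity
  have e : ‖riemannZeta (σ + t * Complex.I)‖ ^ (2 * 2) = Z := by rw [hZ]
  rw [e]
  rw [show 2 * 2 = 4 from rfl]
  have hA : t ^ (2 * σ - 1) * Real.exp (-(Real.pi * t)) ≤ Real.exp 10 * ‖Complex.Gamma ((σ : ℂ) + t * Complex.I)‖ ^ 2 := by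
    have := mul_le_mul_of_nonneg_left hG (Real.exp_pos 10).le
    rwa [← mul_assoc, mul_inv_cancel₀ (Real.exp_pos _).ne', one_mul] at this
  obtain ⟨G, hGd⟩ : ∃ G, G = ‖Complex.Gamma ((σ : ℂ) + t * Complex.I)‖ ^ 2 := ⟨_, rfl⟩
  have hG0 : 0 ≤ G := by rw [hGd]; positivity
  rw [← hGd] at hA ⊢
  calc _ ≤ (Real.exp 10 * G) * Z := by gcongr
    _ = 10 ^ 8 * Real.exp 10 * (G * ((1 / 10 ^ 8) * Z)) := by ring
    _ ≤ _ := by gcongr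

theorem continuous_riemannZeta_vertical {σ : ℝ} (hσ : σ ≠ 1) :
    Continuous fun t : ℝ => riemannZeta (σ + t * Complex.I) := by
  refine continuous_iff_continuousAt.2 fun t => ?_
  have h : (σ : ℂ) + t * Complex.I ≠ 1 := fun h => hσ (by simpa using congrArg Complex.re h)
  exact ContinuousAt.comp (f := fun t : ℝ => (σ : ℂ) + t * Complex.I)
    (differentiableAt_riemannZeta h).continuousAt (by fun_prop)

theorem exists_integral_norm_zeta_pow_four_le :
    ∃ C > 0, ∀ X : ℝ, 3 ≤ X → ∀ σ : ℝ, 1 / 2 ≤ σ → σ ≤ 3 / 4 →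
      ∫ t in Ioc X (2 * X), ‖riemannZeta (σ + t * Complex.I)‖ ^ 4 ≤ C * (X * Real.log X ^ 4) := by
  obtain ⟨C, hC, h⟩ := exists_integral_zetaSqKernel_le_rpow
  refine ⟨10 ^ 8 * Real.exp 14 * (C * 64), by positivity, fun X hX σ hσ hσ1 => ?_⟩
  have hX0 : 0 < X := by linarith
  have hpi := Real.pi_gt_three
  have hpi4 := Real.pi_le_four
  have hd : 1 / X ≤ 1 / 3 := by gcongr
  have hd0 : 0 < 1 / X := by positivity
  have hcos : Real.cos (Real.pi / 2 - 1 / X) = Real.sin (1 / X) := Real.cos_pi_div_two_sub _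
  have hs1 : Real.sin (1 / X) ≤ 1 / X := Real.sin_le hd0.le
  have hs2 : 1 / (2 * X) ≤ Real.sin (1 / X) := by
    refine le_trans ?_ (Real.mul_le_sin hd0.le (by linarith))
    rw [show 1 / (2 * X) = 1 / 2 * (1 / X) by field_simp]
    gcongr ?_ * _
    rw [div_le_div_iff₀ (by norm_num) (by linarith)]
    linarith
  have hspos : 0 < Real.sin (1 / X) := lt_of_lt_of_le (by positivity) hs2
  have he : (1:ℝ) / 3 ≤ Real.exp (-1) := by
    rw [Real.exp_neg, ← one_div]
    have := Real.exp_one_lt_d9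
    gcongr
    linarith
  obtain ⟨hi, hle⟩ := h (Real.pi / 2 - 1 / X) (by linarith) (by linarith) (by rw [hcos]; linarith) σ hσ hσ1
  rw [hcos] at hle
  have hlogX : 1 ≤ Real.log X := by
    rw [Real.le_log_iff_exp_le hX0]; linarith [Real.exp_one_lt_d9]
  have hinv : (Real.sin (1 / X))⁻¹ ≤ 2 * X := by
    rw [inv_le_comm₀ hspos (by positivity), ← one_div]; exact hs2
  have hinv1 : 1 ≤ (Real.sin (1 / X))⁻¹ := (one_le_inv₀ hspos).2 (by linarith)
  have hl0 : 0 ≤ Real.log (Real.sin (1 / X))⁻¹ := Real.log_nonneg hinv1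
  have hl : Real.log (Real.sin (1 / X))⁻¹ ≤ 2 * Real.log X := by
    calc _ ≤ Real.log (X * X) := Real.log_le_log (by positivity) (hinv.trans (by nlinarith))
      _ = _ := by rw [Real.log_mul hX0.ne' hX0.ne']; ring
  have hp : (Real.sin (1 / X))⁻¹ ^ (2 * σ) ≤ 4 * X ^ (2 * σ) := by
    calc _ ≤ (2 * X) ^ (2 * σ) := by gcongr
      _ = 2 ^ (2 * σ) * X ^ (2 * σ) := Real.mul_rpow (by norm_num) hX0.le
      _ ≤ 2 ^ (2:ℝ) * X ^ (2 * σ) := by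
        gcongr
        · norm_num
        · linarith
      _ = _ := by norm_num
  have hbd : ∀ t ∈ Ioc X (2 * X), ‖riemannZeta (σ + t * Complex.I)‖ ^ 4 ≤
      (10 ^ 8 * Real.exp 14 * X ^ (1 - 2 * σ)) *
        (Real.exp ((Real.pi / 2 - 1 / X) * t) * ‖zetaSqKernel (σ + t * Complex.I)‖) ^ 2 := by
    intro t ⟨ht0, ht1⟩
    have k := norm_zeta_pow_four_le (t := t) (by linarith) hσ hσ1
    have k1 : X ^ (2 * σ - 1) ≤ t ^ (2 * σ - 1) := Real.rpow_le_rpow hX0.le ht0.le (by linarith)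
    have k2 : Real.exp (-4) ≤ Real.exp ((Real.pi / 2 - 1 / X) * t) ^ 2 * Real.exp (-(Real.pi * t)) := by
      rw [← Real.exp_nat_mul, ← Real.exp_add]
      apply Real.exp_le_exp.2
      have : 1 / X * t ≤ 2 := by rw [one_div_mul_eq_div, div_le_iff₀ hX0]; linarith
      push_cast
      linarith
    obtain ⟨Z, hZ⟩ : ∃ Z, Z = ‖riemannZeta (σ + t * Complex.I)‖ ^ 4 := ⟨_, rfl⟩
    have hZ0 : 0 ≤ Z := by rw [hZ]; positivity
    rw [← hZ] at k ⊢
    obtain ⟨E, hE⟩ : ∃ E, E = Real.exp ((Real.pi / 2 - 1 / X) * t) ^ 2 := ⟨_, rfl⟩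
    have hE0 : 0 ≤ E := by rw [hE]; positivity
    rw [mul_pow, ← hE]
    rw [← hE] at k2
    have e1 : X ^ (1 - 2 * σ) * X ^ (2 * σ - 1) = 1 := by
      rw [← Real.rpow_add hX0]; simp
    have e2 : Real.exp 4 * Real.exp (-4) = 1 := by rw [← Real.exp_add]; simp
    have e3 : Real.exp 14 = Real.exp 4 * Real.exp 10 := by rw [← Real.exp_add]; norm_num
    have hq : 0 ≤ X ^ (1 - 2 * σ) := by positivity
    calc Z = (Real.exp 4 * Real.exp (-4)) * (X ^ (1 - 2 * σ) * X ^ (2 * σ - 1)) * Z := by rw [e1, e2]; ring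
      _ ≤ (Real.exp 4 * (E * Real.exp (-(Real.pi * t)))) * (X ^ (1 - 2 * σ) * t ^ (2 * σ - 1)) * Z := by gcongr
      _ = Real.exp 4 * E * X ^ (1 - 2 * σ) * (t ^ (2 * σ - 1) * Real.exp (-(Real.pi * t)) * Z) := by ring
      _ ≤ Real.exp 4 * E * X ^ (1 - 2 * σ) * (10 ^ 8 * Real.exp 10 * ‖zetaSqKernel (σ + t * Complex.I)‖ ^ 2) := by gcongr
      _ = _ := by rw [e3]; ring
  have hci : IntegrableOn (fun t : ℝ => ‖riemannZeta (σ + t * Complex.I)‖ ^ 4) (Ioc X (2 * X)) :=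
    (((continuous_riemannZeta_vertical (by linarith)).norm.pow 4).integrableOn_Icc).mono_set Ioc_subset_Icc_self
  have hi' := hi.const_mul (10 ^ 8 * Real.exp 14 * X ^ (1 - 2 * σ))
  calc _ ≤ ∫ t in Ioc X (2 * X), (10 ^ 8 * Real.exp 14 * X ^ (1 - 2 * σ)) *
        (Real.exp ((Real.pi / 2 - 1 / X) * t) * ‖zetaSqKernel (σ + t * Complex.I)‖) ^ 2 :=
        setIntegral_mono_on hci hi'.integrableOn measurableSet_Ioc hbd
    _ ≤ ∫ t, (10 ^ 8 * Real.exp 14 * X ^ (1 - 2 * σ)) *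
        (Real.exp ((Real.pi / 2 - 1 / X) * t) * ‖zetaSqKernel (σ + t * Complex.I)‖) ^ 2 :=
        setIntegral_le_integral hi' (ae_of_all _ fun t => by simp only [Pi.zero_apply]; positivity)
    _ ≤ (10 ^ 8 * Real.exp 14 * X ^ (1 - 2 * σ)) * (C * (4 * X ^ (2 * σ)) * (2 * Real.log X) ^ 4) := by
        rw [integral_const_mul]
        refine mul_le_mul_of_nonneg_left (hle.trans ?_) (by positivity)
        gcongr
    _ = 10 ^ 8 * Real.exp 14 * (C * 64) * (X ^ (1 - 2 * σ) * X ^ (2 * σ) * Real.log X ^ 4) := by ring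
    _ = _ := by
        rw [← Real.rpow_add hX0]
        simp

noncomputable def zetaIncrement (n : ℕ) (s : ℂ) : ℂ :=
  (s - 1) * (n : ℂ) ^ (-s) + ((n + 1 : ℕ) : ℂ) ^ (1 - s) - (n : ℂ) ^ (1 - s)

theorem norm_zetaIncrement_le {n : ℕ} (hn : 1 ≤ n) {s : ℂ} (hs : 0 ≤ s.re) :
    ‖zetaIncrement n s‖ ≤ ‖s - 1‖ * ‖s‖ * (n : ℝ) ^ (-s.re - 1) := by
  have hn0 : (0:ℝ) < n := by exact_mod_cast hn
  rcases eq_or_ne s 0 with rfl | h0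
  · simp [zetaIncrement]
  rcases eq_or_ne s 1 with rfl | h1
  · simp [zetaIncrement]
  have hd : ∀ (r : ℂ), r ≠ 0 → ∀ x ∈ Icc (n:ℝ) (n + 1), HasDerivWithinAt (fun x : ℝ => (x : ℂ) ^ r) (r * (x : ℂ) ^ (r - 1)) (Icc (n:ℝ) (n + 1)) x := by
    intro r hr x hx
    have hx0 : x ≠ 0 := (lt_of_lt_of_le hn0 hx.1).ne'
    exact (hasDerivAt_ofReal_cpow_const hx0 hr).hasDerivWithinAt
  have hb : ∀ x ∈ Icc (n:ℝ) (n + 1), ‖(n : ℂ) ^ (-s) - (x : ℂ) ^ (-s)‖ ≤ ‖s‖ * (n : ℝ) ^ (-s.re - 1) := by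
    intro x hx
    have := (convex_Icc (n:ℝ) (n + 1)).norm_image_sub_le_of_norm_hasDerivWithin_le
      (C := ‖s‖ * (n : ℝ) ^ (-s.re - 1)) (hd (-s) (neg_ne_zero.2 h0)) (fun y hy => ?_) (left_mem_Icc.2 (by linarith)) hx
    · rw [norm_sub_rev]
      refine this.trans ?_
      have : ‖x - n‖ ≤ 1 := by rw [Real.norm_eq_abs, abs_le]; constructor <;> linarith [hx.1, hx.2]
      refine mul_le_of_le_one_right (by positivity) this
    · have hy0 : 0 < y := lt_of_lt_of_le hn0 hy.1
      rw [norm_mul, norm_neg, Complex.norm_cpow_eq_rpow_re_of_pos hy0]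
      simp only [Complex.sub_re, Complex.neg_re, Complex.one_re]
      gcongr ?_ * ?_
      exact Real.rpow_le_rpow_of_nonpos hn0 hy.1 (by linarith)
  have h := (convex_Icc (n:ℝ) (n + 1)).norm_image_sub_le_of_norm_hasDerivWithin_le
      (f := fun x : ℝ => (s - 1) * (n : ℂ) ^ (-s) * x + (x : ℂ) ^ (1 - s))
      (f' := fun x : ℝ => (s - 1) * ((n : ℂ) ^ (-s) - (x : ℂ) ^ (-s)))
      (C := ‖s - 1‖ * (‖s‖ * (n : ℝ) ^ (-s.re - 1))) (fun x hx => ?_) (fun y hy => ?_)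
      (left_mem_Icc.2 (show (n:ℝ) ≤ n + 1 by linarith)) (right_mem_Icc.2 (show (n:ℝ) ≤ n + 1 by linarith))
  · rw [mul_assoc]
    simp only [add_sub_cancel_left, norm_one, mul_one] at h
    refine le_of_eq_of_le ?_ h
    rw [zetaIncrement]
    push_cast
    congr 1
    ring
  · have h1' := ((hasDerivAt_id x).ofReal_comp.const_mul ((s - 1) * (n : ℂ) ^ (-s))).hasDerivWithinAt (s := Icc (n:ℝ) (n + 1))
    have h2' := h1'.add (hd (1 - s) (sub_ne_zero.2 h1.symm) x hx)
    refine h2'.congr_deriv ?_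
    rw [show (1 - s - 1) = -s by ring]
    push_cast
    ring
  · rw [norm_mul]
    gcongr
    exact hb y hy

theorem sum_range_zetaIncrement (s : ℂ) (N : ℕ) :
    ∑ k ∈ Finset.range N, zetaIncrement (k + 1) s =
      (s - 1) * ∑ k ∈ Finset.range N, ((k + 1 : ℕ) : ℂ) ^ (-s) + ((N + 1 : ℕ) : ℂ) ^ (1 - s) - 1 := by
  induction N with
  | zero => simp
  | succ N ih => rw [Finset.sum_range_succ, ih, Finset.sum_range_succ, zetaIncrement]; ring

theorem sum_range_rpow_neg_le {N : ℕ} (hN : 1 ≤ N) (K : ℕ) :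
    ∑ k ∈ Finset.range K, ((N + k : ℕ) : ℝ) ^ (-(3:ℝ) / 2) ≤
      4 * (N : ℝ) ^ (-(1:ℝ) / 2) - 4 * ((N + K : ℕ) : ℝ) ^ (-(1:ℝ) / 2) := by
  induction K with
  | zero => simp
  | succ K ih =>
    rw [Finset.sum_range_succ]
    have key : ∀ x : ℝ, 1 ≤ x → x ^ (-(3:ℝ) / 2) ≤ 4 * x ^ (-(1:ℝ) / 2) - 4 * (x + 1) ^ (-(1:ℝ) / 2) := by
      intro x hx
      have hx0 : 0 < x := by linarith
      have e1 : ∀ y : ℝ, 0 < y → y ^ (-(1:ℝ) / 2) = (√y)⁻¹ := by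
        intro y hy
        rw [Real.sqrt_eq_rpow, ← Real.rpow_neg hy.le]; norm_num
      have e2 : x ^ (-(3:ℝ) / 2) = x⁻¹ * (√x)⁻¹ := by
        rw [← e1 x hx0, ← Real.rpow_neg_one, ← Real.rpow_add hx0]; norm_num
      rw [e2, e1 x hx0, e1 _ (by linarith)]
      obtain ⟨u, hu⟩ : ∃ u, u = √x := ⟨_, rfl⟩
      obtain ⟨v, hv⟩ : ∃ v, v = √(x + 1) := ⟨_, rfl⟩
      have hu2 : u ^ 2 = x := by rw [hu, Real.sq_sqrt hx0.le]
      have hv2 : v ^ 2 = x + 1 := by rw [hv, Real.sq_sqrt (by linarith)]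
      have hu0 : 0 < u := hu ▸ Real.sqrt_pos.2 hx0
      have hv0 : 0 < v := hv ▸ Real.sqrt_pos.2 (by linarith)
      rw [← hu, ← hv, ← hu2]
      have hvu : v ≤ 3 / 2 * u := by
        refine le_of_sq_le_sq ?_ (by positivity)
        nlinarith
      have h4 : 4 * u⁻¹ - 4 * v⁻¹ = 4 / (u * v * (u + v)) := by
        have : (v - u) * (u + v) = 1 := by nlinarith
        field_simp
        linarith
      rw [h4, ← mul_inv, ← one_div, div_le_div_iff₀ (by positivity) (by positivity)]
      have : u * v * (u + v) ≤ u * (3 / 2 * u) * (u + 3 / 2 * u) := by gcongr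
      nlinarith [pow_pos hu0 3]
    have := key ((N + K : ℕ) : ℝ) (by exact_mod_cast (by omega))
    rw [← add_assoc]
    push_cast at *
    linarith

theorem summable_zetaIncrement {s : ℂ} (hs : 1 / 2 ≤ s.re) {N : ℕ} (hN : 1 ≤ N) :
    Summable (fun k => zetaIncrement (N + k) s) ∧
      ‖∑' k, zetaIncrement (N + k) s‖ ≤ ‖s - 1‖ * ‖s‖ * (4 * (N : ℝ) ^ (-s.re)) := by
  have hN0 : (0:ℝ) < N := by exact_mod_cast hN
  have hb : ∀ k : ℕ, ‖zetaIncrement (N + k) s‖ ≤ ‖s - 1‖ * ‖s‖ * (N : ℝ) ^ (1 / 2 - s.re) * ((N + k : ℕ) : ℝ) ^ (-(3:ℝ) / 2) := by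
    intro k
    have hk0 : (0:ℝ) < ((N + k : ℕ) : ℝ) := by exact_mod_cast (by omega)
    have hk : (N:ℝ) ≤ ((N + k : ℕ) : ℝ) := by exact_mod_cast (by omega)
    refine (norm_zetaIncrement_le (by omega) (by linarith)).trans ?_
    rw [mul_assoc (‖s - 1‖ * ‖s‖), show -s.re - 1 = (1 / 2 - s.re) + (-3 / 2) by ring, Real.rpow_add hk0]
    refine mul_le_mul_of_nonneg_left (mul_le_mul_of_nonneg_right ?_ (by positivity)) (by positivity)
    exact Real.rpow_le_rpow_of_nonpos hN0 hk (by linarith)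
  have hp : ∀ K, ∑ k ∈ Finset.range K, ‖s - 1‖ * ‖s‖ * (N : ℝ) ^ (1 / 2 - s.re) * ((N + k : ℕ) : ℝ) ^ (-(3:ℝ) / 2) ≤
      ‖s - 1‖ * ‖s‖ * (4 * (N : ℝ) ^ (-s.re)) := by
    intro K
    rw [← Finset.mul_sum]
    have := sum_range_rpow_neg_le hN K
    have h2 : 0 ≤ ((N + K : ℕ) : ℝ) ^ (-(1:ℝ) / 2) := by positivity
    have h3 : ∑ k ∈ Finset.range K, ((N + k : ℕ) : ℝ) ^ (-(3:ℝ) / 2) ≤ 4 * (N : ℝ) ^ (-(1:ℝ) / 2) := by linarith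
    rw [mul_assoc]
    refine mul_le_mul_of_nonneg_left ?_ (by positivity)
    calc _ ≤ (N : ℝ) ^ (1 / 2 - s.re) * (4 * (N : ℝ) ^ (-(1:ℝ) / 2)) := by gcongr
      _ = 4 * ((N : ℝ) ^ (1 / 2 - s.re) * (N : ℝ) ^ (-(1:ℝ) / 2)) := by ring
      _ = _ := by rw [← Real.rpow_add hN0]; congr 2; ring
  have hsum := summable_of_sum_range_le (f := fun k => ‖s - 1‖ * ‖s‖ * (N : ℝ) ^ (1 / 2 - s.re) * ((N + k : ℕ) : ℝ) ^ (-(3:ℝ) / 2))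
    (fun k => by positivity) hp
  refine ⟨Summable.of_norm_bounded hsum hb, ?_⟩
  refine (tsum_of_norm_bounded hsum.hasSum hb).trans ?_
  exact Real.tsum_le_of_sum_range_le (fun k => by positivity) hp

theorem riemannZeta₁_eq_of_one_lt_re {s : ℂ} (hs : 1 < s.re) :
    riemannZeta₁ s = 1 + ∑' k, zetaIncrement (1 + k) s := by
  have hs1 : s ≠ 1 := by rintro rfl; simp at hs
  have h1 := (summable_zetaIncrement (s := s) (by linarith) le_rfl).1.hasSum.tendsto_sum_nat
  have h2 : Tendsto (fun N => ∑ k ∈ Finset.range N, zetaIncrement (1 + k) s) atTop (𝓝 ((s - 1) * riemannZeta s + 0 - 1)) := by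
    have e : (fun N => ∑ k ∈ Finset.range N, zetaIncrement (1 + k) s) = fun N => (s - 1) * ∑ k ∈ Finset.range N, ((k + 1 : ℕ) : ℂ) ^ (-s) + ((N + 1 : ℕ) : ℂ) ^ (1 - s) - 1 := by
      funext N
      rw [← sum_range_zetaIncrement]
      exact Finset.sum_congr rfl fun k _ => by rw [add_comm]
    rw [e]
    refine ((Tendsto.const_mul _ ?_).add ?_).sub_const 1
    · have hz := zeta_eq_tsum_one_div_nat_add_one_cpow hs
      have hsum : Summable fun n : ℕ => 1 / ((n:ℂ) + 1) ^ s := by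
        have := (summable_nat_add_iff 1).2 (Complex.summable_one_div_nat_cpow.2 hs)
        simpa using this
      rw [hz]
      refine hsum.hasSum.tendsto_sum_nat.congr fun N => Finset.sum_congr rfl fun k _ => ?_
      rw [Complex.cpow_neg, one_div]; push_cast; rfl
    · rw [tendsto_zero_iff_norm_tendsto_zero]
      have : (fun N : ℕ => ‖((N + 1 : ℕ) : ℂ) ^ (1 - s)‖) = fun N : ℕ => (((N + 1 : ℕ) : ℝ)) ^ (-(s.re - 1)) := by
        funext N
        rw [Complex.norm_natCast_cpow_of_pos (by omega)]; simp
      rw [this]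
      exact ((tendsto_rpow_neg_atTop (by linarith)).comp tendsto_natCast_atTop_atTop).comp (tendsto_add_atTop_nat 1)
  have h3 := tendsto_nhds_unique h1 h2
  rw [h3, riemannZeta_eq_inv_sub_mul hs1]
  have := sub_ne_zero.2 hs1
  field_simp
  ring

theorem riemannZeta₁_eq {s : ℂ} (hs : 1 / 2 < s.re) :
    riemannZeta₁ s = 1 + ∑' k, zetaIncrement (1 + k) s := by
  have hU : IsOpen {s : ℂ | 1 / 2 < s.re} := isOpen_lt continuous_const Complex.continuous_re
  have hd : DifferentiableOn ℂ (fun s => 1 + ∑' k, zetaIncrement (1 + k) s) {s : ℂ | 1 / 2 < s.re} := by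
    intro z hz
    have hV : IsOpen ({s : ℂ | 1 / 2 < s.re} ∩ Metric.ball 0 (‖z‖ + 1)) := hU.inter Metric.isOpen_ball
    have hsm : Summable fun k : ℕ => (‖z‖ + 2) * (‖z‖ + 1) * ((k + 1 : ℕ) : ℝ) ^ (-(3:ℝ) / 2) := by
      refine Summable.mul_left _ ?_
      exact (summable_nat_add_iff 1).2 (Real.summable_nat_rpow.2 (by norm_num))
    have := Complex.differentiableOn_tsum_of_summable_norm (F := fun k s => zetaIncrement (1 + k) s) hsm
      (fun k => ?_) hV (fun k w hw => ?_)
    · refine DifferentiableAt.differentiableWithinAt ?_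
      refine ((this z ⟨hz, by simp⟩).differentiableAt (hV.mem_nhds ⟨hz, by simp⟩)).const_add 1
    · have hk : ((1 + k : ℕ) : ℂ) ≠ 0 := Nat.cast_ne_zero.2 (by omega)
      have hk' : ((1 + k + 1 : ℕ) : ℂ) ≠ 0 := Nat.cast_ne_zero.2 (by omega)
      unfold zetaIncrement
      refine Differentiable.differentiableOn ?_
      refine ((Differentiable.mul (by fun_prop) ?_).add ?_).sub ?_
      · exact Differentiable.const_cpow (by fun_prop) (Or.inl hk)
      · exact Differentiable.const_cpow (by fun_prop) (Or.inl hk')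
      · exact Differentiable.const_cpow (by fun_prop) (Or.inl hk)
    · obtain ⟨hw1, hw2⟩ := hw
      rw [mem_ball_zero_iff] at hw2
      simp only [mem_ofPred_eq] at hw1
      refine (norm_zetaIncrement_le (by omega) (by linarith)).trans ?_
      have : ‖w - 1‖ ≤ ‖z‖ + 2 := (norm_sub_le _ _).trans (by rw [norm_one]; linarith)
      rw [show 1 + k = k + 1 from add_comm 1 k]
      gcongr
      · exact_mod_cast (show 1 ≤ k + 1 by omega)
      · linarith
  have hc : IsPreconnected {s : ℂ | 1 / 2 < s.re} := (convex_halfSpace_re_gt _).isPreconnected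
  refine AnalyticOnNhd.eqOn_of_preconnected_of_eventuallyEq
    (differentiable_riemannZeta₁.differentiableOn.analyticOnNhd hU) (hd.analyticOnNhd hU) hc (z₀ := 2)
    (by simp; norm_num) ?_ hs
  filter_upwards [(isOpen_lt continuous_const Complex.continuous_re).mem_nhds (show (1:ℝ) < (2:ℂ).re by simp)] with w hw
  exact riemannZeta₁_eq_of_one_lt_re hw

theorem norm_riemannZeta₁_sub_le {s : ℂ} (hs : 1 / 2 ≤ s.re) (N : ℕ) :
    ‖riemannZeta₁ s - ((s - 1) * ∑ k ∈ Finset.range N, ((k + 1 : ℕ) : ℂ) ^ (-s) + ((N + 1 : ℕ) : ℂ) ^ (1 - s))‖ ≤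
      ‖s - 1‖ * ‖s‖ * (4 * ((N + 1 : ℕ) : ℝ) ^ (-s.re)) := by
  have main : ∀ s : ℂ, 1 / 2 < s.re → ‖riemannZeta₁ s - ((s - 1) * ∑ k ∈ Finset.range N, ((k + 1 : ℕ) : ℂ) ^ (-s) + ((N + 1 : ℕ) : ℂ) ^ (1 - s))‖ ≤
      ‖s - 1‖ * ‖s‖ * (4 * ((N + 1 : ℕ) : ℝ) ^ (-s.re)) := by
    intro s hs
    have h1 := (summable_zetaIncrement hs.le le_rfl).1
    have h2 := (summable_zetaIncrement hs.le (show 1 ≤ N + 1 by omega)).2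
    have e := h1.sum_add_tsum_nat_add N
    have e2 := sum_range_zetaIncrement s N
    refine le_of_eq_of_le ?_ h2
    rw [riemannZeta₁_eq hs, ← e]
    have e3 : ∑ k ∈ Finset.range N, zetaIncrement (1 + k) s = ∑ k ∈ Finset.range N, zetaIncrement (k + 1) s :=
      Finset.sum_congr rfl fun k _ => by rw [add_comm]
    have e4 : ∑' k, zetaIncrement (1 + (k + N)) s = ∑' k, zetaIncrement (N + 1 + k) s :=
      tsum_congr fun k => by congr 1; omega
    rw [e3, e2, e4]
    congr 1; ring
  have hc : Tendsto (fun x : ℝ => s + x) (𝓝[>] 0) (𝓝 s) := by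
    have : Tendsto (fun x : ℝ => s + x) (𝓝 0) (𝓝 (s + (0:ℝ))) := by
      exact (Continuous.tendsto (by fun_prop) 0)
    simp at this
    exact this.mono_left nhdsWithin_le_nhds
  have c1 : Continuous fun s : ℂ => ‖riemannZeta₁ s - ((s - 1) * ∑ k ∈ Finset.range N, ((k + 1 : ℕ) : ℂ) ^ (-s) + ((N + 1 : ℕ) : ℂ) ^ (1 - s))‖ := by
    have : Differentiable ℂ fun s : ℂ => riemannZeta₁ s - ((s - 1) * ∑ k ∈ Finset.range N, ((k + 1 : ℕ) : ℂ) ^ (-s) + ((N + 1 : ℕ) : ℂ) ^ (1 - s)) := by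
      refine differentiable_riemannZeta₁.sub (((by fun_prop : Differentiable ℂ fun s : ℂ => s - 1).mul ?_).add ?_)
      · refine Differentiable.fun_sum fun k _ => Differentiable.const_cpow (by fun_prop) (Or.inl ?_)
        exact Nat.cast_ne_zero.2 (Nat.succ_ne_zero _)
      · refine Differentiable.const_cpow (by fun_prop) (Or.inl ?_)
        exact Nat.cast_ne_zero.2 (Nat.succ_ne_zero _)
    exact this.continuous.norm
  have c2 : Continuous fun s : ℂ => ‖s - 1‖ * ‖s‖ * (4 * ((N + 1 : ℕ) : ℝ) ^ (-s.re)) := by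
    have : Continuous fun s : ℂ => ((N + 1 : ℕ) : ℝ) ^ (-s.re) :=
      Continuous.rpow continuous_const (by fun_prop) (fun s => Or.inl (Nat.cast_ne_zero.2 (Nat.succ_ne_zero _)))
    fun_prop
  refine le_of_tendsto_of_tendsto ((c1.tendsto s).comp hc) ((c2.tendsto s).comp hc) ?_
  filter_upwards [self_mem_nhdsWithin] with x hx
  exact main (s + x) (by simp; linarith [show 0 < x from hx])

theorem norm_riemannZeta_sub_le {s : ℂ} (hs : 1 / 2 ≤ s.re) (h1 : s ≠ 1) (N : ℕ) :
    ‖riemannZeta s - (∑ k ∈ Finset.range N, ((k + 1 : ℕ) : ℂ) ^ (-s) + ((N + 1 : ℕ) : ℂ) ^ (1 - s) / (s - 1))‖ ≤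
      4 * ‖s‖ * ((N + 1 : ℕ) : ℝ) ^ (-s.re) := by
  have h := norm_riemannZeta₁_sub_le hs N
  have h0 := sub_ne_zero.2 h1
  have hp : 0 < ‖s - 1‖ := norm_pos_iff.2 h0
  rw [riemannZeta_eq_inv_sub_mul h1]
  have e : (s - 1)⁻¹ * riemannZeta₁ s - (∑ k ∈ Finset.range N, ((k + 1 : ℕ) : ℂ) ^ (-s) + ((N + 1 : ℕ) : ℂ) ^ (1 - s) / (s - 1)) =
    (s - 1)⁻¹ * (riemannZeta₁ s - ((s - 1) * ∑ k ∈ Finset.range N, ((k + 1 : ℕ) : ℂ) ^ (-s) + ((N + 1 : ℕ) : ℂ) ^ (1 - s))) := by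
    field_simp
  rw [e, norm_mul, norm_inv]
  calc _ ≤ ‖s - 1‖⁻¹ * (‖s - 1‖ * ‖s‖ * (4 * ((N + 1 : ℕ) : ℝ) ^ (-s.re))) := by gcongr
    _ = _ := by field_simp

theorem inv_one_sub_cexp {x : ℝ} (hx : 0 < x) (hx1 : x < 1) :
    (1 - Complex.exp (2 * Real.pi * x * Complex.I))⁻¹ =
      (1 + (Real.cot (Real.pi * x) : ℝ) * Complex.I) / 2 := by
  have hs : 0 < Real.sin (Real.pi * x) := Real.sin_pos_of_pos_of_lt_pi (by positivity) (by nlinarith [Real.pi_pos])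
  have hs' : Complex.sin (Real.pi * x : ℝ) ≠ 0 := by rw [← Complex.ofReal_sin]; exact_mod_cast hs.ne'
  apply inv_eq_of_mul_eq_one_right
  have h2 : Complex.exp (2 * Real.pi * x * Complex.I) = (Complex.cos (Real.pi * x : ℝ) + Complex.sin (Real.pi * x : ℝ) * Complex.I) ^ 2 := by
    rw [← Complex.exp_mul_I, ← Complex.exp_nat_mul]; congr 1; push_cast; ring
  rw [h2, Real.cot_eq_cos_div_sin]
  push_cast at *
  obtain ⟨c, hc⟩ : ∃ c, c = Complex.cos (Real.pi * x) := ⟨_, rfl⟩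
  obtain ⟨s, hsd⟩ : ∃ s, s = Complex.sin (Real.pi * x) := ⟨_, rfl⟩
  have hp : s ^ 2 + c ^ 2 = 1 := by rw [hsd, hc]; exact Complex.sin_sq_add_cos_sq _
  rw [← hc, ← hsd]
  rw [← hsd] at hs'
  field_simp
  linear_combination (-c * Complex.I + s) * hp + (-2 * s * c ^ 2 - s ^ 3 - s ^ 2 * c * Complex.I) * Complex.I_sq

theorem norm_inv_one_sub_cexp_le {x δ : ℝ} (hδ : 0 < δ) (hx : δ ≤ x) (hx1 : x ≤ 1 - δ) :
    ‖(1 - Complex.exp (2 * Real.pi * x * Complex.I))⁻¹‖ ≤ 1 / (4 * δ) ∧ |Real.cot (Real.pi * x)| ≤ 1 / (2 * δ) := by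
  have hpi := Real.pi_pos
  have hs : 2 * δ ≤ Real.sin (Real.pi * x) := by
    rcases le_total x (1 / 2) with h | h
    · have := Real.mul_le_sin (x := Real.pi * x) (by nlinarith) (by nlinarith)
      have e : 2 / Real.pi * (Real.pi * x) = 2 * x := by field_simp
      linarith
    · have := Real.mul_le_sin (x := Real.pi * (1 - x)) (by nlinarith) (by nlinarith)
      have e : 2 / Real.pi * (Real.pi * (1 - x)) = 2 * (1 - x) := by field_simp
      rw [show Real.pi * (1 - x) = Real.pi - Real.pi * x by ring, Real.sin_pi_sub] at this
      rw [show Real.pi * (1 - x) = Real.pi - Real.pi * x by ring] at e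
      linarith
  have hs0 : 0 < Real.sin (Real.pi * x) := by linarith
  constructor
  · have e : ‖1 - Complex.exp (2 * Real.pi * x * Complex.I)‖ = 2 * Real.sin (Real.pi * x) := by
      have h3 : 1 - Complex.exp (2 * Real.pi * x * Complex.I) =
          -(2 * Complex.I) * (Real.sin (Real.pi * x) : ℝ) * Complex.exp ((Real.pi * x : ℝ) * Complex.I) := by
        have h4 : Complex.exp (2 * Real.pi * x * Complex.I) = Complex.exp ((Real.pi * x : ℝ) * Complex.I) ^ 2 := by
          rw [← Complex.exp_nat_mul]; congr 1; push_cast; ring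
        rw [h4, Complex.ofReal_sin, Complex.exp_mul_I]
        have := Complex.sin_sq_add_cos_sq (Real.pi * x : ℝ)
        linear_combination (-1) * this + (2 * Complex.sin (Real.pi * x : ℝ) ^ 2 - Complex.sin (Real.pi * x : ℝ) ^ 2) * Complex.I_sq
      rw [h3, norm_mul, norm_mul, Complex.norm_exp_ofReal_mul_I, norm_neg, norm_mul, Complex.norm_I, Complex.norm_real,
        Real.norm_of_nonneg hs0.le]
      simp
    rw [norm_inv, e, ← one_div]
    apply one_div_le_one_div_of_le <;> linarith
  · rw [Real.cot_eq_cos_div_sin, abs_div, abs_of_pos hs0]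
    apply div_le_div₀ zero_le_one (Real.abs_cos_le_one _) (by positivity) hs

theorem cot_le_cot {x y : ℝ} (hx : 0 < x) (hxy : x ≤ y) (hy : y < 1) :
    Real.cot (Real.pi * y) ≤ Real.cot (Real.pi * x) := by
  have hpi := Real.pi_pos
  have h1 : 0 < Real.sin (Real.pi * x) := Real.sin_pos_of_pos_of_lt_pi (by positivity) (by nlinarith)
  have h2 : 0 < Real.sin (Real.pi * y) := Real.sin_pos_of_pos_of_lt_pi (by nlinarith) (by nlinarith)
  have h3 : 0 ≤ Real.sin (Real.pi * y - Real.pi * x) := Real.sin_nonneg_of_nonneg_of_le_pi (by nlinarith) (by nlinarith)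
  rw [Real.sin_sub] at h3
  rw [Real.cot_eq_cos_div_sin, Real.cot_eq_cos_div_sin, div_le_div_iff₀ h2 h1]
  linarith

theorem sum_eq_of_mul_sub {u c : ℕ → ℂ} {M : ℕ} (h : ∀ n ≤ M, u n = c n * (u n - u (n + 1))) :
    ∑ n ∈ Finset.range (M + 1), u n = c 0 * u 0 - c M * u (M + 1) +
      ∑ n ∈ Finset.range M, (c (n + 1) - c n) * u (n + 1) := by
  induction M with
  | zero => simp; linear_combination h 0 le_rfl
  | succ M ih =>
    rw [Finset.sum_range_succ, ih fun n hn => h n (by omega), Finset.sum_range_succ]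
    linear_combination h (M + 1) le_rfl

/-- The Kusmin–Landau inequality. -/
theorem norm_sum_le_of_monotone_phase {u : ℕ → ℂ} {θ : ℕ → ℝ} {M : ℕ} {δ : ℝ} (hδ : 0 < δ)
    (hu : ∀ n, ‖u n‖ = 1)
    (h : ∀ n < M, u (n + 1) = u n * Complex.exp (2 * Real.pi * θ n * Complex.I))
    (h1 : ∀ n < M, δ ≤ θ n) (h2 : ∀ n < M, θ n ≤ 1 - δ) (hm : ∀ n, n + 1 < M → θ n ≤ θ (n + 1)) :
    ‖∑ n ∈ Finset.range M, u n‖ ≤ 1 / δ := by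
  rcases M with _ | M
  · simp; positivity
  obtain ⟨c, hc⟩ : ∃ c : ℕ → ℂ, c = fun n => (1 - Complex.exp (2 * Real.pi * θ n * Complex.I))⁻¹ := ⟨_, rfl⟩
  have hlt : ∀ n < M + 1, 0 < θ n ∧ θ n < 1 := fun n hn => ⟨by linarith [h1 n hn], by linarith [h2 n hn]⟩
  have hce : ∀ n < M + 1, c n = (1 + (Real.cot (Real.pi * θ n) : ℝ) * Complex.I) / 2 := fun n hn => by
    rw [hc]; exact inv_one_sub_cexp (hlt n hn).1 (hlt n hn).2
  have hcu : ∀ n ≤ M, u n = c n * (u n - u (n + 1)) := by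
    intro n hn
    have hne : (1 - Complex.exp (2 * Real.pi * θ n * Complex.I)) ≠ 0 := by
      intro h0
      have e := hce n (by omega)
      have hc0 : c n = 0 := by rw [hc]; simp only; rw [h0, inv_zero]
      rw [hc0] at e
      generalize Real.cot (Real.pi * θ n) = r at e
      have := congrArg Complex.re e
      simp at this
    rw [h n (by omega), hc]
    field_simp
  rw [sum_eq_of_mul_sub hcu]
  have hb := fun n (hn : n < M + 1) => norm_inv_one_sub_cexp_le hδ (h1 n hn) (h2 n hn)
  have hs : ‖∑ n ∈ Finset.range M, (c (n + 1) - c n) * u (n + 1)‖ ≤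
      (Real.cot (Real.pi * θ 0) - Real.cot (Real.pi * θ M)) / 2 := by
    refine (norm_sum_le _ _).trans ?_
    have : ∀ n ∈ Finset.range M, ‖(c (n + 1) - c n) * u (n + 1)‖ =
        Real.cot (Real.pi * θ n) / 2 - Real.cot (Real.pi * θ (n + 1)) / 2 := by
      intro n hn
      rw [Finset.mem_range] at hn
      rw [norm_mul, hu, mul_one, hce n (by omega), hce (n + 1) (by omega)]
      have hm' := cot_le_cot (hlt n (by omega)).1 (hm n (by omega)) (hlt (n + 1) (by omega)).2
      have e : (1 + (Real.cot (Real.pi * θ (n + 1)) : ℝ) * Complex.I) / 2 - (1 + (Real.cot (Real.pi * θ n) : ℝ) * Complex.I) / 2 =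
        (((Real.cot (Real.pi * θ (n + 1)) - Real.cot (Real.pi * θ n)) / 2 : ℝ) : ℂ) * Complex.I := by push_cast; ring
      rw [e, norm_mul, Complex.norm_I, mul_one, Complex.norm_real, Real.norm_of_nonpos (by linarith)]
      ring
    rw [Finset.sum_congr rfl this, Finset.sum_range_sub' (fun n => Real.cot (Real.pi * θ n) / 2)]
    apply le_of_eq; ring
  have c0 := (hb 0 (by omega)).1
  have cM := (hb M (by omega)).1
  have k0 := (abs_le.1 (hb 0 (by omega)).2).2
  have kM := (abs_le.1 (hb M (by omega)).2).1
  calc _ ≤ ‖c 0 * u 0‖ + ‖c M * u (M + 1)‖ + ‖∑ n ∈ Finset.range M, (c (n + 1) - c n) * u (n + 1)‖ :=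
        (norm_add_le _ _).trans (by gcongr; exact norm_sub_le _ _)
    _ ≤ 1 / (4 * δ) + 1 / (4 * δ) + (1 / (2 * δ) + 1 / (2 * δ)) / 2 := by
        rw [norm_mul, norm_mul, hu, hu, mul_one, mul_one]
        refine add_le_add (add_le_add ?_ ?_) (hs.trans ?_)
        · rw [hc]; exact c0
        · rw [hc]; exact cM
        · linarith
    _ = _ := by field_simp; norm_num

/-- Threshold count for a monotone sequence on an initial segment. -/
theorem exists_lt_iff_lt {θ : ℕ → ℝ} {M : ℕ} (hm : ∀ n, n + 1 < M → θ n ≤ θ (n + 1)) (y : ℝ) :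
    ∃ q ≤ M, ∀ n < M, θ n < y ↔ n < q := by
  have hmono : ∀ n m, n ≤ m → m < M → θ n ≤ θ m := by
    intro n m hnm
    induction m, hnm using Nat.le_induction with
    | base => intro _; rfl
    | succ m _ ih => intro h; exact (ih (by omega)).trans (hm m h)
  by_cases h : ∃ n, n < M ∧ y ≤ θ n
  · classical
    refine ⟨Nat.find h, (Nat.find_spec h).1.le, fun n hn => ⟨fun h1 => ?_, fun h1 => ?_⟩⟩
    · by_contra h2
      exact absurd ((Nat.find_spec h).2.trans (hmono _ _ (not_lt.1 h2) hn)) (not_le.2 h1)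
    · by_contra h2
      exact Nat.find_min h h1 ⟨hn, not_lt.1 h2⟩
  · refine ⟨M, le_rfl, fun n hn => ⟨fun _ => hn, fun _ => ?_⟩⟩
    by_contra h2
    exact h ⟨n, hn, not_lt.1 h2⟩

/-- The discrete second derivative test. -/
theorem norm_sum_le_of_phase_increments {u : ℕ → ℂ} {θ : ℕ → ℝ} {M : ℕ} {l L : ℝ} (hl : 0 < l)
    (hl1 : l ≤ 1 / 4) (hlL : l ≤ L) (hu : ∀ n, ‖u n‖ = 1)
    (h : ∀ n < M, u (n + 1) = u n * Complex.exp (2 * Real.pi * θ n * Complex.I))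
    (h1 : ∀ n, n + 1 < M → l ≤ θ (n + 1) - θ n) (h2 : ∀ n, n + 1 < M → θ (n + 1) - θ n ≤ L) :
    ‖∑ n ∈ Finset.range M, u n‖ ≤ (L * M + 2) * (4 / √l) := by
  rcases Nat.eq_zero_or_pos M with rfl | hM
  · simp; positivity
  have hm : ∀ n, n + 1 < M → θ n ≤ θ (n + 1) := fun n hn => by linarith [h1 n hn]
  choose q hqM hq using fun y => exists_lt_iff_lt hm y
  obtain ⟨d, hd⟩ : ∃ d, d = √l := ⟨_, rfl⟩
  have hd0 : 0 < d := hd ▸ Real.sqrt_pos.2 hl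
  have hd2 : d ^ 2 = l := by rw [hd, Real.sq_sqrt hl.le]
  have hd1 : d ≤ 1 / 2 := by nlinarith
  rw [← hd]
  have hgrow : ∀ n k, n + k < M → l * k ≤ θ (n + k) - θ n ∧ θ (n + k) - θ n ≤ L * k := by
    intro n k
    induction k with
    | zero => intro _; simp
    | succ k ih =>
      intro hk
      have i := ih (by omega)
      have a := h1 (n + k) (by omega)
      have b := h2 (n + k) (by omega)
      rw [← add_assoc]
      push_cast
      constructor <;> linarith [i.1, i.2]
  have hqmono : ∀ x y, x ≤ y → q x ≤ q y := by
    intro x y hxy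
    by_contra hc
    have hlt : q y < q x := not_le.1 hc
    have := (hq x (q y) (hlt.trans_le (hqM x))).2 hlt
    exact lt_irrefl _ ((hq y (q y) (hlt.trans_le (hqM x))).1 (this.trans_le hxy))
  have hshort : ∀ x, ‖∑ n ∈ Finset.Ico (q x) (q (x + d)), u n‖ ≤ 1 / d + 1 := by
    intro x
    refine (norm_sum_le _ _).trans ?_
    simp only [hu, Finset.sum_const, Nat.card_Ico, nsmul_eq_mul, mul_one]
    rcases Nat.eq_zero_or_pos (q (x + d) - q x) with h0 | h0
    · rw [h0]; simp; positivity
    obtain ⟨k, hk⟩ : ∃ k, q (x + d) = q x + k + 1 := ⟨q (x + d) - q x - 1, by omega⟩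
    have hlt : q x + k < M := by have := hqM (x + d); omega
    have g := (hgrow (q x) k hlt).1
    have a : x ≤ θ (q x) := by
      by_contra hc
      exact lt_irrefl _ ((hq x (q x) (by omega)).1 (not_le.1 hc))
    have b : θ (q x + k) < x + d := (hq (x + d) _ hlt).2 (by omega)
    have e : q (x + d) - q x = k + 1 := by omega
    rw [e]
    push_cast
    have : (k:ℝ) ≤ 1 / d := by
      rw [le_div_iff₀ hd0]
      rw [← hd2] at g
      nlinarith
    linarith
  have hmid : ∀ v : ℤ, ‖∑ n ∈ Finset.Ico (q (v + d)) (q (v + 1 - d)), u n‖ ≤ 1 / d := by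
    intro v
    rw [Finset.sum_Ico_eq_sum_range]
    refine norm_sum_le_of_monotone_phase (θ := fun n => θ (q (v + d) + n) - v) hd0 (fun n => hu _) ?_ ?_ ?_ ?_
    · intro n hn
      have := hqM (v + 1 - d)
      rw [← add_assoc, h _ (by omega)]
      congr 1
      rw [show (2:ℂ) * Real.pi * ((θ (q (v + d) + n) - v : ℝ) : ℂ) * Complex.I =
        2 * Real.pi * (θ (q (v + d) + n) : ℂ) * Complex.I - v * (2 * Real.pi * Complex.I) by push_cast; ring,
        Complex.exp_sub, Complex.exp_int_mul_two_pi_mul_I, div_one]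
    · intro n hn
      have := hqM (v + 1 - d)
      have : v + d ≤ θ (q (v + d) + n) := by
        by_contra hc
        have := (hq (v + d) (q (v + d) + n) (by omega)).1 (not_le.1 hc)
        omega
      linarith
    · intro n hn
      have := hqM (v + 1 - d)
      have := (hq (v + 1 - d) (q (v + d) + n) (by omega)).2 (by omega)
      linarith
    · intro n hn
      have := hqM (v + 1 - d)
      have := hm (q (v + d) + n) (by omega)
      rw [← add_assoc]
      linarith
  have hblock : ∀ v : ℤ, ‖∑ n ∈ Finset.Ico (q v) (q (v + 1)), u n‖ ≤ 4 / d := by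
    intro v
    have e1 : ((v:ℝ) + 1 - d) + d = v + 1 := by ring
    have i1 := hqmono v (v + d) (by linarith)
    have i2 := hqmono (v + d) (v + 1 - d) (by linarith)
    have i3 := hqmono (v + 1 - d) (v + 1) (by linarith)
    rw [← Finset.sum_Ico_consecutive _ (i1.trans i2) i3, ← Finset.sum_Ico_consecutive _ i1 i2]
    have s1 := hshort v
    have s3 := hshort (v + 1 - d)
    rw [e1] at s3
    have : 2 ≤ 1 / d := by rw [le_div_iff₀ hd0]; linarith
    calc _ ≤ (1 / d + 1) + 1 / d + (1 / d + 1) := (norm_add₃_le).trans (by gcongr; exact hmid v)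
      _ ≤ 4 * (1 / d) := by linarith
      _ = _ := by ring
  obtain ⟨v, hv⟩ : ∃ v : ℤ, v = ⌊θ 0⌋ := ⟨_, rfl⟩
  have hK : ∀ K : ℕ, ‖∑ n ∈ Finset.Ico (q v) (q (v + K)), u n‖ ≤ K * (4 / d) := by
    intro K
    induction K with
    | zero => simp
    | succ K ih =>
      have i1 := hqmono v (v + K) (by have : (0:ℝ) ≤ K := Nat.cast_nonneg K
                                      linarith)
      have i2 := hqmono (v + K) (v + (K + 1 : ℕ)) (by push_cast; linarith)
      rw [← Finset.sum_Ico_consecutive _ i1 i2]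
      have b := hblock (v + K)
      push_cast at b ⊢
      rw [← add_assoc]
      refine (norm_add_le _ _).trans ?_
      linarith
  have hq0 : q v = 0 := by
    by_contra hc
    have := (hq v 0 hM).2 (Nat.pos_of_ne_zero hc)
    rw [hv] at this
    exact absurd (Int.floor_le (θ 0)) (not_le.2 this)
  have hL0 : 0 ≤ L := by linarith
  have hL : 0 ≤ L * (M - 1 : ℕ) := by positivity
  obtain ⟨K, hKd⟩ : ∃ K : ℕ, K = ⌊L * (M - 1 : ℕ)⌋₊ + 2 := ⟨_, rfl⟩
  have hKlt : L * (M - 1 : ℕ) + 1 < K := by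
    have := Nat.lt_floor_add_one (L * (M - 1 : ℕ))
    rw [hKd]; push_cast; linarith
  have hKle : (K : ℝ) ≤ L * (M - 1 : ℕ) + 2 := by
    have := Nat.floor_le hL
    rw [hKd]; push_cast; linarith
  have hqK : q (v + K) = M := by
    by_contra hc
    have hlt : q (v + K) < M := lt_of_le_of_ne (hqM _) hc
    have g := (hgrow 0 (M - 1) (by omega)).2
    have fl := Int.lt_floor_add_one (θ 0)
    rw [← hv] at fl
    have := (hq (v + K) (0 + (M - 1)) (by omega)).1 (by linarith)
    omega
  have := hK K
  rw [hq0, hqK, ← Finset.range_eq_Ico] at this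
  refine this.trans ?_
  have hL' : L * (M - 1 : ℕ) ≤ L * M := by
    gcongr; omega
  gcongr
  linarith

/-- The van der Corput inequality. -/
theorem norm_sq_sum_le_of_correlations {z : ℕ → ℂ} (hz : ∀ n, ‖z n‖ = 1) {M H : ℕ} (hH : 1 ≤ H)
    {R : ℝ} (hR0 : 0 ≤ R)
    (h : ∀ h, 1 ≤ h → h < H → ‖∑ n ∈ Finset.range (M - h), z n * (starRingEnd ℂ) (z (n + h))‖ ≤ R) :
    ‖∑ n ∈ Finset.range M, z n‖ ^ 2 ≤ (M + H) * (M / H + R) := by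
  obtain ⟨y, hy⟩ : ∃ y : ℕ → ℂ, y = fun j => if H ≤ j ∧ j < H + M then z (j - H) else 0 := ⟨_, rfl⟩
  have hyz : ∀ j, j < H ∨ H + M ≤ j → y j = 0 := by
    intro j hj
    rw [hy]; simp only
    rw [if_neg]; omega
  have hyH : ∀ n, n < M → y (H + n) = z n := by
    intro n hn
    rw [hy]; simp only
    rw [if_pos (by omega)]; congr 1; omega
  have hS : ∀ k ≤ H, ∑ m ∈ Finset.range (M + H), y (m + k) = ∑ n ∈ Finset.range M, z n := by
    intro k hk
    have e1 : ∑ m ∈ Finset.range (M + H), y (m + k) = ∑ j ∈ Finset.Ico k (M + H + k), y j := by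
      rw [Finset.sum_Ico_eq_sum_range]
      refine Finset.sum_congr (by congr 1; omega) fun m _ => by rw [add_comm]
    have e2 : ∑ j ∈ Finset.Ico H (H + M), y j = ∑ j ∈ Finset.Ico k (M + H + k), y j := by
      refine Finset.sum_subset (Finset.Ico_subset_Ico hk (by omega)) fun j _ hj => hyz j ?_
      rw [Finset.mem_Ico] at hj; omega
    rw [e1, ← e2, Finset.sum_Ico_eq_sum_range]
    refine Finset.sum_congr (by congr 1; omega) fun n hn => hyH n ?_
    rw [Finset.mem_range] at hn; omega
  have hcorr : ∀ k d, k + d ≤ H → ∑ m ∈ Finset.range (M + H), y (m + k) * (starRingEnd ℂ) (y (m + (k + d))) =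
      ∑ n ∈ Finset.range (M - d), z n * (starRingEnd ℂ) (z (n + d)) := by
    intro k d hk
    have e1 : ∑ m ∈ Finset.range (M + H), y (m + k) * (starRingEnd ℂ) (y (m + (k + d))) =
        ∑ j ∈ Finset.Ico k (M + H + k), y j * (starRingEnd ℂ) (y (j + d)) := by
      rw [Finset.sum_Ico_eq_sum_range]
      refine Finset.sum_congr (by congr 1; omega) fun m _ => by
        rw [add_comm m k, show m + (k + d) = k + m + d by omega]
    have e2 : ∑ j ∈ Finset.Ico H (H + (M - d)), y j * (starRingEnd ℂ) (y (j + d)) =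
        ∑ j ∈ Finset.Ico k (M + H + k), y j * (starRingEnd ℂ) (y (j + d)) := by
      refine Finset.sum_subset (Finset.Ico_subset_Ico (by omega) (by omega)) fun j _ hj => ?_
      rw [Finset.mem_Ico] at hj
      by_cases hjH : j < H
      · rw [hyz j (Or.inl hjH), zero_mul]
      · rw [hyz (j + d) (Or.inr (by omega)), map_zero, mul_zero]
    rw [e1, ← e2, Finset.sum_Ico_eq_sum_range]
    refine Finset.sum_congr (by congr 1; omega) fun n hn => ?_
    rw [Finset.mem_range] at hn
    rw [hyH n (by omega), add_assoc, hyH (n + d) (by omega)]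
  have hcn : ∀ k l, k < H → l < H → ‖∑ m ∈ Finset.range (M + H), y (m + k) * (starRingEnd ℂ) (y (m + l))‖ ≤
      if k = l then (M : ℝ) else R := by
    have hlt : ∀ k l, k < l → l < H → ‖∑ m ∈ Finset.range (M + H), y (m + k) * (starRingEnd ℂ) (y (m + l))‖ ≤ R := by
      intro k l hkl hl
      obtain ⟨d, rfl⟩ := Nat.exists_eq_add_of_lt hkl
      rw [show k + d + 1 = k + (d + 1) from rfl, hcorr k (d + 1) (by omega)]
      exact h (d + 1) (by omega) (by omega)
    intro k l hk hl
    rcases lt_trichotomy k l with hkl | hkl | hkl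
    · rw [if_neg hkl.ne]; exact hlt k l hkl hl
    · rw [if_pos hkl, ← hkl]
      have := hcorr k 0 (by omega)
      rw [Nat.add_zero] at this
      rw [this]
      refine (norm_sum_le _ _).trans ?_
      simp [hz]
    · have e : ∑ m ∈ Finset.range (M + H), y (m + k) * (starRingEnd ℂ) (y (m + l)) =
          (starRingEnd ℂ) (∑ m ∈ Finset.range (M + H), y (m + l) * (starRingEnd ℂ) (y (m + k))) := by
        rw [map_sum]
        exact Finset.sum_congr rfl fun m _ => by rw [map_mul, Complex.conj_conj, mul_comm]
      rw [if_neg hkl.ne', e, Complex.norm_conj]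
      exact hlt l k hkl hk
  have hHS : (H : ℂ) * ∑ n ∈ Finset.range M, z n = ∑ m ∈ Finset.range (M + H), ∑ k ∈ Finset.range H, y (m + k) := by
    rw [Finset.sum_comm, Finset.sum_congr rfl fun k hk => hS k (Finset.mem_range.1 hk).le]
    simp
  have hcs : ((H : ℝ) * ‖∑ n ∈ Finset.range M, z n‖) ^ 2 ≤
      (M + H) * ∑ m ∈ Finset.range (M + H), ‖∑ k ∈ Finset.range H, y (m + k)‖ ^ 2 := by
    have e : (H : ℝ) * ‖∑ n ∈ Finset.range M, z n‖ = ‖(H : ℂ) * ∑ n ∈ Finset.range M, z n‖ := by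
      rw [norm_mul, Complex.norm_natCast]
    rw [e, hHS]
    calc _ ≤ (∑ m ∈ Finset.range (M + H), ‖∑ k ∈ Finset.range H, y (m + k)‖) ^ 2 := by
          gcongr; exact norm_sum_le _ _
      _ ≤ _ := by
          have := sq_sum_le_card_mul_sum_sq (s := Finset.range (M + H)) (f := fun m => ‖∑ k ∈ Finset.range H, y (m + k)‖)
          simpa using this
  have hsq : ∑ m ∈ Finset.range (M + H), ‖∑ k ∈ Finset.range H, y (m + k)‖ ^ 2 ≤
      ∑ k ∈ Finset.range H, ∑ l ∈ Finset.range H, if k = l then (M : ℝ) else R := by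
    have e : ((∑ m ∈ Finset.range (M + H), ‖∑ k ∈ Finset.range H, y (m + k)‖ ^ 2 : ℝ) : ℂ) =
        ∑ k ∈ Finset.range H, ∑ l ∈ Finset.range H, ∑ m ∈ Finset.range (M + H), y (m + k) * (starRingEnd ℂ) (y (m + l)) := by
      push_cast
      have : ∀ m ∈ Finset.range (M + H), ((‖∑ k ∈ Finset.range H, y (m + k)‖ : ℝ) : ℂ) ^ 2 =
          ∑ k ∈ Finset.range H, ∑ l ∈ Finset.range H, y (m + k) * (starRingEnd ℂ) (y (m + l)) := by
        intro m _
        rw [← Complex.mul_conj', map_sum, Finset.sum_mul_sum]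
      rw [Finset.sum_congr rfl this, Finset.sum_comm]
      exact Finset.sum_congr rfl fun k _ => Finset.sum_comm
    have h0 : 0 ≤ ∑ m ∈ Finset.range (M + H), ‖∑ k ∈ Finset.range H, y (m + k)‖ ^ 2 := by positivity
    rw [← Real.norm_of_nonneg h0, ← Complex.norm_real, e]
    refine (norm_sum_le _ _).trans (Finset.sum_le_sum fun k hk => (norm_sum_le _ _).trans (Finset.sum_le_sum fun l hl => ?_))
    exact hcn k l (Finset.mem_range.1 hk) (Finset.mem_range.1 hl)
  have hfin : ∑ k ∈ Finset.range H, ∑ l ∈ Finset.range H, (if k = l then (M : ℝ) else R) ≤ H * (M + H * R) := by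
    calc _ ≤ ∑ k ∈ Finset.range H, ((M : ℝ) + H * R) := by
          refine Finset.sum_le_sum fun k hk => ?_
          calc _ ≤ ∑ l ∈ Finset.range H, ((if k = l then (M : ℝ) else 0) + R) := by
                refine Finset.sum_le_sum fun l _ => ?_
                split_ifs <;> linarith
            _ = _ := by
                rw [Finset.sum_add_distrib, Finset.sum_ite_eq, if_pos hk]; simp
      _ = _ := by simp; ring
  have hH0 : (0:ℝ) < H := by exact_mod_cast hH
  have hall : ((H : ℝ) * ‖∑ n ∈ Finset.range M, z n‖) ^ 2 ≤ (M + H) * (H * (M + H * R)) :=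
    hcs.trans (by gcongr; exact hsq.trans hfin)
  rw [mul_pow] at hall
  have e : ((M:ℝ) + H) * (H * (M + H * R)) = (H:ℝ) ^ 2 * ((M + H) * (M / H + R)) := by field_simp
  rw [e] at hall
  exact le_of_mul_le_mul_left hall (by positivity)

theorem log_second_difference {m : ℝ} (hm : 2 ≤ m) :
    1 / m ^ 2 ≤ 2 * Real.log m - Real.log (m + 1) - Real.log (m - 1) ∧
      2 * Real.log m - Real.log (m + 1) - Real.log (m - 1) ≤ 2 / m ^ 2 := by
  have hm0 : (0:ℝ) < m := by linarith
  have h1 : (0:ℝ) < m + 1 := by linarith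
  have h2 : (0:ℝ) < m - 1 := by linarith
  have h3 : 0 < m ^ 2 - 1 := by nlinarith
  have e : 2 * Real.log m - Real.log (m + 1) - Real.log (m - 1) = Real.log (m ^ 2 / (m ^ 2 - 1)) := by
    rw [Real.log_div (by positivity) h3.ne', show m ^ 2 - 1 = (m + 1) * (m - 1) by ring,
      Real.log_mul h1.ne' h2.ne', Real.log_pow]
    push_cast; ring
  rw [e]
  constructor
  · have := Real.one_sub_inv_le_log_of_pos (x := m ^ 2 / (m ^ 2 - 1)) (by positivity)
    have e2 : 1 - (m ^ 2 / (m ^ 2 - 1))⁻¹ = 1 / m ^ 2 := by field_simp; ring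
    rwa [e2] at this
  · have := Real.log_le_sub_one_of_pos (x := m ^ 2 / (m ^ 2 - 1)) (by positivity)
    refine this.trans ?_
    rw [div_sub_one h3.ne', div_le_div_iff₀ h3 (by positivity)]
    nlinarith

theorem log_second_difference_shift {m h : ℝ} (hm : 2 ≤ m) (hh : 1 ≤ h) (hhm : h ≤ m) :
    h / (4 * m ^ 3) ≤ (2 * Real.log m - Real.log (m + 1) - Real.log (m - 1)) -
        (2 * Real.log (m + h) - Real.log (m + h + 1) - Real.log (m + h - 1)) ∧
      (2 * Real.log m - Real.log (m + 1) - Real.log (m - 1)) -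
        (2 * Real.log (m + h) - Real.log (m + h + 1) - Real.log (m + h - 1)) ≤ 6 * h / m ^ 3 := by
  have key : ∀ m : ℝ, 2 ≤ m → 2 * Real.log m - Real.log (m + 1) - Real.log (m - 1) =
      Real.log (m ^ 2 / (m ^ 2 - 1)) := by
    intro m hm
    have hm0 : (0:ℝ) < m := by linarith
    have h1 : (0:ℝ) < m + 1 := by linarith
    have h2 : (0:ℝ) < m - 1 := by linarith
    have h3 : 0 < m ^ 2 - 1 := by nlinarith
    rw [Real.log_div (by positivity) h3.ne', show m ^ 2 - 1 = (m + 1) * (m - 1) by ring,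
      Real.log_mul h1.ne' h2.ne', Real.log_pow]
    push_cast; ring
  rw [key m hm, key (m + h) (by linarith)]
  have hm0 : (0:ℝ) < m := by linarith
  have h3 : 0 < m ^ 2 - 1 := by nlinarith
  have h4 : 0 < (m + h) ^ 2 - 1 := by nlinarith
  have h5 : 0 < m + h := by linarith
  rw [← Real.log_div (by positivity) (by positivity)]
  obtain ⟨d, hd⟩ : ∃ d, d = h * (2 * m + h) / ((m + h) ^ 2 * (m ^ 2 - 1)) := ⟨_, rfl⟩
  have e : m ^ 2 / (m ^ 2 - 1) / ((m + h) ^ 2 / ((m + h) ^ 2 - 1)) = 1 + d := by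
    rw [hd]; field_simp; ring
  rw [e]
  have hd0 : 0 < d := by rw [hd]; positivity
  have hup : d ≤ 6 * h / m ^ 3 := by
    rw [hd, div_le_div_iff₀ (by positivity) (by positivity)]
    have a1 : h * (2 * m + h) ≤ h * (3 * m) := by gcongr; linarith
    have a2 : m ^ 2 * (m ^ 2 / 2) ≤ (m + h) ^ 2 * (m ^ 2 - 1) := by
      gcongr
      · linarith
      · nlinarith
    calc h * (2 * m + h) * m ^ 3 ≤ h * (3 * m) * m ^ 3 := by gcongr
      _ = 6 * h * (m ^ 2 * (m ^ 2 / 2)) := by ring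
      _ ≤ _ := by gcongr
  have hlo : h / (2 * m ^ 3) ≤ d := by
    rw [hd, div_le_div_iff₀ (by positivity) (by positivity)]
    have a1 : h * (2 * m) ≤ h * (2 * m + h) := by gcongr; linarith
    have a2 : (m + h) ^ 2 * (m ^ 2 - 1) ≤ (2 * m) ^ 2 * m ^ 2 := by
      gcongr <;> linarith
    calc h * ((m + h) ^ 2 * (m ^ 2 - 1)) ≤ h * ((2 * m) ^ 2 * m ^ 2) := by gcongr
      _ = h * (2 * m) * (2 * m ^ 3) := by ring
      _ ≤ _ := by gcongr
  have hd1 : d ≤ 1 := by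
    rw [hd, div_le_one (by positivity)]
    have h6 : 3 ≤ m ^ 2 - 1 := by nlinarith
    have h7 : (m + h) ^ 2 * 3 ≤ (m + h) ^ 2 * (m ^ 2 - 1) := by gcongr
    nlinarith
  constructor
  · have := Real.one_sub_inv_le_log_of_pos (x := 1 + d) (by positivity)
    refine le_trans ?_ this
    have e2 : 1 - (1 + d)⁻¹ = d / (1 + d) := by field_simp; ring
    rw [e2]
    calc h / (4 * m ^ 3) = h / (2 * m ^ 3) / 2 := by ring
      _ ≤ d / 2 := by gcongr
      _ ≤ _ := by gcongr; linarith
  · have := Real.log_le_sub_one_of_pos (x := 1 + d) (by positivity)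
    linarith

theorem norm_sum_cexp_le_of_phase {φ : ℕ → ℝ} {M : ℕ} {l L : ℝ} (hl : 0 < l) (hl1 : l ≤ 1 / 4)
    (hlL : l ≤ L)
    (h1 : ∀ n, n + 1 < M → l * (2 * Real.pi) ≤ φ (n + 2) - 2 * φ (n + 1) + φ n)
    (h2 : ∀ n, n + 1 < M → φ (n + 2) - 2 * φ (n + 1) + φ n ≤ L * (2 * Real.pi)) :
    ‖∑ n ∈ Finset.range M, Complex.exp (φ n * Complex.I)‖ ≤ (L * M + 2) * (4 / √l) := by
  have hpi : (0:ℝ) < 2 * Real.pi := by positivity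
  refine norm_sum_le_of_phase_increments (θ := fun n => (φ (n + 1) - φ n) / (2 * Real.pi)) hl hl1 hlL
    (fun n => Complex.norm_exp_ofReal_mul_I _) (fun n _ => ?_) (fun n hn => ?_) (fun n hn => ?_)
  · rw [← Complex.exp_add]
    congr 1
    have : (Real.pi : ℂ) ≠ 0 := by exact_mod_cast Real.pi_ne_zero
    push_cast
    field_simp
    ring
  · rw [← sub_div, le_div_iff₀ hpi]
    have := h1 n hn
    have e : n + 1 + 1 = n + 2 := rfl
    rw [e]; linarith
  · rw [← sub_div, div_le_iff₀ hpi]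
    have := h2 n hn
    have e : n + 1 + 1 = n + 2 := rfl
    rw [e]; linarith

theorem norm_sum_cexp_log_le_of_le {t : ℝ} {N M : ℕ} (hN : 1 ≤ N) (hMN : M ≤ N) (ht : 0 < t)
    (htN : t ≤ 2 * Real.pi * (N : ℝ) ^ 2) :
    ‖∑ n ∈ Finset.range M, Complex.exp ((-(t * Real.log (N + n)) : ℝ) * Complex.I)‖ ≤
      8 * √t + 48 * N / √t := by
  have hN0 : (1:ℝ) ≤ N := by exact_mod_cast hN
  have hpi3 := Real.pi_gt_three
  have hpi4 := Real.pi_le_four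
  obtain ⟨l, hl⟩ : ∃ l, l = t / (8 * Real.pi * (N:ℝ) ^ 2) := ⟨_, rfl⟩
  have hl0 : 0 < l := by rw [hl]; positivity
  have hdiff : ∀ n, n + 1 < M →
      (-(t * Real.log (N + (n + 2 : ℕ)))) - 2 * (-(t * Real.log (N + (n + 1 : ℕ)))) + (-(t * Real.log (N + n))) =
        t * (2 * Real.log (N + n + 1 : ℝ) - Real.log (N + n + 1 + 1) - Real.log (N + n + 1 - 1)) := by
    intro n _
    push_cast
    rw [show (N + n + 1 - 1 : ℝ) = N + n by ring, show (N + (n + 2) : ℝ) = N + n + 1 + 1 by ring,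
      show (N + (n + 1) : ℝ) = N + n + 1 by ring]
    ring
  have hbd := norm_sum_cexp_le_of_phase (φ := fun n => -(t * Real.log (N + n))) (M := M) (l := l) (L := 8 * l) hl0 ?_
    (by linarith) ?_ ?_
  · refine hbd.trans ?_
    have hMr : (M:ℝ) ≤ N := by exact_mod_cast hMN
    have hst : 0 < √t := by positivity
    have hsl : 0 < √l := by positivity
    have htt : √t ^ 2 = t := Real.sq_sqrt ht.le
    have hll : √l ^ 2 = l := Real.sq_sqrt hl0.le
    have a1 : √l ≤ √t / (4 * N) := by
      rw [Real.sqrt_le_left (by positivity), div_pow, htt, hl]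
      apply div_le_div_of_nonneg_left ht.le (by positivity)
      nlinarith [sq_nonneg (N:ℝ)]
    have a2 : √t / (6 * N) ≤ √l := by
      apply Real.le_sqrt_of_sq_le
      rw [div_pow, htt, hl]
      apply div_le_div_of_nonneg_left ht.le (by positivity)
      nlinarith [sq_nonneg (N:ℝ)]
    calc (8 * l * M + 2) * (4 / √l) = 32 * M * √l + 8 / √l := by
          nth_rewrite 1 [← hll]; field_simp; ring
      _ ≤ 32 * N * (√t / (4 * N)) + 8 / (√t / (6 * N)) := by gcongr
      _ = _ := by field_simp; ring
  · rw [hl, div_le_iff₀ (by positivity)]; linarith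
  · intro n hn
    have hn' : (n : ℝ) + 1 < N := by exact_mod_cast (by omega : n + 1 < N)
    have hn0 : (0:ℝ) ≤ n := by positivity
    have := (log_second_difference (m := N + n + 1) (by linarith)).1
    rw [hdiff n hn]
    calc l * (2 * Real.pi) = t * (1 / (2 * N) ^ 2) := by rw [hl]; field_simp; norm_num
      _ ≤ t * (1 / ((N:ℝ) + n + 1) ^ 2) := by gcongr; linarith
      _ ≤ _ := by gcongr
  · intro n hn
    have hn0 : (0:ℝ) ≤ n := by positivity
    have := (log_second_difference (m := N + n + 1) (by linarith)).2
    rw [hdiff n hn]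
    calc _ ≤ t * (2 / ((N:ℝ) + n + 1) ^ 2) := by gcongr
      _ ≤ t * (2 / (N:ℝ) ^ 2) := by
          gcongr; linarith
      _ = 8 * l * (2 * Real.pi) := by rw [hl]; field_simp

theorem norm_sum_cexp_log_le_of_ge {t : ℝ} {N M : ℕ} (hN : 1 ≤ N) (hMN : M ≤ N) (ht : 0 < t)
    (htN : t ≤ N) :
    ‖∑ n ∈ Finset.range M, Complex.exp ((-(t * Real.log (N + n)) : ℝ) * Complex.I)‖ ≤ 32 * N / t := by
  have hN0 : (1:ℝ) ≤ N := by exact_mod_cast hN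
  have hpi3 := Real.pi_gt_three
  have hpi4 := Real.pi_le_four
  obtain ⟨δ, hδ⟩ : ∃ δ, δ = t / (8 * Real.pi * N) := ⟨_, rfl⟩
  have hδ0 : 0 < δ := by rw [hδ]; positivity
  have hlog : ∀ n, n < M → 1 / (2 * (N:ℝ)) ≤ Real.log (N + n + 1 : ℝ) - Real.log (N + n) ∧
      Real.log (N + n + 1 : ℝ) - Real.log (N + n) ≤ 1 / N := by
    intro n hn
    have hn' : (n : ℝ) + 1 ≤ N := by exact_mod_cast (by omega : n + 1 ≤ N)
    have hn0 : (0:ℝ) ≤ n := by positivity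
    rw [← Real.log_div (by positivity) (by positivity)]
    constructor
    · refine le_trans ?_ (Real.one_sub_inv_le_log_of_pos (by positivity))
      have e : 1 - ((N + n + 1 : ℝ) / (N + n))⁻¹ = 1 / (N + n + 1) := by field_simp; ring
      rw [e]; gcongr; linarith
    · refine (Real.log_le_sub_one_of_pos (by positivity)).trans ?_
      have e : ((N + n + 1 : ℝ) / (N + n)) - 1 = 1 / (N + n) := by field_simp; ring
      rw [e]; gcongr; linarith
  have hb := norm_sum_le_of_monotone_phase
    (u := fun n => Complex.exp ((-(t * Real.log (N + n)) : ℝ) * Complex.I))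
    (θ := fun n => 1 - t / (2 * Real.pi) * (Real.log (N + n + 1 : ℝ) - Real.log (N + n))) (M := M) hδ0
    (fun n => Complex.norm_exp_ofReal_mul_I _) ?_ ?_ ?_ ?_
  · refine hb.trans ?_
    rw [hδ, one_div_div]; gcongr
    · linarith
  · intro n hn
    rw [← Complex.exp_add, ← Complex.exp_periodic]
    congr 1
    have : (Real.pi : ℂ) ≠ 0 := by exact_mod_cast Real.pi_ne_zero
    push_cast
    rw [show (N + (n + 1) : ℝ) = N + n + 1 by ring]
    field_simp
    ring_nf
  · intro n hn
    have := (hlog n hn).2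
    have h1 : t / (2 * Real.pi) * (Real.log (N + n + 1 : ℝ) - Real.log (N + n)) ≤ N / (2 * 3) * (1 / N) := by
      gcongr
      · linarith [(hlog n hn).1, (by positivity : 0 ≤ 1 / (2 * (N:ℝ)))]
    have h2 : (N:ℝ) / (2 * 3) * (1 / N) = 1 / 6 := by field_simp; norm_num
    have h3 : δ ≤ N / (8 * 3 * N) := by rw [hδ]; gcongr
    have h4 : (N:ℝ) / (8 * 3 * N) = 1 / 24 := by field_simp; norm_num
    linarith
  · intro n hn
    have h1 : t / (2 * Real.pi) * (1 / (2 * N)) ≤ t / (2 * Real.pi) * (Real.log (N + n + 1 : ℝ) - Real.log (N + n)) := by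
      gcongr; exact (hlog n hn).1
    have h2 : δ ≤ t / (2 * Real.pi) * (1 / (2 * N)) := by
      rw [hδ, div_mul_div_comm, mul_one]
      apply div_le_div_of_nonneg_left ht.le (by positivity)
      nlinarith
    linarith
  · intro n hn
    have := (log_second_difference (m := N + n + 1) (by linarith [(by positivity : (0:ℝ) ≤ n)])).1
    have h0 : 0 ≤ 1 / ((N:ℝ) + n + 1) ^ 2 := by positivity
    rw [show (N + n + 1 - 1 : ℝ) = N + n by ring] at this
    have h1 : t / (2 * Real.pi) * (Real.log (N + n + 1 + 1 : ℝ) - Real.log (N + n + 1)) ≤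
        t / (2 * Real.pi) * (Real.log (N + n + 1 : ℝ) - Real.log (N + n)) := by
      gcongr ?_ * ?_; linarith
    push_cast
    rw [show (N + (n + 1) : ℝ) = N + n + 1 by ring]
    linarith

theorem norm_sum_correlation_le {a s : ℝ} {N M h : ℕ} (ha : 1 ≤ a) (hs : s ^ 2 = N) (hMN : M ≤ N)
    (has : a ^ 10 ≤ s) (hsa : s ≤ a ^ 15) (hh : 1 ≤ h) (hha : (h : ℝ) ≤ 2 * a ^ 8) :
    ‖∑ n ∈ Finset.range (M - h), Complex.exp
        (((a ^ 48 * (Real.log (N + n + h) - Real.log (N + n)) : ℝ)) * Complex.I)‖ ≤ 214 * a ^ 22 := by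
  have hpi3 := Real.pi_gt_three
  have hpi4 := Real.pi_le_four
  have ha0 : 0 < a := by linarith
  have hs0 : 0 < s := lt_of_lt_of_le (by positivity) has
  have hN0 : (1:ℝ) ≤ N := by
    rw [← hs]; exact one_le_pow₀ ((one_le_pow₀ ha).trans has)
  rcases Nat.lt_or_ge h M with hhM | hhM
  swap
  · rw [Nat.sub_eq_zero_of_le hhM]; simp; positivity
  have hh1 : (1:ℝ) ≤ h := by exact_mod_cast hh
  have hhN : (h:ℝ) ≤ N := by exact_mod_cast (by omega : h ≤ N)
  obtain ⟨l, hl⟩ : ∃ l, l = a ^ 48 * h / (64 * Real.pi * s ^ 6) := ⟨_, rfl⟩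
  have hl0 : 0 < l := by rw [hl]; positivity
  have hN3 : (N:ℝ) ^ 3 = s ^ 6 := by rw [← hs]; ring
  have hdiff : ∀ n : ℕ,
      a ^ 48 * (Real.log (N + (n + 2 : ℕ) + h) - Real.log (N + (n + 2 : ℕ))) -
        2 * (a ^ 48 * (Real.log (N + (n + 1 : ℕ) + h) - Real.log (N + (n + 1 : ℕ)))) +
        (a ^ 48 * (Real.log (N + n + h) - Real.log (N + n))) =
      a ^ 48 * ((2 * Real.log (N + n + 1 : ℝ) - Real.log (N + n + 1 + 1) - Real.log (N + n + 1 - 1)) -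
        (2 * Real.log (N + n + 1 + h : ℝ) - Real.log (N + n + 1 + h + 1) - Real.log (N + n + 1 + h - 1))) := by
    intro n
    push_cast
    rw [show (N + n + 1 - 1 : ℝ) = N + n by ring, show (N + (n + 2) : ℝ) = N + n + 1 + 1 by ring,
      show (N + (n + 1) : ℝ) = N + n + 1 by ring, show (N + n + 1 + h - 1 : ℝ) = N + n + h by ring,
      show (N + n + 1 + 1 + h : ℝ) = N + n + 1 + h + 1 by ring]
    ring
  have hsup : l ≤ (a ^ 28 / (9 * s ^ 3)) ^ 2 := by
    rw [hl, div_pow]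
    calc a ^ 48 * h / (64 * Real.pi * s ^ 6) ≤ a ^ 48 * (2 * a ^ 8) / (64 * 3 * s ^ 6) := by gcongr
      _ = a ^ 56 / (96 * s ^ 6) := by field_simp; norm_num
      _ ≤ a ^ 56 / (81 * s ^ 6) := by gcongr; norm_num
      _ = _ := by ring
  have hinf : (a ^ 24 / (16 * s ^ 3)) ^ 2 ≤ l := by
    rw [hl, div_pow]
    calc (a ^ 24) ^ 2 / (16 * s ^ 3) ^ 2 = a ^ 48 * 1 / (64 * 4 * s ^ 6) := by field_simp; norm_num
      _ ≤ _ := by gcongr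
  have hbd := norm_sum_cexp_le_of_phase
    (φ := fun n => a ^ 48 * (Real.log (N + n + h) - Real.log (N + n))) (M := M - h) (l := l) (L := 192 * l) hl0 ?_
    (by linarith) ?_ ?_
  · refine hbd.trans ?_
    have hMr : ((M - h : ℕ):ℝ) ≤ s ^ 2 := by rw [hs]; exact_mod_cast (by omega : M - h ≤ N)
    have hsl : 0 < √l := by positivity
    have hll : √l ^ 2 = l := Real.sq_sqrt hl0.le
    have a1 : √l ≤ a ^ 28 / (9 * s ^ 3) := (Real.sqrt_le_left (by positivity)).2 hsup
    have a2 : a ^ 24 / (16 * s ^ 3) ≤ √l := Real.le_sqrt_of_sq_le hinf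
    calc (192 * l * (M - h : ℕ) + 2) * (4 / √l) = 768 * (M - h : ℕ) * √l + 8 / √l := by
          nth_rewrite 1 [← hll]; field_simp; ring
      _ ≤ 768 * s ^ 2 * (a ^ 28 / (9 * s ^ 3)) + 8 / (a ^ 24 / (16 * s ^ 3)) := by gcongr
      _ = (768 / 9) * (a ^ 28 / s) + 128 * (s ^ 3 / a ^ 24) := by field_simp; ring
      _ ≤ (768 / 9) * (a ^ 28 / a ^ 10) + 128 * ((a ^ 15) ^ 3 / a ^ 24) := by gcongr
      _ = (768 / 9) * a ^ 18 + 128 * a ^ 21 := by field_simp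
      _ ≤ (768 / 9) * a ^ 22 + 128 * a ^ 22 := by gcongr <;> first | exact ha | norm_num
      _ ≤ _ := by nlinarith [pow_pos ha0 22]
  · refine hsup.trans ?_
    have : a ^ 28 / (9 * s ^ 3) ≤ 1 / 2 := by
      rw [div_le_iff₀ (by positivity)]
      calc a ^ 28 ≤ a ^ 30 := pow_le_pow_right₀ ha (by norm_num)
        _ = (a ^ 10) ^ 3 := by ring
        _ ≤ s ^ 3 := by gcongr
        _ ≤ _ := by nlinarith [pow_pos hs0 3]
    calc _ ≤ (1 / 2 : ℝ) ^ 2 := by gcongr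
      _ = _ := by norm_num
  · intro n hn
    have hn' : (n : ℝ) + 1 ≤ N := by exact_mod_cast (by omega : n + 1 ≤ N)
    have hn0 : (0:ℝ) ≤ n := by positivity
    have := (log_second_difference_shift (m := N + n + 1) (h := h) (by linarith) hh1 (by linarith)).1
    rw [hdiff n]
    calc l * (2 * Real.pi) = a ^ 48 * (h / (4 * (2 * N) ^ 3)) := by
          rw [hl, mul_pow, hN3]; field_simp; norm_num
      _ ≤ a ^ 48 * (h / (4 * ((N:ℝ) + n + 1) ^ 3)) := by gcongr; linarith
      _ ≤ _ := by gcongr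
  · intro n hn
    have hn' : (n : ℝ) + 1 ≤ N := by exact_mod_cast (by omega : n + 1 ≤ N)
    have hn0 : (0:ℝ) ≤ n := by positivity
    have := (log_second_difference_shift (m := N + n + 1) (h := h) (by linarith) hh1 (by linarith)).2
    rw [hdiff n]
    calc _ ≤ a ^ 48 * (6 * h / ((N:ℝ) + n + 1) ^ 3) := by gcongr
      _ ≤ a ^ 48 * (6 * h / (N:ℝ) ^ 3) := by gcongr; linarith
      _ = 192 * l * (2 * Real.pi) := by rw [hl, hN3]; field_simp; norm_num

theorem norm_sum_cexp_log_le_vdC {a s : ℝ} {N M : ℕ} (ha : 1 ≤ a) (hs : s ^ 2 = N) (hMN : M ≤ N)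
    (has : a ^ 10 ≤ s) (hsa : s ≤ a ^ 15) :
    ‖∑ n ∈ Finset.range M, Complex.exp ((-(a ^ 48 * Real.log (N + n)) : ℝ) * Complex.I)‖ ≤
      26 * s * a ^ 11 := by
  have ha0 : 0 < a := by linarith
  have hs0 : 0 < s := lt_of_lt_of_le (by positivity) has
  have hH0 : (0:ℝ) < ⌈a ^ 8⌉₊ := by
    have := Nat.le_ceil (a ^ 8)
    exact lt_of_lt_of_le (by positivity) this
  have hH2 : (⌈a ^ 8⌉₊ : ℝ) ≤ 2 * a ^ 8 := by
    have := Nat.ceil_lt_add_one (a := a ^ 8) (by positivity)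
    have h1 : 1 ≤ a ^ 8 := one_le_pow₀ ha
    linarith
  have key := norm_sq_sum_le_of_correlations
    (z := fun n => Complex.exp ((-(a ^ 48 * Real.log (N + n)) : ℝ) * Complex.I)) (M := M) (H := ⌈a ^ 8⌉₊)
    (R := 214 * a ^ 22) (fun n => Complex.norm_exp_ofReal_mul_I _) (by exact_mod_cast hH0) (by positivity) ?_
  · refine le_of_sq_le_sq ?_ (by positivity)
    refine key.trans ?_
    have hMr : (M:ℝ) ≤ s ^ 2 := by rw [hs]; exact_mod_cast hMN
    have h8 : a ^ 8 ≤ s ^ 2 := by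
      calc a ^ 8 ≤ a ^ 20 := pow_le_pow_right₀ ha (by norm_num)
        _ = (a ^ 10) ^ 2 := by ring
        _ ≤ _ := by gcongr
    calc _ ≤ (s ^ 2 + 2 * s ^ 2) * (s ^ 2 / a ^ 8 + 214 * a ^ 22) := by
          gcongr
          · linarith
          · exact Nat.le_ceil _
      _ ≤ (s ^ 2 + 2 * s ^ 2) * ((a ^ 15) ^ 2 / a ^ 8 + 214 * a ^ 22) := by gcongr
      _ = 645 * (s ^ 2 * a ^ 22) := by field_simp; ring
      _ ≤ 676 * (s ^ 2 * a ^ 22) := by gcongr; norm_num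
      _ = _ := by ring
  · intro h h1 h2
    have := norm_sum_correlation_le (h := h) ha hs hMN has hsa h1
      ((by exact_mod_cast h2.le : (h:ℝ) ≤ ⌈a ^ 8⌉₊).trans hH2)
    refine le_trans (le_of_eq ?_) this
    congr 1
    refine Finset.sum_congr rfl fun n _ => ?_
    rw [← Complex.exp_conj, ← Complex.exp_add]
    congr 1
    rw [map_mul, Complex.conj_ofReal, Complex.conj_I]
    push_cast
    rw [show (N + (n + h) : ℝ) = N + n + h by ring]
    ring

/-- Exponential sums `∑ n^{-it}` over dyadic blocks exhibit cancellation. -/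
theorem norm_sum_cexp_log_le {a : ℝ} {N M : ℕ} (ha : 1 ≤ a) (hN : 1 ≤ N) (hMN : M ≤ N)
    (hNa : (N:ℝ) ≤ 2 * a ^ 96) :
    ‖∑ n ∈ Finset.range M, Complex.exp ((-(a ^ 48 * Real.log (N + n)) : ℝ) * Complex.I)‖ ≤
      64 * √N * a ^ 11 := by
  have ha0 : 0 < a := by linarith
  have hN0 : (1:ℝ) ≤ N := by exact_mod_cast hN
  have hss : √(N:ℝ) ^ 2 = N := Real.sq_sqrt (by positivity)
  have hs0 : 0 < √(N:ℝ) := by positivity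
  have h11 : 1 ≤ a ^ 11 := one_le_pow₀ ha
  rcases le_total (a ^ 10) √N with h1 | h1
  swap
  · calc _ ≤ (M:ℝ) := by
          refine (norm_sum_le _ _).trans (le_of_eq ?_)
          simp_rw [Complex.norm_exp_ofReal_mul_I]; simp
      _ ≤ N := by exact_mod_cast hMN
      _ = √N * √N := by rw [← sq, hss]
      _ ≤ √N * a ^ 11 := by gcongr; exact h1.trans (pow_le_pow_right₀ ha (by norm_num))
      _ ≤ _ := by nlinarith [mul_pos hs0 (pow_pos ha0 11)]
  rcases le_total √N (a ^ 15) with h2 | h2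
  · refine (norm_sum_cexp_log_le_vdC ha hss hMN h1 h2).trans ?_
    gcongr; norm_num
  rcases le_total √N (a ^ 24) with h3 | h3
  · have hsq : √(a ^ 48) = a ^ 24 := by
      rw [show a ^ 48 = (a ^ 24) ^ 2 by ring, Real.sqrt_sq (by positivity)]
    refine (norm_sum_cexp_log_le_of_le (t := a ^ 48) hN hMN (by positivity) ?_).trans ?_
    · calc a ^ 48 ≤ a ^ 60 := pow_le_pow_right₀ ha (by norm_num)
        _ = (a ^ 15) ^ 4 := by ring
        _ ≤ √N ^ 4 := by gcongr
        _ = (√N ^ 2) ^ 2 := by ring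
        _ = 1 * (N:ℝ) ^ 2 := by rw [hss, one_mul]
        _ ≤ _ := by gcongr; linarith [Real.pi_gt_three]
    · rw [hsq]
      have e1 : a ^ 24 ≤ √N * a ^ 11 := by
        calc a ^ 24 ≤ a ^ 26 := pow_le_pow_right₀ ha (by norm_num)
          _ = a ^ 15 * a ^ 11 := by ring
          _ ≤ _ := by gcongr
      have e2 : (N:ℝ) / a ^ 24 ≤ √N * a ^ 11 := by
        rw [div_le_iff₀ (by positivity)]
        calc (N:ℝ) = √N * √N := by rw [← sq, hss]
          _ ≤ √N * a ^ 24 := by gcongr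
          _ ≤ √N * a ^ 11 * a ^ 24 := by
            gcongr
            nlinarith
      rw [mul_div_assoc]
      nlinarith [mul_pos hs0 (pow_pos ha0 11)]
  · refine (norm_sum_cexp_log_le_of_ge (t := a ^ 48) hN hMN (by positivity) ?_).trans ?_
    · calc a ^ 48 = (a ^ 24) ^ 2 := by ring
        _ ≤ √N ^ 2 := by gcongr
        _ = N := hss
    · have e0 : √(N:ℝ) ≤ 2 * a ^ 48 := by
        rw [Real.sqrt_le_left (by positivity)]
        nlinarith [pow_pos ha0 96]
      rw [div_le_iff₀ (by positivity)]
      calc 32 * (N:ℝ) = 32 * √N * √N := by rw [mul_assoc, ← sq, hss]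
        _ ≤ 32 * √N * (2 * a ^ 48) := by gcongr
        _ = 64 * √N * 1 * a ^ 48 := by ring
        _ ≤ _ := by gcongr

theorem norm_sum_smul_le_of_antitone {w : ℕ → ℝ} {z : ℕ → ℂ} {B : ℝ} {M : ℕ} (hw : ∀ n, 0 ≤ w n)
    (hanti : Antitone w) (hB : ∀ m ≤ M, ‖∑ n ∈ Finset.range m, z n‖ ≤ B) :
    ‖∑ n ∈ Finset.range M, (w n : ℂ) * z n‖ ≤ w 0 * B := by
  have hB0 : 0 ≤ B := (norm_nonneg _).trans (hB 0 (Nat.zero_le _))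
  have key : ∀ m ≤ M, ‖∑ n ∈ Finset.range m, (w n : ℂ) * z n - w m * ∑ n ∈ Finset.range m, z n‖ ≤ (w 0 - w m) * B := by
    intro m
    induction m with
    | zero => intro _; simp
    | succ m ih =>
      intro hm
      have e : ∑ n ∈ Finset.range (m + 1), (w n : ℂ) * z n - w (m + 1) * ∑ n ∈ Finset.range (m + 1), z n =
          (∑ n ∈ Finset.range m, (w n : ℂ) * z n - w m * ∑ n ∈ Finset.range m, z n) +
            ((w m - w (m + 1) : ℝ) : ℂ) * ∑ n ∈ Finset.range (m + 1), z n := by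
        rw [Finset.sum_range_succ, Finset.sum_range_succ]
        push_cast; ring
      have h0 : 0 ≤ w m - w (m + 1) := sub_nonneg.2 (hanti (Nat.le_succ m))
      rw [e]
      refine (norm_add_le _ _).trans ?_
      rw [norm_mul, Complex.norm_real, Real.norm_of_nonneg h0]
      have h1 := ih (by omega)
      have h2 : (w m - w (m + 1)) * ‖∑ n ∈ Finset.range (m + 1), z n‖ ≤ (w m - w (m + 1)) * B := by
        gcongr; exact hB _ hm
      linarith
  have h1 := key M le_rfl
  have h2 : ‖(w M : ℂ) * ∑ n ∈ Finset.range M, z n‖ ≤ w M * B := by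
    rw [norm_mul, Complex.norm_real, Real.norm_of_nonneg (hw M)]
    gcongr
    · exact hw M
    · exact hB M le_rfl
  calc _ = ‖(∑ n ∈ Finset.range M, (w n : ℂ) * z n - w M * ∑ n ∈ Finset.range M, z n) +
        w M * ∑ n ∈ Finset.range M, z n‖ := by rw [sub_add_cancel]
    _ ≤ _ := (norm_add_le _ _).trans (by linarith)

theorem natCast_cpow_neg_eq {n : ℕ} (hn : n ≠ 0) (σ t : ℝ) :
    (n : ℂ) ^ (-((σ : ℂ) + t * Complex.I)) =
      (((n : ℝ) ^ (-σ) : ℝ) : ℂ) * Complex.exp ((-(t * Real.log n) : ℝ) * Complex.I) := by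
  have h0 : (n : ℂ) ≠ 0 := Nat.cast_ne_zero.2 hn
  have h1 : (0 : ℝ) < n := by exact_mod_cast Nat.pos_of_ne_zero hn
  rw [Complex.ofReal_cpow h1.le, Complex.cpow_def_of_ne_zero h0, Complex.ofReal_natCast,
    Complex.cpow_def_of_ne_zero h0, ← Complex.exp_add]
  congr 1
  push_cast
  ring

theorem norm_sum_dyadic_cpow_le {a σ : ℝ} (ha : 1 ≤ a) (hσ : 1 / 2 ≤ σ) {N : ℕ} (hN : 1 ≤ N)
    (hNa : (N:ℝ) ≤ 2 * a ^ 96) :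
    ‖∑ n ∈ Finset.range N, ((N + n : ℕ) : ℂ) ^ (-((σ : ℂ) + (a ^ 48 : ℝ) * Complex.I))‖ ≤ 64 * a ^ 11 := by
  have hN0 : (1:ℝ) ≤ N := by exact_mod_cast hN
  have e : ∀ n ∈ Finset.range N, ((N + n : ℕ) : ℂ) ^ (-((σ : ℂ) + (a ^ 48 : ℝ) * Complex.I)) =
      ((((N:ℝ) + n) ^ (-σ) : ℝ) : ℂ) * Complex.exp ((-(a ^ 48 * Real.log (N + n)) : ℝ) * Complex.I) := by
    intro n _
    rw [natCast_cpow_neg_eq (by omega)]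
    push_cast; rfl
  rw [Finset.sum_congr rfl e]
  have := norm_sum_smul_le_of_antitone (w := fun n : ℕ => ((N:ℝ) + n) ^ (-σ))
    (z := fun n => Complex.exp ((-(a ^ 48 * Real.log (N + n)) : ℝ) * Complex.I)) (B := 64 * √N * a ^ 11)
    (M := N) (fun n => by positivity) ?_ (fun m hm => norm_sum_cexp_log_le ha hN hm hNa)
  · refine this.trans ?_
    have h2 : ((N:ℝ) + (0:ℕ)) ^ (-σ) ≤ (√N)⁻¹ := by
      rw [Real.sqrt_eq_rpow, ← Real.rpow_neg (by positivity), Nat.cast_zero, add_zero]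
      exact Real.rpow_le_rpow_of_exponent_le hN0 (by linarith)
    have hs0 : 0 < √(N:ℝ) := by positivity
    calc _ ≤ (√N)⁻¹ * (64 * √N * a ^ 11) := by gcongr
      _ = _ := by field_simp
  · intro m n hmn
    have : (m:ℝ) ≤ n := by exact_mod_cast hmn
    exact Real.rpow_le_rpow_of_nonpos (by positivity) (by linarith) (by linarith)

theorem sum_range_two_pow_sub_one (f : ℕ → ℂ) (J : ℕ) :
    ∑ k ∈ Finset.range (2 ^ J - 1), f (k + 1) = ∑ j ∈ Finset.range J, ∑ n ∈ Finset.range (2 ^ j), f (2 ^ j + n) := by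
  induction J with
  | zero => simp
  | succ J ih =>
    have h1 : 1 ≤ 2 ^ J := Nat.one_le_two_pow
    rw [Finset.sum_range_succ, ← ih, show 2 ^ (J + 1) - 1 = (2 ^ J - 1) + 2 ^ J by omega, Finset.sum_range_add]
    congr 1
    refine Finset.sum_congr rfl fun n _ => ?_
    congr 1; omega

/-- A subconvexity bound for the zeta function. -/
theorem exists_norm_riemannZeta_pow_four_le : ∃ C > 0, ∀ t : ℝ, 1 ≤ t → ∀ σ : ℝ, 1 / 2 ≤ σ → σ ≤ 3 / 4 →
    ‖riemannZeta (σ + t * Complex.I)‖ ^ 4 ≤ C * t ^ (23 / 24 : ℝ) := by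
  refine ⟨30000 ^ 4, by norm_num, fun t ht σ hσ hσ' => ?_⟩
  have ht0 : 0 < t := by linarith
  obtain ⟨b, hb⟩ : ∃ b, b = t ^ (1 / 96 : ℝ) := ⟨_, rfl⟩
  have hb1 : 1 ≤ b := by rw [hb]; exact Real.one_le_rpow ht (by norm_num)
  have hb0 : 0 < b := by linarith
  have htb : t = b ^ 96 := by
    rw [hb, ← Real.rpow_natCast, ← Real.rpow_mul ht0.le]; norm_num
  have htb' : t ^ (23 / 24 : ℝ) = b ^ 92 := by
    rw [hb, ← Real.rpow_natCast, ← Real.rpow_mul ht0.le]; norm_num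
  have hlog : Real.log t ≤ 96 * b := by
    rw [htb, Real.log_pow]
    have := Real.log_le_self hb0.le
    push_cast; linarith
  have hlog0 : 0 ≤ Real.log t := Real.log_nonneg ht
  obtain ⟨J, hJ⟩ : ∃ J : ℕ, J = ⌈Real.logb 2 (t ^ 2)⌉₊ := ⟨_, rfl⟩
  have hlb0 : 0 ≤ Real.logb 2 (t ^ 2) := Real.logb_nonneg (by norm_num) (by nlinarith)
  have hJ1 : Real.logb 2 (t ^ 2) ≤ J := by rw [hJ]; exact Nat.le_ceil _
  have hJ2 : (J:ℝ) ≤ Real.logb 2 (t ^ 2) + 1 := by rw [hJ]; exact (Nat.ceil_lt_add_one hlb0).le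
  have h2J : t ^ 2 ≤ (2:ℝ) ^ J := by
    rw [← Real.rpow_natCast 2 J]
    exact (Real.logb_le_iff_le_rpow (by norm_num) (by positivity)).1 hJ1
  have h2J' : (2:ℝ) ^ J ≤ 2 * t ^ 2 := by
    rw [← Real.rpow_natCast 2 J]
    calc (2:ℝ) ^ (J:ℝ) ≤ 2 ^ (Real.logb 2 (t ^ 2) + 1) := Real.rpow_le_rpow_of_exponent_le (by norm_num) hJ2
      _ = _ := by
        rw [Real.rpow_add (by norm_num), Real.rpow_logb (by norm_num) (by norm_num) (by positivity)]
        rw [Real.rpow_one]; ring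
  have hJb : (J:ℝ) ≤ 400 * b := by
    have h2 : (1/2:ℝ) ≤ Real.log 2 := by linarith [Real.log_two_gt_d9]
    have : Real.logb 2 (t ^ 2) ≤ 2 * (192 * b) := by
      rw [Real.logb, Real.log_pow, div_le_iff₀ (by linarith)]
      push_cast
      nlinarith
    linarith
  obtain ⟨s, hs⟩ : ∃ s : ℂ, s = σ + t * Complex.I := ⟨_, rfl⟩
  have hsre : s.re = σ := by simp [hs]
  have hsim : s.im = t := by simp [hs]
  have hs1 : s ≠ 1 := by
    intro h
    have := congrArg Complex.im h
    rw [hsim] at this; simp at this; linarith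
  have hsn : ‖s‖ ≤ 2 * t := by
    rw [hs]
    refine (norm_add_le _ _).trans ?_
    rw [norm_mul, Complex.norm_I, Complex.norm_real, Complex.norm_real, Real.norm_of_nonneg ht0.le,
      Real.norm_of_nonneg (by linarith)]
    linarith
  have h1J : 1 ≤ 2 ^ J := Nat.one_le_two_pow
  have hz := norm_riemannZeta_sub_le (s := s) (by rw [hsre]; exact hσ) hs1 (2 ^ J - 1)
  rw [Nat.sub_add_cancel h1J, sum_range_two_pow_sub_one (fun n => (n : ℂ) ^ (-s))] at hz
  have hpos2 : (0:ℝ) < 2 ^ J := by positivity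
  have hone2 : (1:ℝ) ≤ 2 ^ J := one_le_pow₀ (by norm_num)
  have hS : ‖∑ j ∈ Finset.range J, ∑ n ∈ Finset.range (2 ^ j), ((2 ^ j + n : ℕ) : ℂ) ^ (-s)‖ ≤ J * (64 * b ^ 22) := by
    refine (norm_sum_le _ _).trans ?_
    have : ∀ j ∈ Finset.range J, ‖∑ n ∈ Finset.range (2 ^ j), ((2 ^ j + n : ℕ) : ℂ) ^ (-s)‖ ≤ 64 * b ^ 22 := by
      intro j hj
      have h := norm_sum_dyadic_cpow_le (a := b ^ 2) (σ := σ) (N := 2 ^ j) (one_le_pow₀ hb1) hσ Nat.one_le_two_pow ?_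
      · rw [← pow_mul, ← pow_mul, ← htb, ← hs] at h
        exact h
      · push_cast
        rw [← pow_mul]
        calc (2:ℝ) ^ j ≤ 2 ^ J := pow_le_pow_right₀ (by norm_num) (Finset.mem_range.1 hj).le
          _ ≤ 2 * t ^ 2 := h2J'
          _ = _ := by rw [htb, ← pow_mul]
    refine (Finset.sum_le_sum this).trans (le_of_eq ?_)
    simp
  have hmain : ‖((2 ^ J : ℕ) : ℂ) ^ (1 - s) / (s - 1)‖ ≤ 2 := by
    have h1 : t ≤ ‖s - 1‖ := by
      have := Complex.abs_im_le_norm (s - 1)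
      rw [Complex.sub_im, hsim, Complex.one_im, sub_zero] at this
      exact (le_abs_self t).trans this
    rw [norm_div, Complex.norm_natCast_cpow_of_pos (by positivity), div_le_iff₀ (by linarith)]
    simp only [Complex.sub_re, Complex.one_re, hsre]
    push_cast
    calc ((2:ℝ) ^ J) ^ (1 - σ) ≤ ((2:ℝ) ^ J) ^ (1 / 2 : ℝ) :=
          Real.rpow_le_rpow_of_exponent_le hone2 (by linarith)
      _ = √(2 ^ J) := by rw [Real.sqrt_eq_rpow]
      _ ≤ 2 * t := by rw [Real.sqrt_le_left (by positivity)]; nlinarith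
      _ ≤ _ := by linarith
  have herr : 4 * ‖s‖ * ((2 ^ J : ℕ) : ℝ) ^ (-s.re) ≤ 8 := by
    have : ((2 ^ J : ℕ) : ℝ) ^ (-s.re) ≤ 1 / t := by
      push_cast
      rw [hsre]
      calc ((2:ℝ) ^ J) ^ (-σ) ≤ ((2:ℝ) ^ J) ^ (-(1 / 2) : ℝ) :=
            Real.rpow_le_rpow_of_exponent_le hone2 (by linarith)
        _ = (√(2 ^ J))⁻¹ := by rw [Real.rpow_neg hpos2.le, Real.sqrt_eq_rpow]
        _ ≤ t⁻¹ := by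
            gcongr
            exact Real.le_sqrt_of_sq_le h2J
        _ = _ := by rw [one_div]
    calc _ ≤ 4 * (2 * t) * (1 / t) := by gcongr
      _ = 8 := by field_simp; norm_num
  have hfin : ‖riemannZeta s‖ ≤ 30000 * b ^ 23 := by
    have h23 : 1 ≤ b ^ 23 := one_le_pow₀ hb1
    have hJ3 : (J:ℝ) * (64 * b ^ 22) ≤ 25600 * b ^ 23 := by
      calc _ ≤ 400 * b * (64 * b ^ 22) := by gcongr
        _ = _ := by ring
    have := norm_sub_norm_le (riemannZeta s) (∑ j ∈ Finset.range J, ∑ n ∈ Finset.range (2 ^ j), ((2 ^ j + n : ℕ) : ℂ) ^ (-s) +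
      ((2 ^ J : ℕ) : ℂ) ^ (1 - s) / (s - 1))
    have h2 := norm_add_le (∑ j ∈ Finset.range J, ∑ n ∈ Finset.range (2 ^ j), ((2 ^ j + n : ℕ) : ℂ) ^ (-s))
      (((2 ^ J : ℕ) : ℂ) ^ (1 - s) / (s - 1))
    linarith
  rw [htb', ← hs]
  calc _ ≤ (30000 * b ^ 23) ^ 4 := by gcongr
    _ = _ := by ring

theorem norm_riemannZeta_sub_sum_le {u σ : ℝ} (hu : 2 ≤ u) (h1 : 1 ≤ σ) (h2 : σ ≤ 2) :
    ‖riemannZeta (σ + u * Complex.I) - ∑ k ∈ Finset.range (⌈u ^ 2⌉₊ - 1), ((k + 1 : ℕ) : ℂ) ^ (-((σ : ℂ) + u * Complex.I))‖ ≤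
      9 / u := by
  have hu0 : 0 < u := by linarith
  obtain ⟨s, hs⟩ : ∃ s : ℂ, s = σ + u * Complex.I := ⟨_, rfl⟩
  have hsre : s.re = σ := by simp [hs]
  have hsim : s.im = u := by simp [hs]
  have hs1 : s ≠ 1 := by
    intro h
    have := congrArg Complex.im h
    rw [hsim] at this; simp at this; linarith
  have hsn : ‖s‖ ≤ 2 * u := by
    have h := Complex.sq_norm s
    rw [Complex.normSq_apply, hsre, hsim] at h
    refine le_of_sq_le_sq ?_ (by linarith)
    nlinarith
  have hM : u ^ 2 ≤ (⌈u ^ 2⌉₊ : ℝ) := Nat.le_ceil _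
  have hM0 : 1 ≤ ⌈u ^ 2⌉₊ := Nat.one_le_iff_ne_zero.2 (by
    intro h; rw [h] at hM; push_cast at hM; nlinarith)
  have hM1 : (1:ℝ) ≤ (⌈u ^ 2⌉₊ : ℝ) := by exact_mod_cast hM0
  have hz := norm_riemannZeta_sub_le (s := s) (by rw [hsre]; linarith) hs1 (⌈u ^ 2⌉₊ - 1)
  rw [Nat.sub_add_cancel hM0] at hz
  have hmain : ‖((⌈u ^ 2⌉₊ : ℕ) : ℂ) ^ (1 - s) / (s - 1)‖ ≤ 1 / u := by
    have h1 : u ≤ ‖s - 1‖ := by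
      have := Complex.abs_im_le_norm (s - 1)
      rw [Complex.sub_im, hsim, Complex.one_im, sub_zero] at this
      exact (le_abs_self u).trans this
    rw [norm_div, Complex.norm_natCast_cpow_of_pos (by omega)]
    simp only [Complex.sub_re, Complex.one_re, hsre]
    gcongr
    exact Real.rpow_le_one_of_one_le_of_nonpos hM1 (by linarith)
  have herr : 4 * ‖s‖ * ((⌈u ^ 2⌉₊ : ℕ) : ℝ) ^ (-s.re) ≤ 8 / u := by
    have : ((⌈u ^ 2⌉₊ : ℕ) : ℝ) ^ (-s.re) ≤ 1 / u ^ 2 := by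
      rw [hsre]
      calc (⌈u ^ 2⌉₊ : ℝ) ^ (-σ) ≤ (⌈u ^ 2⌉₊ : ℝ) ^ (-1 : ℝ) :=
            Real.rpow_le_rpow_of_exponent_le hM1 (by linarith)
        _ = (⌈u ^ 2⌉₊ : ℝ)⁻¹ := Real.rpow_neg_one _
        _ ≤ (u ^ 2)⁻¹ := by gcongr
        _ = _ := by rw [one_div]
    calc _ ≤ 4 * (2 * u) * (1 / u ^ 2) := by gcongr
      _ = 8 / u := by field_simp; norm_num
  rw [← hs]
  rw [← sub_sub] at hz
  have := norm_sub_norm_le (riemannZeta s - ∑ k ∈ Finset.range (⌈u ^ 2⌉₊ - 1), ((k + 1 : ℕ) : ℂ) ^ (-s))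
    (((⌈u ^ 2⌉₊ : ℕ) : ℂ) ^ (1 - s) / (s - 1))
  have e : 9 / u = 1 / u + 8 / u := by ring
  rw [e]
  linarith

theorem log_ceil_sq_le {u : ℝ} (hu : 2 ≤ u) {k : ℕ} (hk : k < ⌈u ^ 2⌉₊ - 1) :
    Real.log (k + 1 : ℕ) ≤ 2 * Real.log u := by
  have h : (k : ℝ) + 1 ≤ u ^ 2 := by
    have := Nat.ceil_lt_add_one (a := u ^ 2) (by positivity)
    have h2 : ((k + 2 : ℕ) : ℝ) ≤ (⌈u ^ 2⌉₊ : ℝ) := by exact_mod_cast (by omega)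
    push_cast at h2; linarith
  calc _ ≤ Real.log (u ^ 2) := Real.log_le_log (by positivity) (by push_cast; exact h)
    _ = _ := by rw [Real.log_pow]; push_cast; ring

theorem sum_inv_ceil_sq_le {u : ℝ} (hu : 2 ≤ u) :
    ∑ k ∈ Finset.range (⌈u ^ 2⌉₊ - 1), ((k + 1 : ℕ) : ℝ)⁻¹ ≤ 4 * Real.log u := by
  have hl : 1 / 2 ≤ Real.log u := by
    have := Real.log_le_log (by norm_num) hu
    linarith [Real.log_two_gt_d9]
  rcases Nat.eq_zero_or_pos (⌈u ^ 2⌉₊ - 1) with h0 | h0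
  · rw [h0]; simp; linarith
  have h := harmonic_le_one_add_log (⌈u ^ 2⌉₊ - 1)
  have e : ((harmonic (⌈u ^ 2⌉₊ - 1) : ℚ) : ℝ) = ∑ k ∈ Finset.range (⌈u ^ 2⌉₊ - 1), ((k + 1 : ℕ) : ℝ)⁻¹ := by
    rw [harmonic]; push_cast; rfl
  rw [e] at h
  have h2 := log_ceil_sq_le hu (k := ⌈u ^ 2⌉₊ - 1 - 1) (by omega)
  rw [Nat.sub_add_cancel h0] at h2
  linarith

theorem norm_natCast_cpow_neg {n : ℕ} (hn : n ≠ 0) (σ t : ℝ) :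
    ‖(n : ℂ) ^ (-((σ : ℂ) + t * Complex.I))‖ = (n : ℝ) ^ (-σ) := by
  rw [Complex.norm_natCast_cpow_of_pos (Nat.pos_of_ne_zero hn)]
  simp

theorem norm_riemannZeta_le_log {u σ : ℝ} (hu : 2 ≤ u) (h1 : 1 ≤ σ) (h2 : σ ≤ 2) :
    ‖riemannZeta (σ + u * Complex.I)‖ ≤ 13 * Real.log u := by
  have hl : 1 / 2 ≤ Real.log u := by
    have := Real.log_le_log (by norm_num) hu
    linarith [Real.log_two_gt_d9]
  have h := norm_riemannZeta_sub_sum_le hu h1 h2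
  have hS : ‖∑ k ∈ Finset.range (⌈u ^ 2⌉₊ - 1), ((k + 1 : ℕ) : ℂ) ^ (-((σ : ℂ) + u * Complex.I))‖ ≤ 4 * Real.log u := by
    refine (norm_sum_le _ _).trans (le_trans (Finset.sum_le_sum fun k _ => ?_) (sum_inv_ceil_sq_le hu))
    rw [norm_natCast_cpow_neg (by omega), ← Real.rpow_neg_one]
    exact Real.rpow_le_rpow_of_exponent_le (by push_cast; linarith [(by positivity : (0:ℝ) ≤ k)]) (by linarith)
  have h9 : 9 / u ≤ 9 * Real.log u := by
    rw [div_le_iff₀ (by linarith)]; nlinarith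
  have := norm_sub_norm_le (riemannZeta (σ + u * Complex.I))
    (∑ k ∈ Finset.range (⌈u ^ 2⌉₊ - 1), ((k + 1 : ℕ) : ℂ) ^ (-((σ : ℂ) + u * Complex.I)))
  linarith

theorem norm_riemannZeta_sub_riemannZeta_le {u η : ℝ} (hu : 2 ≤ u) (h0 : 0 ≤ η) (h1 : η ≤ 1) :
    ‖riemannZeta ((1 + η : ℝ) + u * Complex.I) - riemannZeta ((1 : ℝ) + u * Complex.I)‖ ≤
      8 * η * Real.log u ^ 2 + 18 / u := by
  have a1 := norm_riemannZeta_sub_sum_le hu (σ := 1 + η) (by linarith) (by linarith)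
  have a2 := norm_riemannZeta_sub_sum_le hu (σ := 1) le_rfl (by norm_num)
  have hS : ‖∑ k ∈ Finset.range (⌈u ^ 2⌉₊ - 1), ((k + 1 : ℕ) : ℂ) ^ (-(((1 + η : ℝ) : ℂ) + u * Complex.I)) -
      ∑ k ∈ Finset.range (⌈u ^ 2⌉₊ - 1), ((k + 1 : ℕ) : ℂ) ^ (-(((1 : ℝ) : ℂ) + u * Complex.I))‖ ≤
      8 * η * Real.log u ^ 2 := by
    rw [← Finset.sum_sub_distrib]
    have : ∀ k ∈ Finset.range (⌈u ^ 2⌉₊ - 1), ‖((k + 1 : ℕ) : ℂ) ^ (-(((1 + η : ℝ) : ℂ) + u * Complex.I)) -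
        ((k + 1 : ℕ) : ℂ) ^ (-(((1 : ℝ) : ℂ) + u * Complex.I))‖ ≤ ((k + 1 : ℕ) : ℝ)⁻¹ * (2 * η * Real.log u) := by
      intro k hk
      have hk0 : (0:ℝ) < (k + 1 : ℕ) := by positivity
      rw [natCast_cpow_neg_eq (by omega), natCast_cpow_neg_eq (by omega), ← sub_mul, norm_mul,
        Complex.norm_exp_ofReal_mul_I, mul_one, ← Complex.ofReal_sub, Complex.norm_real]
      have e : ((k + 1 : ℕ) : ℝ) ^ (-(1 + η)) - ((k + 1 : ℕ) : ℝ) ^ (-1 : ℝ) =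
          -(((k + 1 : ℕ) : ℝ)⁻¹ * (1 - ((k + 1 : ℕ) : ℝ) ^ (-η))) := by
        rw [neg_add, Real.rpow_add hk0, Real.rpow_neg_one]; ring
      have e1 : ((k + 1 : ℕ) : ℝ) ^ (-η) ≤ 1 :=
        Real.rpow_le_one_of_one_le_of_nonpos (by push_cast; linarith [(by positivity : (0:ℝ) ≤ k)]) (by linarith)
      have e2 : 1 - ((k + 1 : ℕ) : ℝ) ^ (-η) ≤ η * Real.log (k + 1 : ℕ) := by
        rw [Real.rpow_def_of_pos hk0]
        have := Real.add_one_le_exp (Real.log (k + 1 : ℕ) * -η)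
        linarith
      have e3 := log_ceil_sq_le hu (Finset.mem_range.1 hk)
      rw [e, norm_neg, norm_mul, Real.norm_of_nonneg (by positivity), Real.norm_of_nonneg (by linarith)]
      gcongr
      calc _ ≤ _ := e2
        _ ≤ η * (2 * Real.log u) := by gcongr
        _ = _ := by ring
    refine (norm_sum_le _ _).trans ((Finset.sum_le_sum this).trans ?_)
    rw [← Finset.sum_mul]
    have hl : 0 ≤ Real.log u := Real.log_nonneg (by linarith)
    calc _ ≤ 4 * Real.log u * (2 * η * Real.log u) := by
          gcongr; exact sum_inv_ceil_sq_le hu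
      _ = _ := by ring
  have e : (18:ℝ) / u = 9 / u + 9 / u := by ring
  rw [e]
  obtain ⟨A, hA⟩ : ∃ A, A = ∑ k ∈ Finset.range (⌈u ^ 2⌉₊ - 1), ((k + 1 : ℕ) : ℂ) ^ (-(((1 + η : ℝ) : ℂ) + u * Complex.I)) := ⟨_, rfl⟩
  obtain ⟨B, hB⟩ : ∃ B, B = ∑ k ∈ Finset.range (⌈u ^ 2⌉₊ - 1), ((k + 1 : ℕ) : ℂ) ^ (-(((1 : ℝ) : ℂ) + u * Complex.I)) := ⟨_, rfl⟩
  rw [← hA] at a1 hS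
  rw [← hB] at a2 hS
  calc _ = ‖(riemannZeta ((1 + η : ℝ) + u * Complex.I) - A) - (riemannZeta ((1 : ℝ) + u * Complex.I) - B) + (A - B)‖ := by
        congr 1; ring
    _ ≤ ‖riemannZeta ((1 + η : ℝ) + u * Complex.I) - A‖ + ‖riemannZeta ((1 : ℝ) + u * Complex.I) - B‖ + ‖A - B‖ :=
        (norm_add_le _ _).trans (by gcongr; exact norm_sub_le _ _)
    _ ≤ _ := by linarith

theorem norm_tsum_tail_le {f : ℕ → ℂ} {η : ℝ} (hη : 0 < η) {N : ℕ} (hN : 1 ≤ N)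
    (hf : ∀ n, ‖f n‖ ≤ (n : ℝ) ^ (-1 - η)) :
    ‖∑' n, f (n + N)‖ ≤ (N : ℝ) ^ (-(η / 2)) * (1 + 2 / η) := by
  have hN0 : (1:ℝ) ≤ N := by exact_mod_cast hN
  have hb : ∀ n : ℕ, ‖f (n + N)‖ ≤ (N : ℝ) ^ (-(η / 2)) * ((n:ℝ) + 1) ^ (-1 - η / 2) := by
    intro n
    have hn0 : (0:ℝ) ≤ n := by positivity
    refine (hf _).trans ?_
    have hp : (0:ℝ) < (n + N : ℕ) := by push_cast; linarith
    rw [show -1 - η = -(η / 2) + (-1 - η / 2) by ring, Real.rpow_add hp]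
    push_cast
    gcongr ?_ * ?_
    · exact Real.rpow_le_rpow_of_nonpos (by linarith) (by linarith) (by linarith)
    · exact Real.rpow_le_rpow_of_nonpos (by linarith) (by linarith) (by linarith)
  have hsum : ∀ M, ∑ n ∈ Finset.range M, ‖f (n + N)‖ ≤ (N : ℝ) ^ (-(η / 2)) * (1 + 2 / η) := by
    intro M
    calc _ ≤ ∑ n ∈ Finset.range M, (N : ℝ) ^ (-(η / 2)) * ((n:ℝ) + 1) ^ (-1 - η / 2) :=
          Finset.sum_le_sum fun n _ => hb n
      _ ≤ _ := by
          rw [← Finset.mul_sum]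
          gcongr
          refine (sum_range_rpow_le (by positivity) M).trans (le_of_eq ?_)
          rw [one_div_div]
  have hs : Summable fun n => ‖f (n + N)‖ := summable_of_sum_range_le (fun _ => norm_nonneg _) hsum
  exact (norm_tsum_le_tsum_norm hs).trans (Real.tsum_le_of_sum_range_le (fun _ => norm_nonneg _) hsum)

theorem norm_riemannZeta_le_one_add_inv {η : ℝ} (hη : 0 < η) (u : ℝ) :
    ‖riemannZeta ((1 + η : ℝ) + u * Complex.I)‖ ≤ 1 + 1 / η := by
  rw [zeta_eq_tsum_one_div_nat_add_one_cpow (by simpa using hη)]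
  have hb : ∀ n : ℕ, ‖1 / ((n:ℂ) + 1) ^ (((1 + η : ℝ) : ℂ) + u * Complex.I)‖ = ((n:ℝ) + 1) ^ (-1 - η) := by
    intro n
    have := norm_natCast_cpow_neg (n := n + 1) (by omega) (1 + η) u
    rw [Complex.cpow_neg] at this
    push_cast at this ⊢
    rw [one_div, this]
    congr 1; ring
  have hsum : ∀ M, ∑ n ∈ Finset.range M, ‖1 / ((n:ℂ) + 1) ^ (((1 + η : ℝ) : ℂ) + u * Complex.I)‖ ≤ 1 + 1 / η := by
    intro M
    rw [Finset.sum_congr rfl fun n _ => hb n]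
    exact sum_range_rpow_le hη M
  have hs := summable_of_sum_range_le (fun _ => norm_nonneg _) hsum
  exact (norm_tsum_le_tsum_norm hs).trans (Real.tsum_le_of_sum_range_le (fun _ => norm_nonneg _) hsum)

theorem summable_indicator_prime_cpow {s : ℂ} (hs : 1 < s.re) :
    Summable fun n : ℕ => {p : ℕ | p.Prime}.indicator (fun n => ‖(n : ℂ) ^ (-s)‖) n := by
  have h : Summable fun n : ℕ => ‖(n : ℂ) ^ (-s)‖ := by
    have := Complex.summable_one_div_nat_cpow.2 hs
    refine this.norm.congr fun n => ?_
    rw [Complex.cpow_neg, one_div]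
  exact h.indicator _

theorem norm_log_one_sub_prime_cpow_add_le {s : ℂ} (hs : 1 < s.re) {p : ℕ} (hp : p.Prime) :
    ‖-Complex.log (1 - (p : ℂ) ^ (-s)) - (p : ℂ) ^ (-s)‖ ≤ (p : ℝ) ^ (-1 - 1 : ℝ) := by
  have hp2 : (2:ℝ) ≤ p := by exact_mod_cast hp.two_le
  have hn : ‖(p : ℂ) ^ (-s)‖ ≤ (p:ℝ)⁻¹ := by
    rw [Complex.norm_natCast_cpow_of_pos hp.pos, ← Real.rpow_neg_one]
    exact Real.rpow_le_rpow_of_exponent_le (by linarith) (by simp; linarith)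
  have h2 : (p:ℝ)⁻¹ ≤ 1 / 2 := by rw [one_div]; gcongr
  have h := Complex.norm_log_one_add_sub_self_le (z := -(p : ℂ) ^ (-s)) (by rw [norm_neg]; linarith)
  rw [norm_neg] at h
  have e : ‖-Complex.log (1 - (p : ℂ) ^ (-s)) - (p : ℂ) ^ (-s)‖ =
      ‖Complex.log (1 + -(p : ℂ) ^ (-s)) - -(p : ℂ) ^ (-s)‖ := by
    rw [← norm_neg]; congr 1; rw [← sub_eq_add_neg]; ring
  rw [e]
  refine h.trans ?_
  have h3 : (1 - ‖(p : ℂ) ^ (-s)‖)⁻¹ ≤ 2 := by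
    rw [inv_le_comm₀ (by linarith) (by norm_num)]; linarith
  have h4 : 0 ≤ (1 - ‖(p : ℂ) ^ (-s)‖)⁻¹ := inv_nonneg.2 (by linarith)
  calc _ ≤ (p:ℝ)⁻¹ ^ 2 * 2 / 2 := by gcongr
    _ = (p:ℝ) ^ (-(2:ℕ) : ℝ) := by rw [Real.rpow_neg (by linarith), Real.rpow_natCast]; field_simp
    _ = _ := by norm_num

theorem riemannZeta_eq_exp_tsum_indicator {s : ℂ} (hs : 1 < s.re) :
    riemannZeta s = Complex.exp (∑' n : ℕ, {p : ℕ | p.Prime}.indicator (fun n => -Complex.log (1 - (n : ℂ) ^ (-s))) n) := by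
  rw [← riemannZeta_eulerProduct_exp_log hs]
  congr 1
  exact tsum_subtype {p : ℕ | p.Prime} (fun n : ℕ => -Complex.log (1 - (n : ℂ) ^ (-s)))

theorem summable_indicator_log {s : ℂ} (hs : 1 < s.re) :
    Summable fun n : ℕ => {p : ℕ | p.Prime}.indicator (fun n => -Complex.log (1 - (n : ℂ) ^ (-s)) - (n : ℂ) ^ (-s)) n := by
  refine Summable.of_norm_bounded (g := fun n : ℕ => (n : ℝ) ^ (-2 : ℝ)) (Real.summable_nat_rpow.2 (by norm_num)) fun n => ?_
  by_cases hn : n.Prime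
  · rw [indicator_of_mem (by exact hn)]
    exact (norm_log_one_sub_prime_cpow_add_le hs hn).trans (le_of_eq (by norm_num))
  · rw [indicator_of_notMem (by exact hn), norm_zero]; positivity

/-- The logarithm of zeta is a sum over primes up to a bounded error. -/
theorem norm_inv_riemannZeta_le_exp {s : ℂ} (hs : 1 < s.re) :
    ‖riemannZeta s‖⁻¹ ≤ Real.exp (2 + ‖∑' n : ℕ, {p : ℕ | p.Prime}.indicator (fun n => (n : ℂ) ^ (-s)) n‖) := by
  have hE : ‖∑' n : ℕ, {p : ℕ | p.Prime}.indicator (fun n => -Complex.log (1 - (n : ℂ) ^ (-s)) - (n : ℂ) ^ (-s)) n‖ ≤ 2 := by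
    obtain ⟨f, hf⟩ : ∃ f : ℕ → ℂ, f = {p : ℕ | p.Prime}.indicator
      (fun n => -Complex.log (1 - (n : ℂ) ^ (-s)) - (n : ℂ) ^ (-s)) := ⟨_, rfl⟩
    have hb : ∀ n, ‖f n‖ ≤ (n:ℝ) ^ (-1 - 1 : ℝ) := by
      intro n
      rw [hf]
      by_cases hn : n.Prime
      · rw [indicator_of_mem (by exact hn)]
        exact norm_log_one_sub_prime_cpow_add_le hs hn
      · rw [indicator_of_notMem (by exact hn), norm_zero]; positivity
    have hsf : Summable f := by rw [hf]; exact summable_indicator_log hs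
    have hf0 : f 0 = 0 := by rw [hf, indicator_of_notMem (by simp [Nat.not_prime_zero])]
    have hsum : ∀ M, ∑ n ∈ Finset.range M, ‖f (n + 1)‖ ≤ 2 := by
      intro M
      calc _ ≤ ∑ n ∈ Finset.range M, ((n:ℝ) + 1) ^ (-1 - 1 : ℝ) :=
            Finset.sum_le_sum fun n _ => (hb (n + 1)).trans (le_of_eq (by push_cast; rfl))
        _ ≤ 1 + 1 / 1 := sum_range_rpow_le one_pos M
        _ = 2 := by norm_num
    have hs1 : Summable fun n => ‖f (n + 1)‖ := summable_of_sum_range_le (fun _ => norm_nonneg _) hsum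
    change ‖∑' n, ({p : ℕ | p.Prime}.indicator
      (fun n : ℕ => -Complex.log (1 - (n : ℂ) ^ (-s)) - (n : ℂ) ^ (-s))) n‖ ≤ 2
    rw [← hf, hsf.tsum_eq_zero_add, hf0, zero_add]
    exact (norm_tsum_le_tsum_norm hs1).trans (Real.tsum_le_of_sum_range_le (fun _ => norm_nonneg _) hsum)
  have hsp : Summable fun n : ℕ => {p : ℕ | p.Prime}.indicator (fun n => (n : ℂ) ^ (-s)) n := by
    refine Summable.of_norm ((summable_indicator_prime_cpow hs).congr fun n => ?_)
    rw [norm_indicator_eq_indicator_norm]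
  have hadd := (summable_indicator_log hs).tsum_add hsp
  have e : ∀ n : ℕ, {p : ℕ | p.Prime}.indicator (fun n : ℕ => -Complex.log (1 - (n : ℂ) ^ (-s)) - (n : ℂ) ^ (-s)) n +
      {p : ℕ | p.Prime}.indicator (fun n : ℕ => (n : ℂ) ^ (-s)) n =
      {p : ℕ | p.Prime}.indicator (fun n : ℕ => -Complex.log (1 - (n : ℂ) ^ (-s))) n := by
    intro n
    by_cases hn : n.Prime
    · simp only [indicator_of_mem (show n ∈ {p : ℕ | p.Prime} from hn)]; ring
    · simp only [indicator_of_notMem (show n ∉ {p : ℕ | p.Prime} from hn)]; ring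
  rw [tsum_congr e] at hadd
  rw [riemannZeta_eq_exp_tsum_indicator hs, hadd, Complex.norm_exp, ← Real.exp_neg, Real.exp_le_exp]
  have h1 := (Complex.abs_re_le_norm (∑' n : ℕ, {p : ℕ | p.Prime}.indicator (fun n => -Complex.log (1 - (n : ℂ) ^ (-s)) - (n : ℂ) ^ (-s)) n +
    ∑' n : ℕ, {p : ℕ | p.Prime}.indicator (fun n => (n : ℂ) ^ (-s)) n)).trans (norm_add_le _ _)
  have h2 := neg_abs_le (∑' n : ℕ, {p : ℕ | p.Prime}.indicator (fun n => -Complex.log (1 - (n : ℂ) ^ (-s)) - (n : ℂ) ^ (-s)) n +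
    ∑' n : ℕ, {p : ℕ | p.Prime}.indicator (fun n => (n : ℂ) ^ (-s)) n).re
  linarith

theorem sum_range_two_pow_eq_add_sum_Ico {E : Type*} [AddCommGroup E] (f : ℕ → E) {i J : ℕ} (h : i ≤ J) :
    ∑ n ∈ Finset.range (2 ^ J), f n = ∑ n ∈ Finset.range (2 ^ i), f n +
      ∑ j ∈ Finset.Ico i J, ∑ n ∈ Finset.Ico (2 ^ j) (2 ^ (j + 1)), f n := by
  induction J, h using Nat.le_induction with
  | base => simp
  | succ J hJ ih =>
    rw [Finset.sum_Ico_succ_top hJ, ← add_assoc, ← ih, Finset.range_eq_Ico, Finset.range_eq_Ico,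
      Finset.sum_Ico_consecutive _ (Nat.zero_le _) (Nat.pow_le_pow_right (by norm_num) (by omega))]

theorem sum_prime_log_div_le (J : ℕ) :
    ∑ n ∈ Finset.range (2 ^ J), {p : ℕ | p.Prime}.indicator (fun n => Real.log n / n) n ≤ J * (2 * Real.log 4) := by
  rw [sum_range_two_pow_eq_add_sum_Ico _ (Nat.zero_le J)]
  have h0 : ∑ n ∈ Finset.range (2 ^ 0), {p : ℕ | p.Prime}.indicator (fun n : ℕ => Real.log n / n) n = 0 := by
    simp
  rw [h0, zero_add]
  have hb : ∀ j ∈ Finset.Ico 0 J, ∑ n ∈ Finset.Ico (2 ^ j) (2 ^ (j + 1)),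
      {p : ℕ | p.Prime}.indicator (fun n : ℕ => Real.log n / n) n ≤ 2 * Real.log 4 := by
    intro j _
    have hθ := Chebyshev.theta_le_log4_mul_x (x := ((2 ^ (j + 1) : ℕ) : ℝ)) (by positivity)
    rw [Chebyshev.theta_eq_sum_Icc, Nat.floor_natCast] at hθ
    calc _ ≤ ∑ n ∈ Finset.Ico (2 ^ j) (2 ^ (j + 1)), (if n.Prime then Real.log n else 0) / 2 ^ j := by
          refine Finset.sum_le_sum fun n hn => ?_
          rw [Finset.mem_Ico] at hn
          have hn' : (2:ℝ) ^ j ≤ n := by exact_mod_cast hn.1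
          have h1 : 1 ≤ 2 ^ j := Nat.one_le_two_pow
          by_cases hp : n.Prime
          · rw [indicator_of_mem (by exact hp), if_pos hp]
            gcongr
          · rw [indicator_of_notMem (by exact hp), if_neg hp]; simp
      _ = (∑ n ∈ (Finset.Ico (2 ^ j) (2 ^ (j + 1)) : Finset ℕ) with n.Prime, Real.log n) / 2 ^ j := by
          rw [Finset.sum_filter, Finset.sum_div]
      _ ≤ (∑ n ∈ (Finset.Icc 0 (2 ^ (j + 1)) : Finset ℕ) with n.Prime, Real.log n) / 2 ^ j := by
          gcongr
          intro n hn
          rw [Finset.mem_Ico] at hn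
          rw [Finset.mem_Icc]; omega
      _ ≤ (Real.log 4 * (2 ^ (j + 1) : ℕ)) / 2 ^ j := by gcongr
      _ = _ := by push_cast; rw [pow_succ]; field_simp
  refine (Finset.sum_le_sum hb).trans (le_of_eq ?_)
  simp

theorem sum_prime_rpow_le {κ : ℝ} (hκ : 0 < κ) (N : ℕ) :
    ∑ n ∈ Finset.range N, {p : ℕ | p.Prime}.indicator (fun n => (n:ℝ) ^ (-1 - κ)) n ≤ Real.log (1 + 1 / κ) := by
  have hs : 1 < ((1 + κ : ℝ) : ℂ).re := by simpa using hκ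
  have hz := norm_riemannZeta_le_one_add_inv hκ 0
  rw [Complex.ofReal_zero, zero_mul, add_zero, riemannZeta_eq_exp_tsum_indicator hs, Complex.norm_exp] at hz
  have hsum : Summable fun n : ℕ => {p : ℕ | p.Prime}.indicator (fun n : ℕ => -Complex.log (1 - (n : ℂ) ^ (-((1 + κ : ℝ) : ℂ)))) n := by
    have hsp : Summable fun n : ℕ => {p : ℕ | p.Prime}.indicator (fun n => (n : ℂ) ^ (-((1 + κ : ℝ) : ℂ))) n := by
      refine Summable.of_norm ((summable_indicator_prime_cpow hs).congr fun n => ?_)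
      rw [norm_indicator_eq_indicator_norm]
    refine ((summable_indicator_log hs).add hsp).congr fun n => ?_
    by_cases hn : n.Prime
    · simp only [indicator_of_mem (show n ∈ {p : ℕ | p.Prime} from hn)]; ring
    · simp only [indicator_of_notMem (show n ∉ {p : ℕ | p.Prime} from hn)]; ring
  rw [Complex.re_tsum hsum] at hz
  have hterm : ∀ n : ℕ, {p : ℕ | p.Prime}.indicator (fun n => (n:ℝ) ^ (-1 - κ)) n ≤
      ({p : ℕ | p.Prime}.indicator (fun n : ℕ => -Complex.log (1 - (n : ℂ) ^ (-((1 + κ : ℝ) : ℂ)))) n).re := by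
    intro n
    by_cases hn : n.Prime
    · rw [indicator_of_mem (show n ∈ {p : ℕ | p.Prime} from hn), indicator_of_mem (show n ∈ {p : ℕ | p.Prime} from hn)]
      have hn1 : (1:ℝ) < n := by exact_mod_cast hn.one_lt
      have e : 1 - (n : ℂ) ^ (-((1 + κ : ℝ) : ℂ)) = ((1 - (n:ℝ) ^ (-1 - κ) : ℝ) : ℂ) := by
        rw [show -1 - κ = -(1 + κ) by ring]
        push_cast
        rw [Complex.ofReal_cpow (by positivity)]
        push_cast; rfl
      have hlt : (n:ℝ) ^ (-1 - κ) < 1 := Real.rpow_lt_one_of_one_lt_of_neg hn1 (by linarith)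
      rw [e, Complex.neg_re, Complex.log_ofReal_re]
      have := Real.log_le_sub_one_of_pos (x := 1 - (n:ℝ) ^ (-1 - κ)) (by linarith)
      linarith
    · rw [indicator_of_notMem (show n ∉ {p : ℕ | p.Prime} from hn), indicator_of_notMem (show n ∉ {p : ℕ | p.Prime} from hn)]
      simp
  have hnn : ∀ n : ℕ, 0 ≤ {p : ℕ | p.Prime}.indicator (fun n : ℕ => (n:ℝ) ^ (-1 - κ)) n := fun n =>
    indicator_nonneg (fun _ _ => by positivity) _
  have h1 := hsum.mapL Complex.reCLM
  have h2 : ∑ n ∈ Finset.range N, ({p : ℕ | p.Prime}.indicator (fun n : ℕ => -Complex.log (1 - (n : ℂ) ^ (-((1 + κ : ℝ) : ℂ)))) n).re ≤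
      ∑' n, ({p : ℕ | p.Prime}.indicator (fun n : ℕ => -Complex.log (1 - (n : ℂ) ^ (-((1 + κ : ℝ) : ℂ)))) n).re :=
    Summable.sum_le_tsum _ (fun n _ => (hnn n).trans (hterm n)) h1
  calc _ ≤ _ := Finset.sum_le_sum fun n _ => hterm n
    _ ≤ _ := h2
    _ ≤ _ := by
      rw [Real.le_log_iff_exp_le (by positivity)]; exact hz

/-- Mertens' upper bound for the sum of reciprocals of the primes. -/
theorem sum_prime_inv_le {J : ℕ} (hJ : 1 ≤ J) :
    ∑ n ∈ Finset.range (2 ^ J), {p : ℕ | p.Prime}.indicator (fun n => (n:ℝ)⁻¹) n ≤ Real.log (1 + J) + 3 := by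
  have hJ0 : (1:ℝ) ≤ J := by exact_mod_cast hJ
  have h1 := sum_prime_rpow_le (κ := 1 / J) (by positivity) (2 ^ J)
  have h2 := sum_prime_log_div_le J
  have hterm : ∀ n ∈ Finset.range (2 ^ J), {p : ℕ | p.Prime}.indicator (fun n => (n:ℝ)⁻¹) n ≤
      {p : ℕ | p.Prime}.indicator (fun n => (n:ℝ) ^ (-1 - 1 / (J:ℝ))) n +
        1 / J * {p : ℕ | p.Prime}.indicator (fun n => Real.log n / n) n := by
    intro n _
    by_cases hn : n.Prime
    · simp only [indicator_of_mem (show n ∈ {p : ℕ | p.Prime} from hn)]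
      have hn0 : (0:ℝ) < n := by exact_mod_cast hn.pos
      rw [sub_eq_add_neg, Real.rpow_add hn0, Real.rpow_neg_one, Real.rpow_def_of_pos hn0]
      have := Real.add_one_le_exp (Real.log n * -(1 / J))
      have e : 1 / (J:ℝ) * (Real.log n / n) = (n:ℝ)⁻¹ * (1 / J * Real.log n) := by field_simp
      rw [e, ← mul_add]
      nth_rewrite 1 [← mul_one (n:ℝ)⁻¹]
      gcongr
      linarith
    · simp only [indicator_of_notMem (show n ∉ {p : ℕ | p.Prime} from hn)]; simp
  have h3 := Finset.sum_le_sum hterm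
  rw [Finset.sum_add_distrib, ← Finset.mul_sum] at h3
  rw [one_div_one_div] at h1
  have h4 : 1 / (J:ℝ) * ∑ n ∈ Finset.range (2 ^ J), {p : ℕ | p.Prime}.indicator (fun n => Real.log n / n) n ≤
      1 / J * (J * (2 * Real.log 4)) := by gcongr
  have h5 : 1 / (J:ℝ) * (J * (2 * Real.log 4)) = 4 * Real.log 2 := by
    rw [show (4:ℝ) = 2 ^ 2 by norm_num, Real.log_pow]; field_simp; push_cast; ring
  linarith [Real.log_two_lt_d9]

theorem norm_inv_riemannZeta_le_of_blocks {η u : ℝ} (hη : 0 < η) {i J : ℕ} (hi : 1 ≤ i) (hiJ : i ≤ J) :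
    ‖riemannZeta ((1 + η : ℝ) + u * Complex.I)‖⁻¹ ≤ Real.exp (5 + Real.log (1 + i) +
      ∑ j ∈ Finset.Ico i J, ‖∑ p ∈ (Finset.Ico (2 ^ j) (2 ^ (j + 1)) : Finset ℕ) with p.Prime, (p : ℂ) ^ (-(((1 + η : ℝ) : ℂ) + u * Complex.I))‖ +
      ((2:ℝ) ^ J) ^ (-(η / 2)) * (1 + 2 / η)) := by
  have hs : 1 < (((1 + η : ℝ) : ℂ) + u * Complex.I).re := by simpa using hη
  refine (norm_inv_riemannZeta_le_exp hs).trans (Real.exp_le_exp.2 ?_)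
  obtain ⟨f, hf⟩ : ∃ f : ℕ → ℂ, f = {p : ℕ | p.Prime}.indicator
      (fun n => (n : ℂ) ^ (-(((1 + η : ℝ) : ℂ) + u * Complex.I))) := ⟨_, rfl⟩
  have hfn : ∀ n, ‖f n‖ = {p : ℕ | p.Prime}.indicator (fun n => (n:ℝ) ^ (-1 - η)) n := by
    intro n
    rw [hf]
    by_cases hn : n.Prime
    · simp only [indicator_of_mem (show n ∈ {p : ℕ | p.Prime} from hn)]
      rw [norm_natCast_cpow_neg hn.ne_zero]; congr 1; ring
    · simp only [indicator_of_notMem (show n ∉ {p : ℕ | p.Prime} from hn)]; simp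
  have hsf : Summable f := by
    refine Summable.of_norm ((summable_indicator_prime_cpow hs).congr fun n => ?_)
    rw [hf, norm_indicator_eq_indicator_norm]
  rw [← hf, ← hsf.sum_add_tsum_nat_add (2 ^ J), sum_range_two_pow_eq_add_sum_Ico f hiJ]
  have hA : ‖∑ n ∈ Finset.range (2 ^ i), f n‖ ≤ Real.log (1 + i) + 3 := by
    refine (norm_sum_le _ _).trans (le_trans (Finset.sum_le_sum fun n _ => ?_) (sum_prime_inv_le hi))
    rw [hfn]
    refine indicator_le_indicator' fun hn => ?_
    have hn1 : (1:ℝ) ≤ n := by exact_mod_cast (show n.Prime from hn).one_lt.le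
    rw [← Real.rpow_neg_one]
    exact Real.rpow_le_rpow_of_exponent_le hn1 (by linarith)
  have hB : ‖∑ j ∈ Finset.Ico i J, ∑ n ∈ Finset.Ico (2 ^ j) (2 ^ (j + 1)), f n‖ ≤
      ∑ j ∈ Finset.Ico i J, ‖∑ p ∈ (Finset.Ico (2 ^ j) (2 ^ (j + 1)) : Finset ℕ) with p.Prime, (p : ℂ) ^ (-(((1 + η : ℝ) : ℂ) + u * Complex.I))‖ := by
    refine (norm_sum_le _ _).trans (le_of_eq (Finset.sum_congr rfl fun j _ => ?_))
    rw [Finset.sum_filter, hf]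
    congr 1
    exact Finset.sum_congr rfl fun n _ => by rw [indicator_apply]; rfl
  have hC := norm_tsum_tail_le (f := f) hη (N := 2 ^ J) Nat.one_le_two_pow fun n => by
    rw [hfn]; exact indicator_le_self' (fun _ _ => by positivity) _
  push_cast at hC
  have h1 := norm_add_le (∑ n ∈ Finset.range (2 ^ i), f n + ∑ j ∈ Finset.Ico i J, ∑ n ∈ Finset.Ico (2 ^ j) (2 ^ (j + 1)), f n)
    (∑' n, f (n + 2 ^ J))
  have h2 := norm_add_le (∑ n ∈ Finset.range (2 ^ i), f n) (∑ j ∈ Finset.Ico i J, ∑ n ∈ Finset.Ico (2 ^ j) (2 ^ (j + 1)), f n)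
  linarith

/-- The number of ordered factorisations into `k` primes is at most `k!`. -/
theorem card_filter_prod_eq_le {k : ℕ} (S : Finset (Fin k → ℕ)) (hS : ∀ f ∈ S, ∀ i, (f i).Prime) (n : ℕ) :
    (S.filter fun f => ∏ i, f i = n).card ≤ k.factorial := by
  by_cases hk : ∃ f ∈ S, ∏ i, f i = n
  · obtain ⟨f₀, hf₀, hn⟩ := hk
    have hperm : ∀ f ∈ S, ∏ i, f i = n → (List.ofFn f).Perm n.primeFactorsList := fun f hf h =>
      Nat.primeFactorsList_unique (by rw [List.prod_ofFn, h]) fun p hp => by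
        obtain ⟨i, rfl⟩ := List.mem_ofFn.1 hp
        exact hS f hf i
    have hlen : n.primeFactorsList.length = k := by
      rw [← (hperm f₀ hf₀ hn).length_eq, List.length_ofFn]
    calc _ = ((S.filter fun f => ∏ i, f i = n).image List.ofFn).card :=
          (Finset.card_image_of_injective _ List.ofFn_injective).symm
      _ ≤ n.primeFactorsList.permutations.toFinset.card := by
          refine Finset.card_le_card fun l hl => ?_
          obtain ⟨f, hf, rfl⟩ := Finset.mem_image.1 hl
          rw [Finset.mem_filter] at hf
          exact List.mem_toFinset.2 (List.mem_permutations.2 (hperm f hf.1 hf.2))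
      _ ≤ n.primeFactorsList.permutations.length := List.toFinset_card_le _
      _ = k.factorial := by rw [List.length_permutations, hlen]
  · rw [Finset.filter_eq_empty_iff.2 fun f hf h => hk ⟨f, hf, h⟩]
    simp

theorem integral_norm_sq_sum_cexp_le {ι : Type*} (S : Finset ι) (c : ι → ℂ) (l : ι → ℝ) {a b : ℝ} (hab : a ≤ b) :
    ∫ u in a..b, ‖∑ f ∈ S, c f * Complex.exp ((u * l f : ℝ) * Complex.I)‖ ^ 2 ≤
      ∑ f ∈ S, ∑ g ∈ S, ‖c f‖ * ‖c g‖ * ‖∫ u in a..b, Complex.exp ((u * (l f - l g) : ℝ) * Complex.I)‖ := by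
  have e : ∀ u : ℝ, ((‖∑ f ∈ S, c f * Complex.exp ((u * l f : ℝ) * Complex.I)‖ ^ 2 : ℝ) : ℂ) =
      ∑ f ∈ S, ∑ g ∈ S, c f * (starRingEnd ℂ) (c g) * Complex.exp ((u * (l f - l g) : ℝ) * Complex.I) := by
    intro u
    push_cast
    rw [← Complex.mul_conj', map_sum, Finset.sum_mul_sum]
    refine Finset.sum_congr rfl fun f _ => Finset.sum_congr rfl fun g _ => ?_
    rw [map_mul, ← Complex.exp_conj, map_mul, Complex.conj_I, mul_mul_mul_comm, ← Complex.exp_add]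
    simp only [map_mul, Complex.conj_ofReal]
    congr 2
    ring
  have h0 : 0 ≤ ∫ u in a..b, ‖∑ f ∈ S, c f * Complex.exp ((u * l f : ℝ) * Complex.I)‖ ^ 2 :=
    intervalIntegral.integral_nonneg hab fun u _ => by positivity
  have h_int : ∀ f g : ι, IntervalIntegrable (fun u : ℝ => c f * (starRingEnd ℂ) (c g) * Complex.exp ((u * (l f - l g) : ℝ) * Complex.I)) volume a b :=
    fun f g => Continuous.intervalIntegrable (by fun_prop) _ _
  calc _ = ‖((∫ u in a..b, ‖∑ f ∈ S, c f * Complex.exp ((u * l f : ℝ) * Complex.I)‖ ^ 2 : ℝ) : ℂ)‖ := by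
        rw [Complex.norm_real, Real.norm_of_nonneg h0]
    _ = ‖∑ f ∈ S, ∑ g ∈ S, c f * (starRingEnd ℂ) (c g) * ∫ u in a..b, Complex.exp ((u * (l f - l g) : ℝ) * Complex.I)‖ := by
        rw [← intervalIntegral.integral_ofReal]
        congr 1
        rw [intervalIntegral.integral_congr fun u _ => e u]
        rw [intervalIntegral.integral_finsetSum fun f _ => Continuous.intervalIntegrable (by fun_prop) _ _]
        refine Finset.sum_congr rfl fun f _ => ?_
        rw [intervalIntegral.integral_finsetSum fun g _ => h_int f g]
        exact Finset.sum_congr rfl fun g _ => intervalIntegral.integral_const_mul _ _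
    _ ≤ _ := by
        refine (norm_sum_le _ _).trans (Finset.sum_le_sum fun f _ => (norm_sum_le _ _).trans
          (Finset.sum_le_sum fun g _ => le_of_eq ?_))
        rw [norm_mul, norm_mul, Complex.norm_conj]

theorem norm_integral_cexp_mul_I_le (a b : ℝ) {θ : ℝ} (hθ : θ ≠ 0) :
    ‖∫ u in a..b, Complex.exp ((u * θ : ℝ) * Complex.I)‖ ≤ 2 / |θ| := by
  have e : ∀ u : ℝ, Complex.exp ((u * θ : ℝ) * Complex.I) = Complex.exp ((θ * Complex.I) * u) := fun u => by
    congr 1; push_cast; ring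
  have hne : (θ : ℂ) * Complex.I ≠ 0 := by simp [hθ]
  simp_rw [e]
  rw [integral_exp_mul_complex hne, norm_div]
  simp only [← e]
  rw [norm_mul, Complex.norm_I, mul_one, Complex.norm_real, Real.norm_eq_abs]
  gcongr
  refine (norm_sub_le _ _).trans ?_
  rw [Complex.norm_exp_ofReal_mul_I, Complex.norm_exp_ofReal_mul_I]; norm_num

theorem sub_div_le_log_sub_log {m n : ℝ} (hm : 0 < m) (hmn : m ≤ n) : (n - m) / n ≤ Real.log n - Real.log m := by
  have hn : 0 < n := hm.trans_le hmn
  rw [← Real.log_div hn.ne' hm.ne']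
  have := Real.one_sub_inv_le_log_of_pos (x := n / m) (by positivity)
  rw [inv_div] at this
  rwa [sub_div, div_self hn.ne']

theorem norm_integral_cexp_log_le {a b M : ℝ} (hab : a ≤ b) {m n : ℕ} (hm : 1 ≤ m) (hn : 1 ≤ n) (hmM : (m:ℝ) ≤ M) (hnM : (n:ℝ) ≤ M) :
    ‖∫ u in a..b, Complex.exp ((u * (Real.log m - Real.log n) : ℝ) * Complex.I)‖ ≤
      if m = n then b - a else 2 * M / |(m:ℝ) - n| := by
  have hm0 : (0:ℝ) < m := by exact_mod_cast hm
  have hn0 : (0:ℝ) < n := by exact_mod_cast hn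
  split_ifs with h
  · refine (intervalIntegral.norm_integral_le_of_norm_le_const (C := 1) fun u _ => ?_).trans ?_
    · rw [Complex.norm_exp_ofReal_mul_I]
    · rw [abs_of_nonneg (by linarith)]; linarith
  · have hne : (m:ℝ) ≠ n := by exact_mod_cast h
    have hpos : 0 < |(m:ℝ) - n| := abs_pos.2 (sub_ne_zero.2 hne)
    have key : |(m:ℝ) - n| / M ≤ |Real.log m - Real.log n| := by
      rcases le_total (m:ℝ) n with h' | h'
      · have := sub_div_le_log_sub_log hm0 h'
        have h2 := Real.log_le_log hm0 h'
        rw [abs_of_nonpos (by linarith), abs_of_nonpos (by linarith), neg_sub, neg_sub]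
        refine le_trans ?_ this
        have := sub_nonneg.2 h'
        gcongr
      · have := sub_div_le_log_sub_log hn0 h'
        have h2 := Real.log_le_log hn0 h'
        rw [abs_of_nonneg (by linarith), abs_of_nonneg (by linarith)]
        refine le_trans ?_ this
        have := sub_nonneg.2 h'
        gcongr
    have hM : 0 < M := hm0.trans_le hmM
    have hp2 : 0 < |Real.log m - Real.log n| := lt_of_lt_of_le (by positivity) key
    refine (norm_integral_cexp_mul_I_le a b (abs_pos.1 hp2)).trans ?_
    rw [div_le_div_iff₀ hp2 hpos]
    rw [div_le_iff₀ hM] at key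
    linarith

theorem sum_inv_abs_sub_le {M m : ℕ} (hm : m ≤ M) :
    ∑ n ∈ Finset.Icc 1 M, (if m = n then 0 else 1 / |(m:ℝ) - n|) ≤ 2 * (1 + Real.log M) := by
  have hpt : ∀ n ∈ Finset.Icc 1 M, (if m = n then 0 else 1 / |(m:ℝ) - n|) ≤
      ∑ d ∈ Finset.Icc 1 M, ((if n = m + d then (d:ℝ)⁻¹ else 0) + if n = m - d then (d:ℝ)⁻¹ else 0) := by
    intro n hn
    rw [Finset.mem_Icc] at hn
    have hnn : ∀ d ∈ Finset.Icc 1 M, (0:ℝ) ≤ (if n = m + d then (d:ℝ)⁻¹ else 0) + if n = m - d then (d:ℝ)⁻¹ else 0 := by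
      intro d _
      refine add_nonneg ?_ ?_ <;> split_ifs <;> positivity
    rcases lt_trichotomy m n with h | h | h
    · rw [if_neg h.ne]
      have hd : n - m ∈ Finset.Icc 1 M := by rw [Finset.mem_Icc]; omega
      refine le_trans ?_ (Finset.single_le_sum hnn hd)
      rw [if_pos (by omega), Nat.cast_sub h.le, abs_sub_comm, abs_of_pos (sub_pos.2 (by exact_mod_cast h)), one_div]
      refine le_add_of_nonneg_right ?_
      split_ifs
      · exact inv_nonneg.2 (sub_nonneg.2 (by exact_mod_cast h.le))
      · exact le_rfl
    · rw [if_pos h]; exact Finset.sum_nonneg hnn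
    · rw [if_neg h.ne']
      have hd : m - n ∈ Finset.Icc 1 M := by rw [Finset.mem_Icc]; omega
      refine le_trans ?_ (Finset.single_le_sum hnn hd)
      rw [if_pos (show n = m - (m - n) by omega), Nat.cast_sub h.le, abs_of_pos (sub_pos.2 (by exact_mod_cast h)), one_div]
      refine le_add_of_nonneg_left ?_
      split_ifs
      · exact inv_nonneg.2 (sub_nonneg.2 (by exact_mod_cast h.le))
      · exact le_rfl
  refine (Finset.sum_le_sum hpt).trans ?_
  rw [Finset.sum_comm]
  have hd : ∀ d ∈ Finset.Icc 1 M, ∑ n ∈ Finset.Icc 1 M, ((if n = m + d then (d:ℝ)⁻¹ else 0) + if n = m - d then (d:ℝ)⁻¹ else 0) ≤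
      2 * (d:ℝ)⁻¹ := by
    intro d _
    rw [Finset.sum_add_distrib, Finset.sum_ite_eq', Finset.sum_ite_eq']
    have : (0:ℝ) ≤ (d:ℝ)⁻¹ := by positivity
    split_ifs <;> linarith
  refine (Finset.sum_le_sum hd).trans ?_
  rw [← Finset.mul_sum]
  have := harmonic_le_one_add_log M
  rw [harmonic_eq_sum_Icc] at this
  push_cast at this
  linarith

/-- High moments of a Dirichlet polynomial supported on primes in a dyadic interval. -/
theorem integral_norm_sum_prime_pow_le {W : ℕ} (hW : 1 ≤ W) (k : ℕ) {P : Finset ℕ}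
    (hP : ∀ p ∈ P, p.Prime ∧ W ≤ p ∧ p < 2 * W) (c : ℕ → ℂ) (hc : ∀ p ∈ P, ‖c p‖ ≤ 1 / W) {a b : ℝ} (hab : a ≤ b) :
    ∫ u in a..b, ‖∑ p ∈ P, c p * Complex.exp ((-(u * Real.log p) : ℝ) * Complex.I)‖ ^ (2 * k) ≤
      k.factorial / (W:ℝ) ^ k * ((b - a) + 4 * (2 * W) ^ k * (1 + Real.log ((2 * W) ^ k))) := by
  obtain ⟨S, hS⟩ : ∃ S, S = Fintype.piFinset fun _ : Fin k => P := ⟨_, rfl⟩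
  obtain ⟨M, hM⟩ : ∃ M : ℕ, M = (2 * W) ^ k := ⟨_, rfl⟩
  have hW0 : (0:ℝ) < W := by exact_mod_cast hW
  have hM1 : 1 ≤ M := hM ▸ Nat.one_le_pow _ _ (by omega)
  have hmem : ∀ f ∈ S, ∀ i, f i ∈ P := fun f hf => by rw [hS] at hf; exact Fintype.mem_piFinset.1 hf
  have hN : ∀ f ∈ S, ∏ i, f i ∈ Finset.Icc 1 M := by
    intro f hf
    rw [Finset.mem_Icc]
    refine ⟨Nat.one_le_iff_ne_zero.2 (Finset.prod_ne_zero_iff.2 fun i _ => (hP _ (hmem f hf i)).1.ne_zero), ?_⟩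
    calc _ ≤ ∏ _i : Fin k, 2 * W := Finset.prod_le_prod' fun i _ => (hP _ (hmem f hf i)).2.2.le
      _ = M := by simp [hM]
  have e : ∀ u : ℝ, ‖∑ p ∈ P, c p * Complex.exp ((-(u * Real.log p) : ℝ) * Complex.I)‖ ^ (2 * k) =
      ‖∑ f ∈ S, (∏ i, c (f i)) * Complex.exp ((u * -Real.log ((∏ i, f i : ℕ) : ℝ) : ℝ) * Complex.I)‖ ^ 2 := by
    intro u
    rw [mul_comm 2 k, pow_mul, ← norm_pow, Finset.sum_pow', hS]
    congr 2
    refine Finset.sum_congr rfl fun f hf => ?_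
    rw [Finset.prod_mul_distrib, ← Complex.exp_sum]
    congr 2
    rw [Nat.cast_prod, Real.log_prod fun i _ => Nat.cast_ne_zero.2 (hP _ (Fintype.mem_piFinset.1 hf i)).1.ne_zero]
    push_cast
    rw [← Finset.sum_neg_distrib, Finset.mul_sum, Finset.sum_mul]
    exact Finset.sum_congr rfl fun i _ => by ring
  rw [intervalIntegral.integral_congr fun u _ => e u]
  refine (integral_norm_sq_sum_cexp_le S _ _ hab).trans ?_
  have hcf : ∀ f ∈ S, ‖∏ i, c (f i)‖ ≤ 1 / (W:ℝ) ^ k := by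
    intro f hf
    rw [norm_prod]
    calc _ ≤ ∏ _i : Fin k, 1 / (W:ℝ) := Finset.prod_le_prod (fun _ _ => norm_nonneg _) fun i _ => hc _ (hmem f hf i)
      _ = _ := by simp
  obtain ⟨K, hK⟩ : ∃ K : ℕ → ℕ → ℝ, K = fun m n : ℕ => if m = n then b - a else 2 * M / |(m:ℝ) - n| := ⟨_, rfl⟩
  have hK0 : ∀ m n, 0 ≤ K m n := by
    intro m n
    rw [hK]; dsimp only
    split_ifs
    · linarith
    · positivity
  have hsumK : ∀ m ∈ Finset.Icc 1 M, ∑ n ∈ Finset.Icc 1 M, K m n ≤ (b - a) + 4 * M * (1 + Real.log M) := by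
    intro m hm
    have h1 := sum_inv_abs_sub_le (Finset.mem_Icc.1 hm).2
    have h2 : ∀ n ∈ Finset.Icc 1 M, K m n = (if m = n then b - a else 0) + 2 * M * (if m = n then 0 else 1 / |(m:ℝ) - n|) := by
      intro n _
      rw [hK]; dsimp only
      split_ifs <;> ring
    rw [Finset.sum_congr rfl h2, Finset.sum_add_distrib, ← Finset.mul_sum, Finset.sum_ite_eq, if_pos hm]
    have hM0 : (0:ℝ) ≤ 2 * M := by positivity
    have := mul_le_mul_of_nonneg_left h1 hM0
    linarith
  have hinner : ∀ f ∈ S, ∑ g ∈ S, K (∏ i, f i) (∏ i, g i) ≤ k.factorial * ((b - a) + 4 * M * (1 + Real.log M)) := by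
    intro f hf
    rw [← Finset.sum_fiberwise_of_maps_to hN]
    calc _ ≤ ∑ n ∈ Finset.Icc 1 M, (k.factorial : ℝ) * K (∏ i, f i) n := by
          refine Finset.sum_le_sum fun n _ => ?_
          have : ∑ g ∈ S with ∏ i, g i = n, K (∏ i, f i) (∏ i, g i) = ∑ g ∈ S with ∏ i, g i = n, K (∏ i, f i) n :=
            Finset.sum_congr rfl fun g hg => by rw [(Finset.mem_filter.1 hg).2]
          rw [this, Finset.sum_const, nsmul_eq_mul]
          have h3 := card_filter_prod_eq_le S (fun f hf i => (hP _ (hmem f hf i)).1) n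
          have := hK0 (∏ i, f i) n
          gcongr
      _ ≤ _ := by
          rw [← Finset.mul_sum]
          gcongr
          exact hsumK _ (hN f hf)
  have hcard : (S.card : ℝ) ≤ (W:ℝ) ^ k := by
    rw [hS, Fintype.card_piFinset]
    have hPc : P.card ≤ W := by
      calc P.card ≤ (Finset.Ico W (2 * W)).card := Finset.card_le_card fun p hp => by
            rw [Finset.mem_Ico]; exact (hP p hp).2
        _ = W := by rw [Nat.card_Ico]; omega
    simp only [Finset.prod_const, Finset.card_univ, Fintype.card_fin]
    exact_mod_cast Nat.pow_le_pow_left hPc k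
  have hMr : (M:ℝ) = (2 * W) ^ k := by rw [hM]; push_cast; rfl
  rw [← hMr]
  have hL : 0 ≤ Real.log M := Real.log_natCast_nonneg M
  calc _ ≤ ∑ f ∈ S, ∑ g ∈ S, 1 / (W:ℝ) ^ k * (1 / (W:ℝ) ^ k) * K (∏ i, f i) (∏ i, g i) := by
        refine Finset.sum_le_sum fun f hf => Finset.sum_le_sum fun g hg => ?_
        have h1 := Finset.mem_Icc.1 (hN f hf)
        have h2 := Finset.mem_Icc.1 (hN g hg)
        have h3 : ‖∫ u in a..b, Complex.exp ((u * (-Real.log ((∏ i, f i : ℕ) : ℝ) - -Real.log ((∏ i, g i : ℕ) : ℝ)) : ℝ) * Complex.I)‖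
            ≤ K (∏ i, f i) (∏ i, g i) := by
          have h4 := norm_integral_cexp_log_le (M := M) hab h2.1 h1.1 (by exact_mod_cast h2.2) (by exact_mod_cast h1.2)
          rw [hK]; dsimp only
          have e1 : ∀ x y : ℝ, -x - -y = y - x := fun x y => by ring
          rw [e1]
          refine h4.trans (le_of_eq ?_)
          rw [abs_sub_comm]
          simp only [eq_comm]
        gcongr
        · exact hcf f hf
        · exact hcf g hg
    _ = 1 / (W:ℝ) ^ k * (1 / (W:ℝ) ^ k) * ∑ f ∈ S, ∑ g ∈ S, K (∏ i, f i) (∏ i, g i) := by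
        simp_rw [← Finset.mul_sum]
    _ ≤ 1 / (W:ℝ) ^ k * (1 / (W:ℝ) ^ k) * ∑ f ∈ S, k.factorial * ((b - a) + 4 * M * (1 + Real.log M)) := by
        gcongr with f hf
        exact hinner f hf
    _ = 1 / (W:ℝ) ^ k * (1 / (W:ℝ) ^ k) * (S.card * (k.factorial * ((b - a) + 4 * M * (1 + Real.log M)))) := by
        rw [Finset.sum_const, nsmul_eq_mul]
    _ ≤ 1 / (W:ℝ) ^ k * (1 / (W:ℝ) ^ k) * ((W:ℝ) ^ k * (k.factorial * ((b - a) + 4 * M * (1 + Real.log M)))) := by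
        have : 0 ≤ b - a := by linarith
        gcongr
    _ = _ := by field_simp

theorem measureReal_primeBlock_ge_le {L B η : ℝ} (hL : 17 ≤ L) (hB : 1 ≤ B) (hη : 0 < η) {j : ℕ}
    (hj : B * Real.log L ≤ j * Real.log 2) (hj2 : (j + 1) * Real.log 2 ≤ 2 * L ^ 6) :
    (volume.restrict (Ioc (Real.exp L) (2 * Real.exp L))).real
      {u : ℝ | (L ^ 6)⁻¹ ≤ ‖∑ p ∈ (Finset.Ico (2 ^ j) (2 ^ (j + 1)) : Finset ℕ) with p.Prime,
        (p : ℂ) ^ (-(((1 + η : ℝ) : ℂ) + u * Complex.I))‖} ≤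
      Real.exp (14 * (L / B + Real.log L)) * L ^ 8 := by
  obtain ⟨W, hW⟩ : ∃ W : ℕ, W = 2 ^ j := ⟨_, rfl⟩
  have hL0 : 0 < L := by linarith
  have hW1 : 1 ≤ W := hW ▸ Nat.one_le_two_pow
  have hW0 : (0:ℝ) < W := by exact_mod_cast hW1
  have hlogW : Real.log W = j * Real.log 2 := by rw [hW]; push_cast; rw [Real.log_pow]
  have hlog2W : Real.log (2 * W) = (j + 1) * Real.log 2 := by
    rw [Real.log_mul (by norm_num) hW0.ne', hlogW]; ring
  have hlL : 1 ≤ Real.log L := by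
    rw [Real.le_log_iff_exp_le hL0]; linarith [Real.exp_one_lt_d9]
  have hlW : 1 ≤ Real.log W := by rw [hlogW]; nlinarith
  obtain ⟨k, hk⟩ : ∃ k : ℕ, k = ⌈L / Real.log W⌉₊ := ⟨_, rfl⟩
  have hk1 : L ≤ k * Real.log W := by
    have := Nat.le_ceil (L / Real.log W)
    rw [← hk, div_le_iff₀ (by linarith)] at this; exact this
  have hk2 : (k:ℝ) ≤ L / Real.log W + 1 := by
    rw [hk]; exact (Nat.ceil_lt_add_one (by positivity)).le
  have hk3 : (k:ℝ) ≤ 2 * L := by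
    have : L / Real.log W ≤ L := div_le_self hL0.le hlW
    linarith
  have hk4 : k * Real.log L ≤ L / B + Real.log L := by
    have h1 : L / Real.log W * Real.log L ≤ L / B := by
      rw [div_mul_eq_mul_div, div_le_div_iff₀ (by linarith) (by linarith)]
      rw [mul_assoc]
      refine mul_le_mul_of_nonneg_left ?_ hL0.le
      rw [hlogW]; linarith
    have h2 := mul_le_mul_of_nonneg_right hk2 (show 0 ≤ Real.log L by linarith)
    linarith
  have hXW : Real.exp L ≤ (W:ℝ) ^ k := by
    rw [← Real.exp_log (pow_pos hW0 k), Real.log_pow]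
    exact Real.exp_le_exp.2 hk1
  obtain ⟨P, hP⟩ : ∃ P : Finset ℕ, P = (Finset.Ico (2 ^ j) (2 ^ (j + 1)) : Finset ℕ).filter Nat.Prime := ⟨_, rfl⟩
  have hPm : ∀ p ∈ P, p.Prime ∧ W ≤ p ∧ p < 2 * W := by
    intro p hp
    rw [hP, Finset.mem_filter, Finset.mem_Ico, pow_succ] at hp
    rw [hW]; exact ⟨hp.2, hp.1.1, by omega⟩
  obtain ⟨c, hc⟩ : ∃ c : ℕ → ℂ, c = fun p : ℕ => (((p:ℝ) ^ (-(1 + η)) : ℝ) : ℂ) := ⟨_, rfl⟩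
  have hcb : ∀ p ∈ P, ‖c p‖ ≤ 1 / W := by
    intro p hp
    have h1 := hPm p hp
    have hWp : (W:ℝ) ≤ p := by exact_mod_cast h1.2.1
    have h1p : (1:ℝ) ≤ p := by exact_mod_cast h1.1.one_lt.le
    rw [hc]; dsimp only
    rw [Complex.norm_real, Real.norm_of_nonneg (by positivity)]
    calc _ ≤ (p:ℝ) ^ (-1:ℝ) := Real.rpow_le_rpow_of_exponent_le h1p (by linarith)
      _ = 1 / (p:ℝ) := by rw [Real.rpow_neg_one, one_div]
      _ ≤ _ := by gcongr
  have hX0 := Real.exp_pos L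
  have h_int := integral_norm_sum_prime_pow_le hW1 k hPm c hcb (a := Real.exp L) (b := 2 * Real.exp L) (by linarith)
  have eA : ∀ u : ℝ, ∑ p ∈ P, (p : ℂ) ^ (-(((1 + η : ℝ) : ℂ) + u * Complex.I)) =
      ∑ p ∈ P, c p * Complex.exp ((-(u * Real.log p) : ℝ) * Complex.I) := by
    intro u
    refine Finset.sum_congr rfl fun p hp => ?_
    rw [natCast_cpow_neg_eq (hPm p hp).1.ne_zero, hc]
  rw [← hP]
  simp_rw [eA]
  rw [intervalIntegral.integral_of_le (by linarith)] at h_int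
  have hcont : Continuous fun u : ℝ => ‖∑ p ∈ P, c p * Complex.exp ((-(u * Real.log p) : ℝ) * Complex.I)‖ ^ (2 * k) := by
    fun_prop
  have hmk := mul_meas_ge_le_integral_of_nonneg (μ := volume.restrict (Ioc (Real.exp L) (2 * Real.exp L)))
    (Eventually.of_forall fun u => by positivity) (hcont.integrableOn_Ioc (a := Real.exp L) (b := 2 * Real.exp L)) (((L ^ 6)⁻¹) ^ (2 * k))
  have hsub : {u : ℝ | (L ^ 6)⁻¹ ≤ ‖∑ p ∈ P, c p * Complex.exp ((-(u * Real.log p) : ℝ) * Complex.I)‖} ⊆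
      {u : ℝ | ((L ^ 6)⁻¹) ^ (2 * k) ≤ ‖∑ p ∈ P, c p * Complex.exp ((-(u * Real.log p) : ℝ) * Complex.I)‖ ^ (2 * k)} := by
    intro u hu
    have hu' : (L ^ 6)⁻¹ ≤ ‖∑ p ∈ P, c p * Complex.exp ((-(u * Real.log p) : ℝ) * Complex.I)‖ := hu
    exact pow_le_pow_left₀ (by positivity) hu' _
  refine (measureReal_mono hsub).trans ?_
  obtain ⟨m, hm⟩ : ∃ m, m = (volume.restrict (Ioc (Real.exp L) (2 * Real.exp L))).real
    {u : ℝ | ((L ^ 6)⁻¹) ^ (2 * k) ≤ ‖∑ p ∈ P, c p * Complex.exp ((-(u * Real.log p) : ℝ) * Complex.I)‖ ^ (2 * k)} := ⟨_, rfl⟩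
  rw [← hm] at hmk ⊢
  have hm1 := hmk.trans h_int
  rw [inv_pow, inv_mul_le_iff₀ (by positivity)] at hm1
  refine hm1.trans ?_
  have hk2W : Real.log ((2 * (W:ℝ)) ^ k) ≤ 4 * L ^ 7 := by
    rw [Real.log_pow, hlog2W]
    calc (k:ℝ) * ((j + 1) * Real.log 2) ≤ (2 * L) * (2 * L ^ 6) := by gcongr
      _ = _ := by ring
  have hA : 4 * (1 + Real.log ((2 * (W:ℝ)) ^ k)) + 1 ≤ L ^ 8 := by
    have h1 : 17 * L ^ 7 ≤ L * L ^ 7 := by gcongr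
    have h2 : 1 ≤ L ^ 6 := one_le_pow₀ (by linarith)
    have h3 : 17 ≤ L ^ 7 := by
      calc (17:ℝ) ≤ L * 1 := by linarith
        _ ≤ L * L ^ 6 := by gcongr
        _ = _ := by ring
    nlinarith
  have hbr : 2 * Real.exp L - Real.exp L + 4 * (2 * (W:ℝ)) ^ k * (1 + Real.log ((2 * W) ^ k)) ≤ W ^ k * (2 ^ k * L ^ 8) := by
    have h2k : (1:ℝ) ≤ 2 ^ k := one_le_pow₀ (by norm_num)
    have hWk : (0:ℝ) < (W:ℝ) ^ k := pow_pos hW0 k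
    have h3 : (W:ℝ) ^ k * 1 ≤ (W:ℝ) ^ k * 2 ^ k := by gcongr
    have h4 : (W:ℝ) ^ k * (2 ^ k * (4 * (1 + Real.log ((2 * (W:ℝ)) ^ k)) + 1)) ≤ W ^ k * (2 ^ k * L ^ 8) := by gcongr
    have h5 : 4 * (2 * (W:ℝ)) ^ k * (1 + Real.log ((2 * W) ^ k)) = (W:ℝ) ^ k * (2 ^ k * (4 * (1 + Real.log ((2 * (W:ℝ)) ^ k)))) := by
      rw [mul_pow 2 (W:ℝ) k]; ring
    nlinarith
  have hfac : (k.factorial : ℝ) ≤ (2 * L) ^ k := by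
    calc (k.factorial : ℝ) ≤ (k:ℝ) ^ k := by exact_mod_cast Nat.factorial_le_pow k
      _ ≤ _ := by gcongr
  have hlog0 : 0 ≤ Real.log ((2 * (W:ℝ)) ^ k) := by
    refine Real.log_nonneg (one_le_pow₀ ?_)
    have : (1:ℝ) ≤ W := by exact_mod_cast hW1
    linarith
  have hpos : 0 ≤ 2 * Real.exp L - Real.exp L + 4 * (2 * (W:ℝ)) ^ k * (1 + Real.log ((2 * W) ^ k)) := by
    have : 0 ≤ 4 * (2 * (W:ℝ)) ^ k * (1 + Real.log ((2 * W) ^ k)) := by positivity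
    linarith
  calc _ ≤ (L ^ 6) ^ (2 * k) * ((2 * L) ^ k / (W:ℝ) ^ k * (W ^ k * (2 ^ k * L ^ 8))) := by
        gcongr
    _ = (4 * L ^ 13) ^ k * L ^ 8 := by
        have hWk : (W:ℝ) ^ k ≠ 0 := (pow_pos hW0 k).ne'
        have e4 : (4 * L ^ 13) ^ k = (L ^ 12) ^ k * (2 * L) ^ k * 2 ^ k := by
          rw [← mul_pow, ← mul_pow]; congr 1; ring
        rw [e4, pow_mul, show (L ^ 6) ^ 2 = L ^ 12 by ring]
        field_simp
    _ ≤ (L ^ 14) ^ k * L ^ 8 := by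
        have : 4 * L ^ 13 ≤ L * L ^ 13 := by gcongr; linarith
        gcongr
        linarith [show L ^ 14 = L * L ^ 13 by ring]
    _ = Real.exp (14 * (k * Real.log L)) * L ^ 8 := by
        congr 1
        rw [← pow_mul, ← Real.exp_log (pow_pos hL0 (14 * k)), Real.log_pow]
        push_cast; ring_nf
    _ ≤ _ := by gcongr

theorem eventually_three_mul_pow_le_exp : ∀ᶠ L : ℝ in atTop, 3 * L ^ 28 ≤ Real.exp (L / 96) := by
  have h := isLittleO_pow_exp_pos_mul_atTop 28 (show (0:ℝ) < 1 / 96 by norm_num)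
  have h1 := h.bound (show (0:ℝ) < 1 / 3 by norm_num)
  filter_upwards [h1, eventually_ge_atTop 0] with L hL h0
  rw [Real.norm_of_nonneg (by positivity), Real.norm_of_nonneg (by positivity)] at hL
  rw [show L / 96 = 1 / 96 * L by ring]
  linarith

/-- Away from a set of measure at most `X ^ (1 / 48)`, the inverse of `ζ` on the line `re s = 1` in
`(X, 2 X]` is at most a constant times `log (log X)`. -/
theorem exists_eventually_norm_inv_riemannZeta_le : ∃ C > 0, ∀ᶠ L : ℝ in atTop, ∃ E : Set ℝ, MeasurableSet E ∧
    (volume.restrict (Ioc (Real.exp L) (2 * Real.exp L))).real E ≤ Real.exp (L / 48) ∧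
    ∀ u ∈ Ioc (Real.exp L) (2 * Real.exp L), u ∉ E → ‖riemannZeta ((1:ℝ) + u * Complex.I)‖⁻¹ ≤ C * Real.log L := by
  obtain ⟨C, hC⟩ : ∃ C : ℝ, C = Real.exp 9 * 2700 := ⟨_, rfl⟩
  have hC0 : 0 < C := by rw [hC]; positivity
  refine ⟨2 * C, by positivity, ?_⟩
  have hlogle : ∀ᶠ L : ℝ in atTop, 1344 * Real.log L ≤ L ^ 6 := by
    filter_upwards [eventually_ge_atTop 1344] with L hL
    have h1 : Real.log L ≤ L := (Real.log_le_sub_one_of_pos (by linarith)).trans (by linarith)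
    have h2 : 1 ≤ L ^ 4 := one_le_pow₀ (by linarith)
    calc 1344 * Real.log L ≤ L * L * 1 := by nlinarith
      _ ≤ L * L * L ^ 4 := by gcongr
      _ = _ := by ring
  filter_upwards [hlogle, eventually_three_mul_pow_le_exp, eventually_ge_atTop 17, eventually_ge_atTop (136 * C)] with L h1 h2 hL h3
  have hL0 : 0 < L := by linarith
  have hl2 : 0 < Real.log 2 := Real.log_pos (by norm_num)
  have hl2' : 1 / 2 < Real.log 2 := by linarith [Real.log_two_gt_d9]
  have hl2'' : Real.log 2 < 1 := by linarith [Real.log_two_lt_d9]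
  have hlL : 1 ≤ Real.log L := by
    rw [Real.le_log_iff_exp_le hL0]; linarith [Real.exp_one_lt_d9]
  obtain ⟨i, hi⟩ : ∃ i : ℕ, i = ⌈1344 * Real.log L / Real.log 2⌉₊ := ⟨_, rfl⟩
  obtain ⟨J, hJ⟩ : ∃ J : ℕ, J = ⌈L ^ 6 / Real.log 2⌉₊ := ⟨_, rfl⟩
  have hiJ : i ≤ J := by rw [hi, hJ]; exact Nat.ceil_mono (by gcongr)
  have hi1 : 1344 * Real.log L ≤ i * Real.log 2 := by
    have := Nat.le_ceil (1344 * Real.log L / Real.log 2)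
    rwa [← hi, div_le_iff₀ hl2] at this
  have hi2 : 1 + (i:ℝ) ≤ 2700 * Real.log L := by
    have := Nat.ceil_lt_add_one (show 0 ≤ 1344 * Real.log L / Real.log 2 by positivity)
    rw [← hi] at this
    have h4 : 1344 * Real.log L / Real.log 2 ≤ 2688 * Real.log L := by
      rw [div_le_iff₀ hl2]; nlinarith
    linarith
  have hi3 : 1 ≤ i := by
    rw [hi]; exact Nat.one_le_ceil_iff.2 (by positivity)
  have hL6 : 1 ≤ L ^ 6 := one_le_pow₀ (by linarith)
  have hJ1 : L ^ 6 ≤ J * Real.log 2 := by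
    have := Nat.le_ceil (L ^ 6 / Real.log 2)
    rwa [← hJ, div_le_iff₀ hl2] at this
  have hJc := Nat.ceil_lt_add_one (show 0 ≤ L ^ 6 / Real.log 2 by positivity)
  rw [← hJ] at hJc
  have hJ2 : (J:ℝ) ≤ 3 * L ^ 6 := by
    have h4 : L ^ 6 / Real.log 2 ≤ 2 * L ^ 6 := by
      rw [div_le_iff₀ hl2]; nlinarith
    linarith
  have hJ3 : J * Real.log 2 ≤ 2 * L ^ 6 := by
    have h4 : J * Real.log 2 ≤ (L ^ 6 / Real.log 2 + 1) * Real.log 2 := by gcongr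
    rw [add_mul, div_mul_cancel₀ _ hl2.ne'] at h4
    linarith
  obtain ⟨η, hη⟩ : ∃ η : ℝ, η = (L ^ 4)⁻¹ := ⟨_, rfl⟩
  have hη0 : 0 < η := by rw [hη]; positivity
  have hη1 : η ≤ 1 := by rw [hη]; exact inv_le_one_of_one_le₀ (one_le_pow₀ (by linarith))
  obtain ⟨A, hA⟩ : ∃ A : ℕ → ℝ → ℂ, A = fun (j : ℕ) (u : ℝ) => ∑ p ∈ (Finset.Ico (2 ^ j) (2 ^ (j + 1)) : Finset ℕ) with p.Prime,
    (p : ℂ) ^ (-(((1 + η : ℝ) : ℂ) + u * Complex.I)) := ⟨_, rfl⟩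
  have hAc : ∀ j, Continuous (A j) := by
    intro j
    rw [hA]; dsimp only
    refine continuous_finsetSum _ fun p hp => ?_
    refine Continuous.const_cpow (by fun_prop) (Or.inl ?_)
    exact Nat.cast_ne_zero.2 (Finset.mem_filter.1 hp).2.ne_zero
  refine ⟨⋃ j ∈ Finset.Ico i J, {u : ℝ | (L ^ 6)⁻¹ ≤ ‖A j u‖}, ?_, ?_, ?_⟩
  · exact Finset.measurableSet_biUnion _ fun j _ => (isClosed_le continuous_const (hAc j).norm).measurableSet
  · refine (measureReal_biUnion_finset_le _ _).trans ?_
    calc _ ≤ ∑ j ∈ Finset.Ico i J, Real.exp (14 * (L / 1344 + Real.log L)) * L ^ 8 := by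
          refine Finset.sum_le_sum fun j hj => ?_
          rw [Finset.mem_Ico] at hj
          rw [hA]
          refine measureReal_primeBlock_ge_le hL (by norm_num) hη0 (hi1.trans ?_) (le_trans ?_ hJ3)
          · have : (i:ℝ) ≤ j := by exact_mod_cast hj.1
            gcongr
          · have : (j:ℝ) + 1 ≤ J := by exact_mod_cast hj.2
            gcongr
      _ ≤ 3 * L ^ 6 * (Real.exp (14 * (L / 1344 + Real.log L)) * L ^ 8) := by
          rw [Finset.sum_const, nsmul_eq_mul]
          have h5 : ((Finset.Ico i J).card : ℝ) ≤ J := by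
            rw [Nat.card_Ico]; exact_mod_cast Nat.sub_le _ _
          have := h5.trans hJ2
          gcongr
      _ = 3 * L ^ 28 * Real.exp (L / 96) := by
          have : Real.exp (14 * (L / 1344 + Real.log L)) = Real.exp (L / 96) * L ^ 14 := by
            rw [← Real.exp_log (pow_pos hL0 14), ← Real.exp_add, Real.log_pow]
            congr 1; push_cast; ring
          rw [this]; ring
      _ ≤ Real.exp (L / 96) * Real.exp (L / 96) := by gcongr
      _ = _ := by rw [← Real.exp_add]; congr 1; ring
  · intro u hu huE
    have hAu : ∀ j ∈ Finset.Ico i J, ‖A j u‖ ≤ (L ^ 6)⁻¹ := by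
      intro j hj
      by_contra hcon
      refine huE (mem_iUnion₂.2 ⟨j, hj, ?_⟩)
      exact (not_le.1 hcon).le
    have hexpL : L + 1 ≤ Real.exp L := Real.add_one_le_exp L
    have hu2 : 2 ≤ u := by have := hu.1; linarith
    have hsumA : ∑ j ∈ Finset.Ico i J, ‖A j u‖ ≤ 3 := by
      refine (Finset.sum_le_sum hAu).trans ?_
      rw [Finset.sum_const, nsmul_eq_mul]
      have h5 : ((Finset.Ico i J).card : ℝ) ≤ J := by
        rw [Nat.card_Ico]; exact_mod_cast Nat.sub_le _ _
      calc _ ≤ 3 * L ^ 6 * (L ^ 6)⁻¹ := by have := h5.trans hJ2; gcongr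
        _ = 3 := by field_simp
    have htail : ((2:ℝ) ^ J) ^ (-(η / 2)) * (1 + 2 / η) ≤ 1 := by
      have e1 : ((2:ℝ) ^ J) ^ (-(η / 2)) ≤ Real.exp (-(L ^ 2 / 2)) := by
        rw [Real.rpow_def_of_pos (by positivity), Real.log_pow]
        refine Real.exp_le_exp.2 ?_
        have : L ^ 6 * (η / 2) ≤ J * Real.log 2 * (η / 2) := by gcongr
        have e2 : L ^ 6 * (η / 2) = L ^ 2 / 2 := by rw [hη]; field_simp
        linarith
      have e3 : 1 + 2 / η ≤ Real.exp (L ^ 2 / 2) := by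
        have e4 := Real.pow_div_factorial_le_exp (L ^ 2 / 2) (by positivity) 3
        refine le_trans ?_ e4
        rw [hη, div_inv_eq_mul]
        have e5 : (289:ℝ) ≤ L ^ 2 := by nlinarith
        simp only [Nat.factorial]
        push_cast
        have e6 : 1 ≤ L ^ 4 := one_le_pow₀ (by linarith)
        have e7 : (L ^ 2 / 2) ^ 3 = L ^ 2 * L ^ 4 / 8 := by ring
        rw [e7]
        nlinarith
      calc _ ≤ Real.exp (-(L ^ 2 / 2)) * Real.exp (L ^ 2 / 2) := by gcongr
        _ = 1 := by rw [← Real.exp_add]; simp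
    have hz := norm_inv_riemannZeta_le_of_blocks (u := u) hη0 hi3 hiJ
    have hz1 : ‖riemannZeta ((1 + η : ℝ) + u * Complex.I)‖⁻¹ ≤ C * Real.log L := by
      refine hz.trans ?_
      rw [hA] at hsumA
      calc _ ≤ Real.exp (9 + Real.log (1 + i)) := Real.exp_le_exp.2 (by linarith)
        _ = Real.exp 9 * (1 + i) := by rw [Real.exp_add, Real.exp_log (by positivity)]
        _ ≤ Real.exp 9 * (2700 * Real.log L) := by gcongr
        _ = _ := by rw [hC]; ring
    have hd := norm_riemannZeta_sub_riemannZeta_le hu2 hη0.le hη1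
    have hlogu : Real.log u ≤ 2 * L := by
      have h6 := Real.log_le_log (by linarith) hu.2
      rw [Real.log_mul (by norm_num) (Real.exp_pos L).ne', Real.log_exp] at h6
      linarith
    have hlogu0 : 0 ≤ Real.log u := Real.log_nonneg (by linarith)
    have hdiff : 8 * η * Real.log u ^ 2 + 18 / u ≤ 68 / L ^ 2 := by
      have h7 : 8 * η * Real.log u ^ 2 ≤ 8 * η * (2 * L) ^ 2 := by gcongr
      have h8 : 8 * η * (2 * L) ^ 2 = 32 / L ^ 2 := by rw [hη]; field_simp; ring
      have h9 : 18 / u ≤ 36 / L ^ 2 := by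
        have h10 := Real.pow_div_factorial_le_exp L hL0.le 2
        norm_num [Nat.factorial] at h10
        rw [div_le_div_iff₀ (by linarith) (by positivity)]
        linarith [hu.1]
      have h11 : 32 / L ^ 2 + 36 / L ^ 2 = 68 / L ^ 2 := by ring
      linarith
    have hCl : 0 < C * Real.log L := by positivity
    have hsmall : 68 / L ^ 2 ≤ (2 * (C * Real.log L))⁻¹ := by
      have h12 : Real.log L ≤ L := (Real.log_le_sub_one_of_pos hL0).trans (by linarith)
      rw [← one_div, div_le_div_iff₀ (by positivity) (by positivity)]
      nlinarith
    have hne : riemannZeta ((1 + η : ℝ) + u * Complex.I) ≠ 0 := riemannZeta_ne_zero_of_one_le_re (by simp [hη0.le])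
    have hlow : (C * Real.log L)⁻¹ ≤ ‖riemannZeta ((1 + η : ℝ) + u * Complex.I)‖ := by
      rw [inv_le_comm₀ hCl (norm_pos_iff.2 hne)]; exact hz1
    have htri := norm_sub_norm_le (riemannZeta ((1 + η : ℝ) + u * Complex.I)) (riemannZeta ((1 : ℝ) + u * Complex.I))
    have hhalf : (C * Real.log L)⁻¹ = 2 * (2 * (C * Real.log L))⁻¹ := by field_simp
    have hfin : (2 * (C * Real.log L))⁻¹ ≤ ‖riemannZeta ((1 : ℝ) + u * Complex.I)‖ := by linarith
    calc _ ≤ ((2 * (C * Real.log L))⁻¹)⁻¹ := by gcongr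
      _ = _ := by rw [inv_inv]; ring

theorem one_le_norm_riemannZeta_product {x : ℝ} (hx : 0 < x) (y : ℝ) :
    1 ≤ ‖riemannZeta ((1 + x : ℝ) + (0:ℝ) * Complex.I)‖ ^ 3 * ‖riemannZeta ((1 + x : ℝ) + y * Complex.I)‖ ^ 4 *
      ‖riemannZeta ((1 + x : ℝ) + (2 * y : ℝ) * Complex.I)‖ := by
  have h := DirichletCharacter.norm_LFunction_product_ge_one (N := 1) (1 : DirichletCharacter ℂ 1) hx y
  have e : ∀ s, DirichletCharacter.LFunctionTrivChar 1 s = riemannZeta s := fun s => by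
    rw [DirichletCharacter.LFunctionTrivChar, DirichletCharacter.LFunction_modOne_eq]
  simp only [one_pow, e, norm_mul, norm_pow] at h
  refine h.trans (le_of_eq ?_)
  congr 3
  · push_cast; ring_nf
  · push_cast; ring_nf
  · push_cast; ring_nf

theorem eventually_norm_inv_riemannZeta_le_log_pow : ∃ C > 0, ∀ᶠ u : ℝ in atTop,
    ‖riemannZeta ((1:ℝ) + u * Complex.I)‖⁻¹ ≤ C * Real.log u ^ 7 := by
  refine ⟨8 * 128 ^ 3, by norm_num, ?_⟩
  have hlo := (Real.isLittleO_pow_log_id_atTop (n := 7)).bound (show (0:ℝ) < 1 / (18 * 16 * 128 ^ 3) by norm_num)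
  filter_upwards [hlo, eventually_ge_atTop (Real.exp 1)] with u h1 hu
  have he := Real.exp_one_gt_d9
  have hu2 : 2 ≤ u := by linarith
  have hl : 1 ≤ Real.log u := by rwa [Real.le_log_iff_exp_le (by linarith)]
  have hl0 : 0 < Real.log u := by linarith
  rw [id, Real.norm_of_nonneg (by positivity), Real.norm_of_nonneg (by linarith)] at h1
  obtain ⟨l, hl'⟩ : ∃ l, l = Real.log u := ⟨_, rfl⟩
  rw [← hl'] at h1 hl hl0 ⊢
  obtain ⟨η, hη⟩ : ∃ η : ℝ, η = (1 / 128) ^ 4 / l ^ 9 := ⟨_, rfl⟩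
  have hη0 : 0 < η := by rw [hη]; positivity
  have hl9 : 1 ≤ l ^ 9 := one_le_pow₀ hl
  have hη1 : η ≤ 1 := by
    rw [hη, div_le_one (by positivity)]; linarith [show ((1:ℝ) / 128) ^ 4 ≤ 1 by norm_num]
  have hp := one_le_norm_riemannZeta_product hη0 u
  have hz1 : ‖riemannZeta ((1 + η : ℝ) + (0:ℝ) * Complex.I)‖ ≤ 2 / η := by
    refine (norm_riemannZeta_le_one_add_inv hη0 0).trans ?_
    rw [le_div_iff₀ hη0, add_mul, one_div, inv_mul_cancel₀ hη0.ne']; linarith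
  have hz2 : ‖riemannZeta ((1 + η : ℝ) + (2 * u : ℝ) * Complex.I)‖ ≤ 26 * l := by
    refine (norm_riemannZeta_le_log (u := 2 * u) (by linarith) (by linarith) (by linarith)).trans ?_
    rw [Real.log_mul (by norm_num) (by linarith), ← hl']
    linarith [Real.log_two_lt_d9]
  have hd := norm_riemannZeta_sub_riemannZeta_le hu2 hη0.le hη1
  obtain ⟨z, hz⟩ : ∃ z, z = ‖riemannZeta ((1 + η : ℝ) + u * Complex.I)‖ := ⟨_, rfl⟩
  rw [← hz] at hp
  have hz0 : 0 ≤ z := hz ▸ norm_nonneg _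
  have hzlow : (1 / 128) ^ 3 / 4 / l ^ 7 ≤ z := by
    refine le_of_pow_le_pow_left₀ (n := 4) (by norm_num) hz0 ?_
    have h2 : 1 ≤ (2 / η) ^ 3 * z ^ 4 * (26 * l) := hp.trans (by gcongr)
    have h3 : (2 / η) ^ 3 * z ^ 4 * (26 * l) = 208 * l * z ^ 4 / η ^ 3 := by field_simp; ring
    rw [h3, le_div_iff₀ (by positivity), one_mul] at h2
    have h4 : η ^ 3 / (256 * l) ≤ z ^ 4 := by
      rw [div_le_iff₀ (by positivity)]
      have : 0 ≤ l * z ^ 4 := by positivity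
      linarith
    refine le_trans (le_of_eq ?_) h4
    rw [hη]
    field_simp
    norm_num
  have hdiff : 8 * η * l ^ 2 + 18 / u ≤ (1 / 128) ^ 3 / 8 / l ^ 7 := by
    have h5 : 8 * η * l ^ 2 = (1 / 128) ^ 3 / 16 / l ^ 7 := by rw [hη]; field_simp; norm_num
    have h6 : 18 / u ≤ (1 / 128) ^ 3 / 16 / l ^ 7 := by
      rw [div_le_div_iff₀ (by linarith) (by positivity)]
      linarith
    have h7 : (1 / 128) ^ 3 / 8 / l ^ 7 = (1 / 128) ^ 3 / 16 / l ^ 7 + (1 / 128) ^ 3 / 16 / l ^ 7 := by ring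
    linarith
  rw [← hl'] at hd
  have htri := norm_sub_norm_le (riemannZeta ((1 + η : ℝ) + u * Complex.I)) (riemannZeta ((1 : ℝ) + u * Complex.I))
  have h8 : (1 / 128) ^ 3 / 4 / l ^ 7 = (1 / 128) ^ 3 / 8 / l ^ 7 + (1 / 128) ^ 3 / 8 / l ^ 7 := by ring
  have hfin : (1 / 128) ^ 3 / 8 / l ^ 7 ≤ ‖riemannZeta ((1 : ℝ) + u * Complex.I)‖ := by
    rw [← hz] at htri; linarith
  calc _ ≤ ((1 / 128) ^ 3 / 8 / l ^ 7)⁻¹ := by gcongr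
    _ = _ := by field_simp

theorem integral_norm_zeta_pow_four_shift_le : ∃ C > 0, ∀ τ : ℝ, ∀ᶠ L : ℝ in atTop, ∀ σ : ℝ, 1 / 2 ≤ σ → σ ≤ 3 / 4 →
    ∫ t in (Real.exp L / 2)..(Real.exp L), ‖riemannZeta (σ + (t + τ : ℝ) * Complex.I)‖ ^ 4 ≤ C * (Real.exp L * L ^ 4) := by
  obtain ⟨C, hC, h⟩ := exists_integral_norm_zeta_pow_four_le
  refine ⟨3 * C, by positivity, fun τ => ?_⟩
  filter_upwards [Real.tendsto_exp_atTop.eventually_ge_atTop (12 + 4 * |τ|), eventually_ge_atTop 2] with L h1 h2 σ hs hs'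
  obtain ⟨X, hX⟩ : ∃ X, X = Real.exp L := ⟨_, rfl⟩
  have hlX : Real.log X = L := by rw [hX, Real.log_exp]
  rw [← hX] at h1 ⊢
  have hτ := abs_le.1 (le_refl |τ|)
  have hτ0 := abs_nonneg τ
  have hc : Continuous fun t : ℝ => ‖riemannZeta (σ + t * Complex.I)‖ ^ 4 :=
    (continuous_riemannZeta_vertical (by linarith : σ ≠ 1)).norm.pow 4
  have hi : ∀ a b : ℝ, IntervalIntegrable (fun t : ℝ => ‖riemannZeta (σ + t * Complex.I)‖ ^ 4) volume a b :=
    fun a b => hc.intervalIntegrable a b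
  rw [intervalIntegral.integral_comp_add_right (fun t : ℝ => ‖riemannZeta (σ + t * Complex.I)‖ ^ 4) τ]
  have hblock : ∀ Y : ℝ, 3 ≤ Y → Y ≤ X → ∫ t in Y..(2 * Y), ‖riemannZeta (σ + t * Complex.I)‖ ^ 4 ≤ C * (X * L ^ 4) := by
    intro Y hY hYX
    rw [intervalIntegral.integral_of_le (by linarith)]
    refine (h Y hY σ hs hs').trans ?_
    have h3 : 0 ≤ Real.log Y := Real.log_nonneg (by linarith)
    have h4 : Real.log Y ≤ L := hlX ▸ Real.log_le_log (by linarith) hYX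
    have h5 : 0 ≤ X := by linarith
    gcongr
  have b1 := hblock (X / 4) (by linarith) (by linarith)
  have b2 := hblock (X / 2) (by linarith) (by linarith)
  have b3 := hblock X (by linarith) le_rfl
  rw [show 2 * (X / 4) = X / 2 by ring] at b1
  rw [show 2 * (X / 2) = X by ring] at b2
  calc _ ≤ ∫ t in (X / 4)..(2 * X), ‖riemannZeta (σ + t * Complex.I)‖ ^ 4 :=
        intervalIntegral.integral_mono_interval (by linarith) (by linarith) (by linarith)
          (Eventually.of_forall fun t => by positivity) (hi _ _)
    _ = (∫ t in (X / 4)..(X / 2), ‖riemannZeta (σ + t * Complex.I)‖ ^ 4) +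
        (∫ t in (X / 2)..X, ‖riemannZeta (σ + t * Complex.I)‖ ^ 4) +
        ∫ t in X..(2 * X), ‖riemannZeta (σ + t * Complex.I)‖ ^ 4 := by
        rw [intervalIntegral.integral_add_adjacent_intervals (hi _ _) (hi _ _),
          intervalIntegral.integral_add_adjacent_intervals (hi _ _) (hi _ _)]
    _ ≤ _ := by linarith

theorem eventually_mul_pow_le_exp (A : ℝ) {b : ℝ} (hb : 0 < b) (n : ℕ) : ∀ᶠ L : ℝ in atTop, A * L ^ n ≤ Real.exp (b * L) := by
  have h := (isLittleO_pow_exp_pos_mul_atTop n hb).bound (show (0:ℝ) < 1 / (|A| + 1) by positivity)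
  filter_upwards [h, eventually_ge_atTop 0] with L hL h0
  rw [Real.norm_of_nonneg (by positivity), Real.norm_of_nonneg (by positivity), div_mul_eq_mul_div, one_mul,
    le_div_iff₀ (by positivity)] at hL
  have h1 : A * L ^ n ≤ (|A| + 1) * L ^ n := by
    gcongr; linarith [le_abs_self A]
  linarith

theorem integral_norm_zeta_pow_four_mul_inv_le : ∃ C > 0, ∀ τ : ℝ, ∀ᶠ L : ℝ in atTop, ∀ σ : ℝ, 1 / 2 ≤ σ → σ ≤ 3 / 4 →
    ∫ t in (Real.exp L / 2)..(Real.exp L), ‖riemannZeta (σ + (t + τ : ℝ) * Complex.I)‖ ^ 4 *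
      ‖riemannZeta ((1:ℝ) + (2 * t : ℝ) * Complex.I)‖⁻¹ ≤ C * (Real.exp L * L ^ 4 * Real.log L) := by
  obtain ⟨C₄, hC₄, h₄⟩ := integral_norm_zeta_pow_four_shift_le
  obtain ⟨S, hS, hsub⟩ := exists_norm_riemannZeta_pow_four_le
  obtain ⟨G, hG, hgood⟩ := exists_eventually_norm_inv_riemannZeta_le
  obtain ⟨B, hB, hbad⟩ := eventually_norm_inv_riemannZeta_le_log_pow
  obtain ⟨U, hU⟩ := eventually_atTop.1 hbad
  refine ⟨G * C₄ + 1, by positivity, fun τ => ?_⟩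
  filter_upwards [h₄ τ, hgood, Real.tendsto_exp_atTop.eventually_ge_atTop (12 + 4 * |τ|),
    Real.tendsto_exp_atTop.eventually_ge_atTop U, eventually_ge_atTop 17,
    eventually_mul_pow_le_exp (256 * S * B) (show (0:ℝ) < 1 / 48 by norm_num) 7] with L a1 a2 a3 a4 a5 a6 σ hs hs'
  obtain ⟨E, hEm, hE1, hE2⟩ := a2
  have b4 := a1 σ hs hs'
  obtain ⟨X, hX⟩ : ∃ X, X = Real.exp L := ⟨_, rfl⟩
  have hlX : Real.log X = L := by rw [hX, Real.log_exp]
  rw [← hX] at b4 a3 a4 hE1 hE2 ⊢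
  have hτ := abs_le.1 (le_refl |τ|)
  have hτ0 := abs_nonneg τ
  have hX0 : 0 < X := by linarith
  have hL0 : 0 < L := by linarith
  have hlL : 1 ≤ Real.log L := by
    rw [Real.le_log_iff_exp_le hL0]; linarith [Real.exp_one_lt_d9]
  obtain ⟨Q, hQ⟩ : ∃ Q, Q = 256 * S * B * X ^ (23/24:ℝ) * L ^ 7 := ⟨_, rfl⟩
  have hQ0 : 0 ≤ Q := by rw [hQ]; positivity
  have hc : Continuous fun t : ℝ => ‖riemannZeta (σ + (t + τ : ℝ) * Complex.I)‖ ^ 4 :=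
    ((continuous_riemannZeta_vertical (by linarith : σ ≠ 1)).comp (continuous_id.add continuous_const)).norm.pow 4
  have hpt : ∀ t ∈ Ioc (X / 2) X, ‖riemannZeta (σ + (t + τ : ℝ) * Complex.I)‖ ^ 4 *
      ‖riemannZeta ((1:ℝ) + (2 * t : ℝ) * Complex.I)‖⁻¹ ≤
      G * Real.log L * ‖riemannZeta (σ + (t + τ : ℝ) * Complex.I)‖ ^ 4 + Q * E.indicator (fun _ => (1:ℝ)) (2 * t) := by
    intro t ht
    have hu : 2 * t ∈ Ioc X (2 * X) := ⟨by linarith [ht.1], by linarith [ht.2]⟩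
    by_cases hE : 2 * t ∈ E
    · rw [indicator_of_mem hE]
      have c1 := hsub (t + τ) (by linarith [ht.1]) σ hs hs'
      have c2 := hU (2 * t) (by linarith [hu.1])
      have c3 : (t + τ) ^ (23/24:ℝ) ≤ 2 * X ^ (23/24:ℝ) := by
        calc (t + τ) ^ (23/24:ℝ) ≤ (2 * X) ^ (23/24:ℝ) := by
              refine Real.rpow_le_rpow ?_ ?_ (by norm_num) <;> linarith [ht.1, ht.2]
          _ = 2 ^ (23/24:ℝ) * X ^ (23/24:ℝ) := Real.mul_rpow (by norm_num) hX0.le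
          _ ≤ 2 ^ (1:ℝ) * X ^ (23/24:ℝ) := by
              gcongr <;> norm_num
          _ = _ := by rw [Real.rpow_one]
      have c4 : Real.log (2 * t) ≤ 2 * L := by
        have := Real.log_le_log (by linarith [hu.1]) hu.2
        rw [Real.log_mul (by norm_num) hX0.ne', hlX] at this
        linarith [Real.log_two_lt_d9]
      have c5 : 0 ≤ Real.log (2 * t) := Real.log_nonneg (by linarith [hu.1])
      have c6 : 0 ≤ G * Real.log L * ‖riemannZeta (σ + (t + τ : ℝ) * Complex.I)‖ ^ 4 := by positivity
      calc _ ≤ (S * (2 * X ^ (23/24:ℝ))) * (B * (2 * L) ^ 7) := by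
            refine mul_le_mul (c1.trans (by gcongr)) (c2.trans (by gcongr)) (by positivity) (by positivity)
        _ = Q := by rw [hQ]; ring
        _ ≤ _ := by linarith
    · rw [indicator_of_notMem hE, mul_zero, add_zero, mul_comm]
      have := hE2 (2 * t) hu hE
      gcongr
  have hindint : IntervalIntegrable (fun t : ℝ => E.indicator (fun _ => (1:ℝ)) (2 * t)) volume (X / 2) X := by
    rw [intervalIntegrable_iff_integrableOn_Ioc_of_le (by linarith)]
    refine Integrable.mono' (g := fun _ => (1:ℝ)) (integrable_const _) ?_ (Eventually.of_forall fun t => ?_)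
    · exact ((measurable_const.indicator hEm).comp (measurable_const_mul 2)).aestronglyMeasurable
    · by_cases h : 2 * t ∈ E
      · rw [indicator_of_mem h]; simp
      · rw [indicator_of_notMem h]; simp
  have hi1 : IntervalIntegrable (fun t : ℝ => G * Real.log L * ‖riemannZeta (σ + (t + τ : ℝ) * Complex.I)‖ ^ 4) volume (X / 2) X :=
    (hc.const_mul _).intervalIntegrable _ _
  have hi2 := hi1.add (hindint.const_mul Q)
  have hind : ∫ t in (X / 2)..X, E.indicator (fun _ => (1:ℝ)) (2 * t) ≤ Real.exp (L / 48) := by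
    rw [intervalIntegral.integral_comp_mul_left _ (by norm_num : (2:ℝ) ≠ 0), show 2 * (X / 2) = X by ring,
      intervalIntegral.integral_of_le (by linarith), integral_indicator hEm]
    simp only [integral_const, smul_eq_mul, mul_one, measureReal_restrict_apply_univ]
    have := measureReal_nonneg (μ := volume.restrict (Ioc X (2 * X))) (s := E)
    linarith
  calc _ ≤ ∫ t in (X / 2)..X, (G * Real.log L * ‖riemannZeta (σ + (t + τ : ℝ) * Complex.I)‖ ^ 4 +
        Q * E.indicator (fun _ => (1:ℝ)) (2 * t)) := by
        rw [intervalIntegral.integral_of_le (by linarith), intervalIntegral.integral_of_le (by linarith)]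
        refine integral_mono_of_nonneg (Eventually.of_forall fun t => by positivity) ?_ ?_
        · exact (intervalIntegrable_iff_integrableOn_Ioc_of_le (by linarith)).1 hi2
        · exact (ae_restrict_mem measurableSet_Ioc).mono hpt
    _ = G * Real.log L * (∫ t in (X / 2)..X, ‖riemannZeta (σ + (t + τ : ℝ) * Complex.I)‖ ^ 4) +
        Q * ∫ t in (X / 2)..X, E.indicator (fun _ => (1:ℝ)) (2 * t) := by
        rw [intervalIntegral.integral_add hi1 (hindint.const_mul Q), intervalIntegral.integral_const_mul,
          intervalIntegral.integral_const_mul]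
    _ ≤ G * Real.log L * (C₄ * (X * L ^ 4)) + Q * Real.exp (L / 48) := by gcongr
    _ ≤ G * Real.log L * (C₄ * (X * L ^ 4)) + X * 1 * 1 := by
        refine add_le_add le_rfl ?_
        calc Q * Real.exp (L / 48) = (256 * S * B * L ^ 7) * (X ^ (23/24:ℝ) * Real.exp (L / 48)) := by rw [hQ]; ring
          _ ≤ Real.exp (1 / 48 * L) * (X ^ (23/24:ℝ) * Real.exp (L / 48)) := by gcongr
          _ = X * 1 * 1 := by
              rw [hX, ← Real.exp_mul, ← Real.exp_add, ← Real.exp_add, mul_one, mul_one]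
              congr 1; ring
    _ ≤ G * Real.log L * (C₄ * (X * L ^ 4)) + X * L ^ 4 * Real.log L := by
        gcongr
        exact one_le_pow₀ (by linarith)
    _ = _ := by ring

theorem exists_continuous_eq_norm_inv_riemannZeta : ∃ D : ℝ → ℝ, Continuous D ∧ (∀ t, 0 ≤ D t) ∧
    ∀ t : ℝ, t ≠ 0 → D t = ‖riemannZeta ((1:ℝ) + (2 * t : ℝ) * Complex.I)‖⁻¹ := by
  have hne : ∀ t : ℝ, riemannZeta₁ ((1:ℝ) + (2 * t : ℝ) * Complex.I) ≠ 0 := by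
    intro t
    by_cases ht : t = 0
    · subst ht; simp
    · have h1 : ((1:ℝ) : ℂ) + (2 * t : ℝ) * Complex.I ≠ 1 := by simp [ht]
      have h2 : riemannZeta ((1:ℝ) + (2 * t : ℝ) * Complex.I) ≠ 0 := riemannZeta_ne_zero_of_one_le_re (by simp)
      rw [riemannZeta_eq_inv_sub_mul h1] at h2
      exact right_ne_zero_of_mul h2
  refine ⟨fun t => ‖((2 * t : ℝ) : ℂ) * Complex.I‖ * ‖riemannZeta₁ ((1:ℝ) + (2 * t : ℝ) * Complex.I)‖⁻¹, ?_, fun t => by positivity, ?_⟩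
  · refine Continuous.mul (by fun_prop) (Continuous.inv₀ ?_ fun t => norm_ne_zero_iff.2 (hne t))
    have := differentiable_riemannZeta₁.continuous
    fun_prop
  · intro t ht
    have h1 : ((1:ℝ) : ℂ) + (2 * t : ℝ) * Complex.I ≠ 1 := by simp [ht]
    rw [riemannZeta_eq_inv_sub_mul h1, norm_mul, norm_inv, mul_inv, inv_inv,
      show ((1:ℝ) : ℂ) + (2 * t : ℝ) * Complex.I - 1 = (2 * t : ℝ) * Complex.I by push_cast; ring]

theorem continuousOn_riemannZeta_vertical_strip (τ : ℝ) :
    ContinuousOn (fun q : ℝ × ℝ => riemannZeta (q.1 + (q.2 + τ : ℝ) * Complex.I)) (Icc (1 / 2) (3 / 4) ×ˢ univ) := by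
  intro q hq
  have hne : (q.1 : ℂ) + (q.2 + τ : ℝ) * Complex.I ≠ 1 := by
    intro h
    have := congrArg Complex.re h
    simp at this
    linarith [hq.1.2]
  have h1 : ContinuousAt riemannZeta ((q.1 : ℂ) + (q.2 + τ : ℝ) * Complex.I) := (differentiableAt_riemannZeta hne).continuousAt
  exact (ContinuousAt.comp (f := fun q : ℝ × ℝ => (q.1 : ℂ) + (q.2 + τ : ℝ) * Complex.I) h1 (by fun_prop)).continuousWithinAt

theorem le_norm_add_mul_I (a b : ℝ) : |b| ≤ ‖(a : ℂ) + (b : ℝ) * Complex.I‖ := by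
  have := Complex.abs_im_le_norm ((a : ℂ) + (b : ℝ) * Complex.I)
  simpa using this

theorem add_mul_I_ne_zero {a : ℝ} (ha : a ≠ 0) (b : ℝ) : (a : ℂ) + (b : ℝ) * Complex.I ≠ 0 := by
  intro h
  have := congrArg Complex.re h
  simp at this
  exact ha this

/-- Summation of dyadic bounds for the integral of a nonnegative function. -/
theorem integral_le_add_mul_of_dyadic {f : ℝ → ℝ} (hf : Continuous f) {T T₀ K M : ℝ} (hM : 0 ≤ M)
    (hK : ∀ x, 0 ≤ x → x ≤ T₀ → ∫ t in (0:ℝ)..x, f t ≤ K)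
    (hd : ∀ x, T₀ ≤ x → x ≤ T → ∫ t in (x / 2)..x, f t ≤ M) (n : ℕ) :
    ∀ x, 0 ≤ x → x ≤ T → x ≤ 2 ^ n * T₀ → ∫ t in (0:ℝ)..x, f t ≤ K + n * M := by
  induction n with
  | zero => intro x h0 _ h2; simpa using hK x h0 (by simpa using h2)
  | succ n ih =>
    intro x h0 h1 h2
    push_cast
    rcases le_total x T₀ with h | h
    · have := hK x h0 h
      have : 0 ≤ ((n:ℝ) + 1) * M := by positivity
      linarith
    · rw [← intervalIntegral.integral_add_adjacent_intervals (hf.intervalIntegrable 0 (x / 2)) (hf.intervalIntegrable (x / 2) x)]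
      have a1 := ih (x / 2) (by linarith) (by linarith) (by rw [pow_succ] at h2; linarith)
      have a2 := hd x h h1
      linarith

theorem integral_half_line_le {D : ℝ → ℝ} (hDc : Continuous D) (hD0 : ∀ t, 0 ≤ D t)
    (hD : ∀ t : ℝ, t ≠ 0 → D t = ‖riemannZeta ((1:ℝ) + (2 * t : ℝ) * Complex.I)‖⁻¹) (τ τ' : ℝ) {α : ℝ} (hα : α ≠ 0) :
    ∃ C > 0, ∀ σ T : ℝ, 1 / 2 ≤ σ → σ ≤ 3 / 4 → 3 ≤ T →
      ∫ t in (0:ℝ)..T, ‖riemannZeta (σ + (t + τ : ℝ) * Complex.I)‖ ^ 4 * D t / ‖(α : ℂ) + (t + τ' : ℝ) * Complex.I‖ ≤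
        C * Real.log T ^ 5 * Real.log (Real.log T) := by
  obtain ⟨C, hC, hblk⟩ := integral_norm_zeta_pow_four_mul_inv_le
  obtain ⟨L₀, hL₀⟩ := eventually_atTop.1 (hblk τ)
  obtain ⟨T₀, hT₀⟩ : ∃ T₀, T₀ = max (Real.exp L₀) (max 3 (4 * |τ'|)) := ⟨_, rfl⟩
  have hT₀1 : Real.exp L₀ ≤ T₀ := hT₀ ▸ le_max_left _ _
  have hT₀2 : 3 ≤ T₀ := hT₀ ▸ (le_max_left _ _).trans (le_max_right _ _)
  have hT₀3 : 4 * |τ'| ≤ T₀ := hT₀ ▸ (le_max_right _ _).trans (le_max_right _ _)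
  obtain ⟨f, hf⟩ : ∃ f : ℝ × ℝ → ℝ, f = fun q => ‖riemannZeta (q.1 + (q.2 + τ : ℝ) * Complex.I)‖ ^ 4 * D q.2 /
    ‖(α : ℂ) + (q.2 + τ' : ℝ) * Complex.I‖ := ⟨_, rfl⟩
  have hfc : ContinuousOn f (Icc (1 / 2) (3 / 4) ×ˢ univ) := by
    rw [hf]
    refine ContinuousOn.div (((continuousOn_riemannZeta_vertical_strip τ).norm.pow 4).mul
      (hDc.comp continuous_snd).continuousOn) (Continuous.continuousOn (by fun_prop)) fun q _ =>
      norm_ne_zero_iff.2 (add_mul_I_ne_zero hα _)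
  have hfσ : ∀ σ : ℝ, 1 / 2 ≤ σ → σ ≤ 3 / 4 → Continuous fun t => f (σ, t) := fun σ h1 h2 =>
    continuousOn_univ.1 (hfc.comp (Continuous.continuousOn (by fun_prop)) fun t _ => ⟨⟨h1, h2⟩, mem_univ _⟩)
  obtain ⟨K, hK⟩ := (isCompact_Icc.prod (isCompact_Icc (a := (0:ℝ)) (b := T₀))).exists_bound_of_continuousOn
    (hfc.mono (prod_mono_right (subset_univ _)))
  have hK0 : 0 ≤ K := (norm_nonneg _).trans (hK (1 / 2, 0) ⟨⟨le_rfl, by norm_num⟩, ⟨le_rfl, by linarith⟩⟩)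
  have hl3 : 1 < Real.log 3 := by
    rw [Real.lt_log_iff_exp_lt (by norm_num)]; linarith [Real.exp_one_lt_d9]
  have hll3 : 0 < Real.log (Real.log 3) := Real.log_pos hl3
  refine ⟨K * T₀ / Real.log (Real.log 3) + 12 * C, by positivity, fun σ T hs hs' hT => ?_⟩
  have hlT : Real.log 3 ≤ Real.log T := Real.log_le_log (by norm_num) hT
  have hllT : Real.log (Real.log 3) ≤ Real.log (Real.log T) := Real.log_le_log (by linarith) hlT
  have hlT1 : 1 ≤ Real.log T := by linarith
  have hllT0 : 0 < Real.log (Real.log T) := by linarith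
  have hsmall : ∀ x, 0 ≤ x → x ≤ T₀ → ∫ t in (0:ℝ)..x, f (σ, t) ≤ K * T₀ := by
    intro x h0 hx
    have := intervalIntegral.norm_integral_le_of_norm_le_const (f := fun t => f (σ, t)) (a := 0) (b := x) (C := K) fun t ht => by
      rw [uIoc_of_le h0] at ht
      exact hK (σ, t) ⟨⟨hs, hs'⟩, ⟨ht.1.le, ht.2.trans hx⟩⟩
    rw [sub_zero, abs_of_nonneg h0] at this
    calc _ ≤ _ := (le_abs_self _).trans this
      _ ≤ _ := by gcongr
  have hdy : ∀ x, T₀ ≤ x → x ≤ T → ∫ t in (x / 2)..x, f (σ, t) ≤ 4 * C * (Real.log T ^ 4 * Real.log (Real.log T)) := by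
    intro x hx hxT
    have hx0 : 0 < x := by linarith
    have hlx : L₀ ≤ Real.log x := by rw [Real.le_log_iff_exp_le hx0]; linarith
    have hb := hL₀ (Real.log x) hlx σ hs hs'
    rw [Real.exp_log hx0] at hb
    have hl1 : 1 ≤ Real.log x := by linarith [Real.log_le_log (by norm_num) (hT₀2.trans hx)]
    have hl2 : Real.log x ≤ Real.log T := Real.log_le_log hx0 hxT
    have hl3 : Real.log (Real.log x) ≤ Real.log (Real.log T) := Real.log_le_log (by linarith) hl2
    have hl4 : 0 ≤ Real.log (Real.log x) := Real.log_nonneg hl1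
    have hcZ : Continuous fun t : ℝ => ‖riemannZeta (σ + (t + τ : ℝ) * Complex.I)‖ ^ 4 * D t :=
      (((continuous_riemannZeta_vertical (by linarith : σ ≠ 1)).comp (continuous_id.add continuous_const)).norm.pow 4).mul hDc
    calc ∫ t in (x / 2)..x, f (σ, t) ≤ ∫ t in (x / 2)..x, 4 / x * (‖riemannZeta (σ + (t + τ : ℝ) * Complex.I)‖ ^ 4 * D t) := by
          refine intervalIntegral.integral_mono_on (by linarith) ((hfσ σ hs hs').intervalIntegrable _ _)
            ((hcZ.const_mul _).intervalIntegrable _ _) fun t ht => ?_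
          rw [hf]; dsimp only
          have hden : x / 4 ≤ ‖(α : ℂ) + (t + τ' : ℝ) * Complex.I‖ := by
            refine le_trans ?_ (le_norm_add_mul_I α (t + τ'))
            refine le_trans ?_ (le_abs_self _)
            linarith [ht.1, neg_abs_le τ']
          have := hD0 t
          rw [div_eq_inv_mul]
          gcongr
          rw [show 4 / x = (x / 4)⁻¹ by rw [inv_div]]
          gcongr
      _ = 4 / x * ∫ t in (x / 2)..x, ‖riemannZeta (σ + (t + τ : ℝ) * Complex.I)‖ ^ 4 *
            ‖riemannZeta ((1:ℝ) + (2 * t : ℝ) * Complex.I)‖⁻¹ := by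
          rw [intervalIntegral.integral_const_mul]
          congr 1
          refine intervalIntegral.integral_congr fun t ht => ?_
          rw [uIcc_of_le (by linarith)] at ht
          rw [hD t (by linarith [ht.1])]
      _ ≤ 4 / x * (C * (x * Real.log x ^ 4 * Real.log (Real.log x))) := by gcongr
      _ = 4 * C * (Real.log x ^ 4 * Real.log (Real.log x)) := by field_simp
      _ ≤ _ := by gcongr
  obtain ⟨n, hn⟩ : ∃ n : ℕ, n = ⌈Real.log T / Real.log 2⌉₊ := ⟨_, rfl⟩
  have hl2 : 0 < Real.log 2 := Real.log_pos (by norm_num)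
  have hn1 : T ≤ 2 ^ n := by
    have := Nat.le_ceil (Real.log T / Real.log 2)
    rw [← hn, div_le_iff₀ hl2, ← Real.log_pow] at this
    exact (Real.log_le_log_iff (by linarith) (by positivity)).1 this
  have hn2 : (n:ℝ) ≤ 3 * Real.log T := by
    have h1 := Nat.ceil_lt_add_one (show 0 ≤ Real.log T / Real.log 2 by positivity)
    rw [← hn] at h1
    have h2 : Real.log T / Real.log 2 ≤ 2 * Real.log T := by
      rw [div_le_iff₀ hl2]; nlinarith [Real.log_two_gt_d9]
    linarith
  have hmain := integral_le_add_mul_of_dyadic (hfσ σ hs hs') (by positivity) hsmall hdy n T (by linarith) le_rfl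
    (by
      have : (0:ℝ) < 2 ^ n := by positivity
      nlinarith)
  rw [hf] at hmain
  refine hmain.trans ?_
  have h5 : K * T₀ ≤ K * T₀ / Real.log (Real.log 3) * (Real.log T ^ 5 * Real.log (Real.log T)) := by
    rw [div_mul_eq_mul_div, le_div_iff₀ hll3]
    have h6 : 1 ≤ Real.log T ^ 5 := one_le_pow₀ hlT1
    have h7 : 1 * Real.log (Real.log 3) ≤ Real.log T ^ 5 * Real.log (Real.log T) := by gcongr
    rw [one_mul] at h7
    gcongr
  have h8 : n * (4 * C * (Real.log T ^ 4 * Real.log (Real.log T))) ≤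
      (3 * Real.log T) * (4 * C * (Real.log T ^ 4 * Real.log (Real.log T))) := by gcongr
  nlinarith

end

section

theorem norm_riemannZeta_neg_im (a b : ℝ) :
    ‖riemannZeta ((a : ℂ) + (-b : ℝ) * Complex.I)‖ = ‖riemannZeta ((a : ℂ) + b * Complex.I)‖ := by
  rw [← Complex.norm_conj (riemannZeta ((a : ℂ) + b * Complex.I)), ← riemannZeta_conj]
  congr 2
  simp

theorem norm_add_neg_mul_I (a b : ℝ) : ‖(a : ℂ) + (-b : ℝ) * Complex.I‖ = ‖(a : ℂ) + b * Complex.I‖ := by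
  rw [← Complex.norm_conj ((a : ℂ) + b * Complex.I)]
  congr 1
  simp

end

open Complex Finset
open scoped Classical

theorem zeta_fourth_moment_weighted (t' t'' σ' : ℝ) (hσ' : σ' ≠ 0) :
    ∃ C > 0, ∀ σ T : ℝ, 1 / 2 ≤ σ → σ ≤ 3 / 4 → 3 ≤ T →
      (∫ t in (-T)..T,
          ‖riemannZeta ((σ : ℂ) + ((t : ℂ) + (t' : ℂ)) * Complex.I)‖ ^ 4 /
            (‖riemannZeta (1 + 2 * (t : ℂ) * Complex.I)‖ *
              ‖(σ' : ℂ) + ((t : ℂ) + (t'' : ℂ)) * Complex.I‖)) ≤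
        C * (Real.log T) ^ 5 * Real.log (Real.log T) := by
  obtain ⟨D, hDc, hD0, hD⟩ := exists_continuous_eq_norm_inv_riemannZeta
  obtain ⟨C₁, hC₁, h₁⟩ := integral_half_line_le hDc hD0 hD t' t'' hσ'
  obtain ⟨C₂, hC₂, h₂⟩ := integral_half_line_le hDc hD0 hD (-t') (-t'') hσ'
  refine ⟨C₁ + C₂, by positivity, fun σ T hs hs' hT => ?_⟩
  obtain ⟨f, hf⟩ : ∃ f : ℝ → ℝ, f = fun t => ‖riemannZeta (σ + (t + t' : ℝ) * Complex.I)‖ ^ 4 * D t /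
    ‖(σ' : ℂ) + (t + t'' : ℝ) * Complex.I‖ := ⟨_, rfl⟩
  have hfc : Continuous f := by
    rw [hf]
    refine Continuous.div ((((continuous_riemannZeta_vertical (by linarith : σ ≠ 1)).comp
      (continuous_id.add continuous_const)).norm.pow 4).mul hDc) (by fun_prop) fun t =>
      norm_ne_zero_iff.2 (add_mul_I_ne_zero hσ' _)
  have hneg : ∫ t in (-T)..0, f t = ∫ t in (0:ℝ)..T, ‖riemannZeta (σ + (t + -t' : ℝ) * Complex.I)‖ ^ 4 * D t /
      ‖(σ' : ℂ) + (t + -t'' : ℝ) * Complex.I‖ := by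
    have := intervalIntegral.integral_comp_neg (a := 0) (b := T) f
    rw [neg_zero] at this
    rw [← this]
    refine intervalIntegral.integral_congr fun t _ => ?_
    have hDn : D (-t) = D t := by
      by_cases ht : t = 0
      · rw [ht, neg_zero]
      · rw [hD t ht, hD (-t) (neg_ne_zero.2 ht), mul_neg, norm_riemannZeta_neg_im]
    simp only [hf]
    rw [hDn, show -t + t' = -(t + -t') by ring, show -t + t'' = -(t + -t'') by ring,
      norm_riemannZeta_neg_im, norm_add_neg_mul_I]
  have hae : (∫ t in (-T)..T,
          ‖riemannZeta ((σ : ℂ) + ((t : ℂ) + (t' : ℂ)) * Complex.I)‖ ^ 4 /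
            (‖riemannZeta (1 + 2 * (t : ℂ) * Complex.I)‖ *
              ‖(σ' : ℂ) + ((t : ℂ) + (t'' : ℂ)) * Complex.I‖)) = ∫ t in (-T)..T, f t := by
    refine intervalIntegral.integral_congr_ae ?_
    filter_upwards [MeasureTheory.Measure.ae_ne MeasureTheory.volume (0:ℝ)] with t ht _
    rw [hf]
    dsimp only
    rw [hD t ht]
    push_cast
    rw [div_mul_eq_div_div, div_eq_mul_inv (_ ^ 4)]
  rw [hae, ← intervalIntegral.integral_add_adjacent_intervals (hfc.intervalIntegrable (-T) 0)
    (hfc.intervalIntegrable 0 T), hneg]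
  have e₁ := h₁ σ T hs hs' hT
  have e₂ := h₂ σ T hs hs' hT
  rw [hf]
  linarith
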